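/- arXiv:1608.04061 — 5 statements merged into one kernel-verified Lean document; each statement's English description precedes it below -/
import Mathlib

section
/- Let (X,d) be a metric space, μ a Borel measure on X, x₀ ∈ X, and let n ≥ 5 be an integer. If μ(B(x₀,t)) ≤ ωₙ tⁿ for every t > 0, then for every λ > 0, ∫_X (λ + d(x,x₀)²)^{-(n-2)} dμ(x) ≤ (2^{4-n} π^{(n+1)/2} / ((n-4) Γ((n-1)/2))) · λ^{(4-n)/2}; in particular this integral is finite. -/
open MeasureTheory

lemma aux_gamma (a r : ℝ) (ha : 0 < a) (hr : 0 < r) :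
    ∫⁻ t in Set.Ioi (0:ℝ), ENNReal.ofReal (t ^ (a - 1) * Real.exp (-(r * t))) =
      ENNReal.ofReal ((1 / r) ^ a * Real.Gamma a) := by
  have h := Real.integral_rpow_mul_exp_neg_mul_Ioi ha hr
  have hpos : 0 < (1 / r) ^ a * Real.Gamma a := by
    have := Real.Gamma_pos_of_pos ha
    positivity
  rw [← h, ofReal_integral_eq_lintegral_ofReal]
  · by_contra hc
    rw [integral_undef hc] at h
    linarith
  · filter_upwards [ae_restrict_mem measurableSet_Ioi] with t ht
    have : (0:ℝ) < t := ht
    simp only [Pi.zero_apply]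
    positivity

lemma aux_exp (c u : ℝ) (hu : 0 < u) :
    ∫⁻ t in Set.Ioi c, ENNReal.ofReal (u * Real.exp (-(u * t))) =
      ENNReal.ofReal (Real.exp (-(u * c))) := by
  have hi : IntegrableOn (fun t => Real.exp (-u * t)) (Set.Ioi c) :=
    integrableOn_exp_mul_Ioi (by linarith) c
  have h := integral_exp_mul_Ioi (a := -u) (by linarith) c
  rw [← ofReal_integral_eq_lintegral_ofReal]
  · rw [integral_const_mul]
    simp only [neg_mul] at h
    rw [h]
    congr 1
    field_simp
  · have := hi.const_mul u
    simpa only [neg_mul] using this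
  · exact Filter.Eventually.of_forall fun t => by simp only [Pi.zero_apply]; positivity

lemma aux_gauss {X : Type*} [MeasurableSpace X] (μ : Measure X) [SFinite μ] (d : X → ℝ)
    (hd : Measurable d) (hd0 : ∀ x, 0 ≤ d x) (n : ℕ) 
    (hvol : ∀ t > (0 : ℝ), μ {x | d x < t} ≤
        ENNReal.ofReal ((Real.pi ^ ((n : ℝ) / 2) / Real.Gamma ((n : ℝ) / 2 + 1)) * t ^ n))
    (u : ℝ) (hu : 0 < u) :
    ∫⁻ x, ENNReal.ofReal (Real.exp (-(u * d x ^ 2))) ∂μ ≤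
      ENNReal.ofReal (Real.pi ^ ((n : ℝ) / 2) * (1 / u) ^ ((n : ℝ) / 2)) := by
  have hG : 0 < Real.Gamma ((n : ℝ) / 2 + 1) := Real.Gamma_pos_of_pos (by positivity)
  set w := Real.pi ^ ((n : ℝ) / 2) / Real.Gamma ((n : ℝ) / 2 + 1) with hw
  have hw0 : 0 < w := by have := Real.pi_pos; positivity
  have e1 : ∀ x, ENNReal.ofReal (Real.exp (-(u * d x ^ 2))) =
      ∫⁻ t in Set.Ioi (0:ℝ), {p : X × ℝ | d p.1 ^ 2 < p.2}.indicator
        (fun p => ENNReal.ofReal (u * Real.exp (-(u * p.2)))) (x, t) := by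
    intro x
    rw [← aux_exp _ u hu]
    have : ∀ t, {p : X × ℝ | d p.1 ^ 2 < p.2}.indicator
        (fun p => ENNReal.ofReal (u * Real.exp (-(u * p.2)))) (x, t) =
        (Set.Ioi (d x ^ 2)).indicator (fun t => ENNReal.ofReal (u * Real.exp (-(u * t)))) t := by
      intro t
      simp only [Set.indicator, Set.mem_setOf_eq, Set.mem_Ioi]
    simp_rw [this]
    rw [setLIntegral_indicator measurableSet_Ioi]
    congr 2
    ext t
    simp only [Set.mem_inter_iff, Set.mem_Ioi]
    have := sq_nonneg (d x)
    constructor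
    · intro h; exact ⟨h, by linarith⟩
    · exact fun h => h.1
  have hd1 : Measurable fun p : X × ℝ => d p.1 := hd.comp measurable_fst
  have hms : MeasurableSet {p : X × ℝ | d p.1 ^ 2 < p.2} :=
    measurableSet_lt (hd1.pow_const 2) measurable_snd
  simp_rw [e1]
  rw [lintegral_lintegral_swap]
  swap
  · apply Measurable.aemeasurable
    apply Measurable.indicator _ hms
    fun_prop
  calc _ ≤ ∫⁻ t in Set.Ioi (0:ℝ), ENNReal.ofReal (w * u) *
            ENNReal.ofReal (t ^ (((n : ℝ) / 2 + 1) - 1) * Real.exp (-(u * t))) := by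
        apply setLIntegral_mono' measurableSet_Ioi
        intro t ht
        have ht : 0 < t := ht
        have : ∀ x, {p : X × ℝ | d p.1 ^ 2 < p.2}.indicator
          (fun p => ENNReal.ofReal (u * Real.exp (-(u * p.2)))) (x, t) =
          {x | d x < √t}.indicator (fun _ => ENNReal.ofReal (u * Real.exp (-(u * t)))) x := by
          intro x
          simp only [Set.indicator, Set.mem_setOf_eq, Real.lt_sqrt (hd0 x)]
        simp_rw [this]
        rw [lintegral_indicator_const (measurableSet_lt hd measurable_const)]
        calc _ ≤ ENNReal.ofReal (u * Real.exp (-(u * t))) * ENNReal.ofReal (w * √t ^ n) := by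
              gcongr
              exact hvol _ (Real.sqrt_pos.2 ht)
          _ = _ := by
              rw [← ENNReal.ofReal_mul (by positivity), ← ENNReal.ofReal_mul (by positivity)]
              congr 1
              have : √t ^ n = t ^ (((n : ℝ) / 2 + 1) - 1) := by
                rw [Real.sqrt_eq_rpow, ← Real.rpow_natCast, ← Real.rpow_mul ht.le]
                congr 1; ring
              rw [this]; ring
    _ = _ := by
        rw [lintegral_const_mul _ (by fun_prop), aux_gamma _ _ (by positivity) hu,
          ← ENNReal.ofReal_mul (by positivity), Real.rpow_add_one (by positivity)]
        congr 1
        rw [hw]; field_simp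

lemma aux_const (n : ℕ) (hn : 5 ≤ n) (lam : ℝ) (hlam : 0 < lam) :
    1 / Real.Gamma ((n:ℝ) - 2) * Real.pi ^ ((n : ℝ) / 2) *
      ((1 / lam) ^ ((n:ℝ) / 2 - 2) * Real.Gamma ((n:ℝ) / 2 - 2)) =
    (2 ^ ((4 : ℝ) - n) * Real.pi ^ (((n : ℝ) + 1) / 2) /
        (((n : ℝ) - 4) * Real.Gamma (((n : ℝ) - 1) / 2))) * lam ^ (((4 : ℝ) - n) / 2) := by
  have h5 : (5:ℝ) ≤ n := by exact_mod_cast hn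
  have h1 := Real.Gamma_mul_Gamma_add_half ((n:ℝ) / 2 - 1)
  have h2 := Real.Gamma_add_one (s := (n:ℝ) / 2 - 2) (by linarith)
  rw [show (n:ℝ) / 2 - 2 + 1 = n / 2 - 1 by ring] at h2
  rw [h2, show (n:ℝ) / 2 - 1 + 1 / 2 = (n - 1) / 2 by ring,
    show 2 * ((n:ℝ) / 2 - 1) = n - 2 by ring,
    show (1:ℝ) - (n - 2) = (4 - n) - 1 by ring, Real.rpow_sub_one (by norm_num)] at h1
  have g1 := Real.Gamma_pos_of_pos (s := (n:ℝ) - 2) (by linarith)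
  have g2 := Real.Gamma_pos_of_pos (s := (n:ℝ) / 2 - 2) (by linarith)
  have g3 := Real.Gamma_pos_of_pos (s := ((n:ℝ) - 1) / 2) (by linarith)
  have hl : (1 / lam) ^ ((n:ℝ) / 2 - 2) = lam ^ (((4 : ℝ) - n) / 2) := by
    rw [one_div, Real.inv_rpow hlam.le, ← Real.rpow_neg hlam.le]
    congr 1; ring
  have hp : Real.pi ^ (((n : ℝ) + 1) / 2) = Real.pi ^ ((n : ℝ) / 2) * √Real.pi := by
    rw [Real.sqrt_eq_rpow, ← Real.rpow_add Real.pi_pos]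
    congr 1; ring
  rw [hl, hp]
  have h4 : (n:ℝ) - 4 ≠ 0 := by linarith
  generalize Real.Gamma ((n:ℝ) - 2) = A at *
  generalize Real.Gamma ((n:ℝ) / 2 - 2) = B at *
  generalize Real.Gamma (((n:ℝ) - 1) / 2) = C at *
  generalize (2:ℝ) ^ ((4:ℝ) - n) = D at *
  have : B / A = D * √Real.pi / ((n - 4) * C) := by
    rw [div_eq_div_iff g1.ne' (mul_ne_zero h4 g3.ne')]
    linarith
  calc _ = Real.pi ^ ((n : ℝ) / 2) * lam ^ (((4 : ℝ) - n) / 2) * (B / A) := by ring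
    _ = _ := by rw [this]; ring

lemma aux_main {X : Type*} [MeasurableSpace X] (μ : Measure X) [SFinite μ] (d : X → ℝ)
    (hd : Measurable d) (hd0 : ∀ x, 0 ≤ d x) (n : ℕ) (hn : 5 ≤ n)
    (hvol : ∀ t > (0 : ℝ), μ {x | d x < t} ≤
        ENNReal.ofReal ((Real.pi ^ ((n : ℝ) / 2) / Real.Gamma ((n : ℝ) / 2 + 1)) * t ^ n))
    (lam : ℝ) (hlam : 0 < lam) :
    ∫⁻ x, ENNReal.ofReal ((lam + d x ^ 2) ^ (-((n : ℝ) - 2))) ∂μ ≤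
      ENNReal.ofReal ((2 ^ ((4 : ℝ) - n) * Real.pi ^ (((n : ℝ) + 1) / 2) /
        (((n : ℝ) - 4) * Real.Gamma (((n : ℝ) - 1) / 2))) * lam ^ (((4 : ℝ) - n) / 2)) := by
  have h5 : (5:ℝ) ≤ n := by exact_mod_cast hn
  have g1 := Real.Gamma_pos_of_pos (s := (n:ℝ) - 2) (by linarith)
  have hpi := Real.pi_pos
  have e1 : ∀ x, ENNReal.ofReal ((lam + d x ^ 2) ^ (-((n : ℝ) - 2))) =
      ENNReal.ofReal (1 / Real.Gamma ((n:ℝ) - 2)) * ∫⁻ t in Set.Ioi (0:ℝ),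
        ENNReal.ofReal (t ^ (((n:ℝ) - 2) - 1) * Real.exp (-((lam + d x ^ 2) * t))) := by
    intro x
    have hp : 0 < lam + d x ^ 2 := by positivity
    rw [aux_gamma _ _ (by linarith) hp, ← ENNReal.ofReal_mul (by positivity)]
    congr 1
    rw [one_div (lam + d x ^ 2), Real.inv_rpow hp.le, ← Real.rpow_neg hp.le]
    field_simp
  have hd1 : Measurable fun p : X × ℝ => d p.1 := hd.comp measurable_fst
  simp_rw [e1]
  rw [lintegral_const_mul' _ _ ENNReal.ofReal_ne_top, lintegral_lintegral_swap]
  swap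
  · apply Measurable.aemeasurable
    simp only [Function.uncurry_def]
    fun_prop
  rw [← aux_const n hn lam hlam, mul_assoc, ENNReal.ofReal_mul (by positivity)]
  gcongr
  rw [ENNReal.ofReal_mul (by positivity), ← aux_gamma _ _ (by linarith) hlam,
    ← lintegral_const_mul _ (by fun_prop)]
  apply setLIntegral_mono' measurableSet_Ioi
  intro t ht
  have ht : 0 < t := ht
  have : ∀ x, ENNReal.ofReal (t ^ (((n:ℝ) - 2) - 1) * Real.exp (-((lam + d x ^ 2) * t))) =
      ENNReal.ofReal (t ^ (((n:ℝ) - 2) - 1) * Real.exp (-(lam * t))) *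
        ENNReal.ofReal (Real.exp (-(t * d x ^ 2))) := by
    intro x
    rw [← ENNReal.ofReal_mul (by positivity), mul_assoc, ← Real.exp_add]
    congr 3; ring
  simp_rw [this]
  rw [lintegral_const_mul' _ _ ENNReal.ofReal_ne_top]
  refine (mul_le_mul_right (aux_gauss μ d hd hd0 n hvol t ht) _).trans (le_of_eq ?_)
  rw [← ENNReal.ofReal_mul (by positivity), ← ENNReal.ofReal_mul (by positivity)]
  congr 1
  have : t ^ ((n:ℝ) / 2 - 2 - 1) = t ^ ((n:ℝ) - 2 - 1) * (1 / t) ^ ((n:ℝ) / 2) := by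
    rw [one_div, Real.inv_rpow ht.le, ← Real.rpow_neg ht.le, ← Real.rpow_add ht]
    congr 1; ring
  rw [this]; ring

/-- If the measure of balls grows at most like the Euclidean volume,
`μ(B(x₀,t)) ≤ ωₙ tⁿ` for all `t > 0` (with `ωₙ = π^{n/2}/Γ(n/2+1)`), then for every `λ > 0`,
`∫_X (λ + d(x,x₀)²)^{-(n-2)} dμ ≤ (2^{4-n} π^{(n+1)/2}/((n-4)Γ((n-1)/2))) λ^{(4-n)/2}`;
in particular the integral is finite. -/
theorem stmt_2 {X : Type*} [MetricSpace X] [MeasurableSpace X] [BorelSpace X]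
    (μ : Measure X) (x₀ : X) (n : ℕ) (hn : 5 ≤ n)
    (hvol : ∀ t > (0 : ℝ),
      μ (Metric.ball x₀ t) ≤
        ENNReal.ofReal ((Real.pi ^ ((n : ℝ) / 2) / Real.Gamma ((n : ℝ) / 2 + 1)) * t ^ n))
    (lam : ℝ) (hlam : 0 < lam) :
    ∫⁻ x, ENNReal.ofReal ((lam + dist x x₀ ^ 2) ^ (-((n : ℝ) - 2))) ∂μ ≤
      ENNReal.ofReal ((2 ^ ((4 : ℝ) - n) * Real.pi ^ (((n : ℝ) + 1) / 2) /
        (((n : ℝ) - 4) * Real.Gamma (((n : ℝ) - 1) / 2))) * lam ^ (((4 : ℝ) - n) / 2)) := by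
  have hs : SigmaFinite μ := by
    refine ⟨⟨⟨fun k : ℕ => Metric.ball x₀ ((k : ℝ) + 1), fun _ => trivial, fun k => ?_, ?_⟩⟩⟩
    · exact (hvol _ (by positivity)).trans_lt ENNReal.ofReal_lt_top
    · ext x
      simp only [Set.mem_iUnion, Metric.mem_ball, Set.mem_univ, iff_true]
      obtain ⟨k, hk⟩ := exists_nat_gt (dist x x₀)
      exact ⟨k, by linarith⟩
  exact aux_main μ (fun x => dist x x₀) (by fun_prop) (fun _ => dist_nonneg) n hn hvol lam hlam
end

section
/- Let n ≥ 5 be an integer, 2♯ = 2n/(n-4), K₀ = [π² n(n-4)(n²-4)]^{-1} (Γ(n)/Γ(n/2))^{4/n}, and λ > 0. For the function u_λ(x) = (λ + |x|²)^{(4-n)/2} on ℝⁿ, one has the equality (∫_{ℝⁿ} |u_λ|^{2♯} dx)^{2/2♯} = K₀ ∫_{ℝⁿ} (Δu_λ)² dx, and both integrals are finite. -/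
open MeasureTheory

/-- The Euclidean Laplacian of `u : ℝⁿ → ℝ`: the sum of the second partial derivatives,
i.e. the trace of the second derivative in the standard orthonormal basis. -/
noncomputable def laplacian {n : ℕ} (u : EuclideanSpace ℝ (Fin n) → ℝ)
    (x : EuclideanSpace ℝ (Fin n)) : ℝ :=
  ∑ i : Fin n,
    iteratedFDeriv ℝ 2 u x ![EuclideanSpace.single i (1 : ℝ), EuclideanSpace.single i (1 : ℝ)]

section aux
open Set

theorem aux_int {n : ℕ} (p lam : ℝ) (hlam : 0 < lam) (hp : (n:ℝ)/2 < p) :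
    Integrable (fun x : EuclideanSpace ℝ (Fin n) => (lam + ‖x‖^2) ^ (-p)) ∧
    ∫ x : EuclideanSpace ℝ (Fin n), (lam + ‖x‖^2) ^ (-p) =
      Real.pi ^ ((n:ℝ)/2) * lam ^ ((n:ℝ)/2 - p) * Real.Gamma (p - n/2) / Real.Gamma p := by
  have hp0 : 0 < p := lt_of_le_of_lt (by positivity) hp
  have hG : 0 < Real.Gamma p := Real.Gamma_pos_of_pos hp0
  let F : EuclideanSpace ℝ (Fin n) → ℝ → ℝ := fun x t => t^(p-1) * Real.exp (-((lam + ‖x‖^2) * t))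
  have hF1 : ∀ x, ∫ t in Ioi (0:ℝ), F x t = Real.Gamma p * (lam + ‖x‖^2) ^ (-p) := by
    intro x
    have hs : 0 < lam + ‖x‖^2 := by positivity
    rw [Real.integral_rpow_mul_exp_neg_mul_Ioi hp0 hs, Real.rpow_neg hs.le, one_div,
      Real.inv_rpow hs.le, mul_comm]
  have hFe : ∀ x t, F x t = (t^(p-1) * Real.exp (-(lam * t))) * Real.exp (-t * ‖x‖^2) := by
    intro x t
    simp only [F]
    rw [mul_assoc, ← Real.exp_add]; ring_nf
  have hgi : ∀ t : ℝ, 0 < t → ∫ x : EuclideanSpace ℝ (Fin n), Real.exp (-t * ‖x‖^2) =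
      (Real.pi / t) ^ ((n:ℝ)/2) := by
    intro t ht
    simpa using GaussianFourier.integral_rexp_neg_mul_sq_norm (V := EuclideanSpace ℝ (Fin n)) ht
  have hgI : ∀ t : ℝ, 0 < t → Integrable (fun x : EuclideanSpace ℝ (Fin n) => Real.exp (-t * ‖x‖^2)) := by
    intro t ht
    by_contra h
    have := hgi t ht
    rw [integral_undef h] at this
    have h2 : 0 < (Real.pi / t) ^ ((n:ℝ)/2) := by positivity
    linarith
  have hF2 : ∀ t ∈ Ioi (0:ℝ), ∫ x, F x t = Real.pi ^ ((n:ℝ)/2) * (t ^ (p - n/2 - 1) * Real.exp (-(lam * t))) := by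
    intro t ht
    have ht : 0 < t := ht
    simp_rw [hFe]
    rw [integral_const_mul, hgi t ht, Real.div_rpow Real.pi_pos.le ht.le,
      show p - n/2 - 1 = (p - 1) - n/2 by ring, Real.rpow_sub ht (p-1) (n/2)]
    ring
  have hval := Real.integral_rpow_mul_exp_neg_mul_Ioi (a := p - n/2) (r := lam) (by linarith) hlam
  have hpos : 0 < p - n/2 := by linarith
  have hint : IntegrableOn (fun t => t ^ (p - n/2 - 1) * Real.exp (-(lam * t))) (Ioi 0) := by
    by_contra h
    rw [integral_undef h] at hval
    have h2 : 0 < (1/lam)^(p - n/2) * Real.Gamma (p - n/2) := 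
      mul_pos (by positivity) (Real.Gamma_pos_of_pos hpos)
    linarith
  have hprod : Integrable (Function.uncurry F) (volume.prod (volume.restrict (Ioi 0))) := by
    rw [integrable_prod_iff']
    · constructor
      · refine (ae_restrict_iff' measurableSet_Ioi).2 (Filter.Eventually.of_forall fun t ht => ?_)
        simp only [Function.uncurry, hFe]
        exact (hgI t ht).const_mul _
      · refine (integrableOn_congr_fun ?_ measurableSet_Ioi).1 (hint.const_mul (Real.pi ^ ((n:ℝ)/2)))
        intro t ht
        simp only
        rw [← hF2 t ht]
        congr 1; ext x
        simp only [Function.uncurry, F]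
        have ht : 0 < t := ht
        rw [Real.norm_of_nonneg (by positivity)]
    · apply Measurable.aestronglyMeasurable
      simp only [Function.uncurry_def, F]
      fun_prop
  have h1 := hprod.integral_prod_left
  have h2 := integral_integral_swap hprod
  simp only [Function.uncurry, hF1] at h1
  simp only [hF1] at h2
  rw [integral_const_mul, setIntegral_congr_fun measurableSet_Ioi hF2, integral_const_mul, hval] at h2
  constructor
  · have := h1.const_mul (Real.Gamma p)⁻¹
    simpa [← mul_assoc, inv_mul_cancel₀ hG.ne'] using this
  · rw [eq_div_iff hG.ne', mul_comm, h2, one_div, Real.inv_rpow hlam.le, ← Real.rpow_neg hlam.le]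
    ring_nf

theorem aux_grad {n : ℕ} (c lam : ℝ) (hlam : 0 < lam) (x : EuclideanSpace ℝ (Fin n)) :
    HasFDerivAt (fun y : EuclideanSpace ℝ (Fin n) => (lam + ‖y‖^2) ^ c)
      ((2 * c * (lam + ‖x‖^2) ^ (c-1)) • innerSL ℝ x) x := by
  have h := ((hasStrictFDerivAt_norm_sq x).hasFDerivAt.const_add lam).rpow_const (p := c)
    (Or.inl (by positivity))
  have e : (2 * c * (lam + ‖x‖^2) ^ (c-1)) • innerSL ℝ x =
      (c * (lam + ‖x‖ ^ 2) ^ (c - 1)) • 2 • (innerSL ℝ) x := by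
    rw [← Nat.cast_smul_eq_nsmul ℝ, smul_smul]
    congr 1
    push_cast; ring
  rw [e]
  exact h

theorem aux_lap {n : ℕ} (c lam : ℝ) (hlam : 0 < lam) (x : EuclideanSpace ℝ (Fin n)) :
    laplacian (fun y : EuclideanSpace ℝ (Fin n) => (lam + ‖y‖^2) ^ c) x
      = 2 * c * (lam + ‖x‖^2) ^ (c-1) * n + 4 * c * (c-1) * (lam + ‖x‖^2) ^ (c-2) * ‖x‖^2 := by
  have h1 : fderiv ℝ (fun y : EuclideanSpace ℝ (Fin n) => (lam + ‖y‖^2) ^ c) =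
      fun x => (2 * c * (lam + ‖x‖^2) ^ (c-1)) • innerSL ℝ x :=
    funext fun x => (aux_grad c lam hlam x).fderiv
  have h2 := ((aux_grad (c-1) lam hlam x).const_mul (2*c)).smul
    (innerSL ℝ (E := EuclideanSpace ℝ (Fin n))).hasFDerivAt
  unfold laplacian
  simp_rw [iteratedFDeriv_two_apply, h1]
  have h3 : fderiv ℝ (fun x => (2 * c * (lam + ‖x‖ ^ 2) ^ (c - 1)) • (innerSL ℝ) x) x = _ := h2.fderiv
  rw [h3]
  have hc : c - 1 - 1 = c - 2 := by ring
  simp [hc, EuclideanSpace.norm_sq_eq, Finset.sum_add_distrib, Finset.mul_sum, EuclideanSpace.inner_single_right]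
  have k : ∀ (y : EuclideanSpace ℝ (Fin n)) (i : Fin n),
      innerSL ℝ y (EuclideanSpace.single i (1:ℝ)) = y i := by
    intro y i
    rw [innerSL_apply_apply, EuclideanSpace.inner_single_right]
    simp
  congr 1
  · trans ∑ i : Fin n, 2 * c * (lam + ∑ j, x.ofLp j ^ 2) ^ (c - 1) * 1
    · refine Finset.sum_congr rfl fun i _ => ?_
      congr 1
      exact (k _ i).trans (by simp)
    · simp; ring
  · refine Finset.sum_congr rfl fun i _ => ?_
    trans 2 * c * (2 * (c - 1) * (lam + ∑ j, x.ofLp j ^ 2) ^ (c - 2) * x.ofLp i) * x.ofLp i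
    · congr 1
      exact k _ i
    · ring

end aux

/-- For `n ≥ 5`, `2♯ = 2n/(n-4)`,
`K₀ = [π² n(n-4)(n²-4)]⁻¹ (Γ(n)/Γ(n/2))^{4/n}` and `λ > 0`, the extremal function
`u_λ(x) = (λ+|x|²)^{(4-n)/2}` satisfies
`(∫_{ℝⁿ} |u_λ|^{2♯} dx)^{2/2♯} = K₀ ∫_{ℝⁿ} (Δu_λ)² dx`, and both integrals are finite. -/
theorem stmt_6 (n : ℕ) (hn : 5 ≤ n) (lam : ℝ) (hlam : 0 < lam) :
    Integrable (fun x : EuclideanSpace ℝ (Fin n) =>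
      |(lam + ‖x‖ ^ 2) ^ (((4 : ℝ) - n) / 2)| ^ (2 * (n : ℝ) / ((n : ℝ) - 4))) ∧
    Integrable (fun x : EuclideanSpace ℝ (Fin n) =>
      (laplacian (fun y : EuclideanSpace ℝ (Fin n) =>
        (lam + ‖y‖ ^ 2) ^ (((4 : ℝ) - n) / 2)) x) ^ 2) ∧
    (∫ x : EuclideanSpace ℝ (Fin n),
        |(lam + ‖x‖ ^ 2) ^ (((4 : ℝ) - n) / 2)| ^ (2 * (n : ℝ) / ((n : ℝ) - 4)))
        ^ (((n : ℝ) - 4) / (n : ℝ)) =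
      (Real.pi ^ 2 * (n : ℝ) * ((n : ℝ) - 4) * ((n : ℝ) ^ 2 - 4))⁻¹ *
        (Real.Gamma (n : ℝ) / Real.Gamma ((n : ℝ) / 2)) ^ ((4 : ℝ) / (n : ℝ)) *
      ∫ x : EuclideanSpace ℝ (Fin n),
        (laplacian (fun y : EuclideanSpace ℝ (Fin n) =>
          (lam + ‖y‖ ^ 2) ^ (((4 : ℝ) - n) / 2)) x) ^ 2 := by
  have hn5 : (5:ℝ) ≤ n := by exact_mod_cast hn
  obtain ⟨i0, e0⟩ := aux_int (n := n) (n:ℝ) lam hlam (by linarith)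
  obtain ⟨i1, e1⟩ := aux_int (n := n) ((n:ℝ)-1) lam hlam (by linarith)
  obtain ⟨i2, e2⟩ := aux_int (n := n) ((n:ℝ)-2) lam hlam (by linarith)
  have hA : ∀ x : EuclideanSpace ℝ (Fin n),
      |(lam + ‖x‖ ^ 2) ^ (((4 : ℝ) - n) / 2)| ^ (2 * (n : ℝ) / ((n : ℝ) - 4)) =
        (lam + ‖x‖^2) ^ (-(n:ℝ)) := by
    intro x
    have hs : 0 < lam + ‖x‖^2 := by positivity
    have h4 : (n:ℝ) - 4 ≠ 0 := by linarith
    rw [abs_of_pos (by positivity), ← Real.rpow_mul hs.le]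
    congr 1
    field_simp
    ring
  have hB : ∀ x : EuclideanSpace ℝ (Fin n),
      (laplacian (fun y : EuclideanSpace ℝ (Fin n) =>
        (lam + ‖y‖ ^ 2) ^ (((4 : ℝ) - n) / 2)) x) ^ 2 =
      (4 * ((n:ℝ)-4)^2) * (lam + ‖x‖^2) ^ (-((n:ℝ)-2)) +
      (4 * ((n:ℝ)-4)^2 * (n-2) * lam) * (lam + ‖x‖^2) ^ (-((n:ℝ)-1)) +
      (((n:ℝ)-4)^2 * (n-2)^2 * lam^2) * (lam + ‖x‖^2) ^ (-(n:ℝ)) := by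
    intro x
    rw [aux_lap _ _ hlam]
    have hs : 0 < lam + ‖x‖^2 := by positivity
    set r := ‖x‖^2
    have hr : r = (lam + r) - lam := by ring
    set s := lam + r
    have a1 : s ^ ((4 - (n:ℝ))/2 - 1) = s * s ^ (-(n:ℝ)/2) := by
      rw [mul_comm, ← Real.rpow_add_one hs.ne']; congr 1; ring
    have a2 : s ^ ((4 - (n:ℝ))/2 - 2) = s ^ (-(n:ℝ)/2) := by
      congr 1; ring
    have a3 : s ^ (-(n:ℝ)) = s ^ (-(n:ℝ)/2) * s ^ (-(n:ℝ)/2) := by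
      rw [← Real.rpow_add hs]; congr 1; ring
    have a4 : s ^ (-((n:ℝ)-1)) = s * s ^ (-(n:ℝ)) := by
      rw [mul_comm, ← Real.rpow_add_one hs.ne']; congr 1; ring
    have a5 : s ^ (-((n:ℝ)-2)) = s * s ^ (-((n:ℝ)-1)) := by
      rw [mul_comm, ← Real.rpow_add_one hs.ne']; congr 1; ring
    rw [a5, a4, a3, a1, a2, hr]
    ring
  simp only [hA, hB]
  have j2 := i2.const_mul (4 * ((n:ℝ)-4)^2)
  have j1 := i1.const_mul (4 * ((n:ℝ)-4)^2 * (n-2) * lam)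
  have j0 := i0.const_mul (((n:ℝ)-4)^2 * (n-2)^2 * lam^2)
  refine ⟨i0, (j2.add j1).add j0, ?_⟩
  rw [integral_add (by exact j2.add j1) j0, integral_add j2 j1, integral_const_mul, integral_const_mul,
    integral_const_mul]
  set I0 := ∫ x : EuclideanSpace ℝ (Fin n), (lam + ‖x‖^2) ^ (-(n:ℝ)) with hI0
  have g1 : Real.Gamma n = (n-1) * Real.Gamma ((n:ℝ)-1) := by
    have := Real.Gamma_add_one (s := (n:ℝ)-1) (by linarith)
    rwa [sub_add_cancel] at this
  have g2 : Real.Gamma ((n:ℝ)-1) = (n-2) * Real.Gamma ((n:ℝ)-2) := by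
    have := Real.Gamma_add_one (s := (n:ℝ)-2) (by linarith)
    rwa [show (n:ℝ)-2+1 = n-1 by ring] at this
  have g3 : Real.Gamma ((n:ℝ)-n/2) = (n/2-1) * Real.Gamma ((n:ℝ)-1-n/2) := by
    have := Real.Gamma_add_one (s := (n:ℝ)-1-n/2) (by linarith)
    rw [show (n:ℝ)-1-n/2+1 = n-n/2 by ring] at this
    rw [this]; ring
  have g4 : Real.Gamma ((n:ℝ)-1-n/2) = (n/2-2) * Real.Gamma ((n:ℝ)-2-n/2) := by
    have := Real.Gamma_add_one (s := (n:ℝ)-2-n/2) (by linarith)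
    rw [show (n:ℝ)-2-n/2+1 = n-1-n/2 by ring] at this
    rw [this]; ring
  have l1 : lam ^ ((n:ℝ)/2 - (n-1)) = lam * lam ^ ((n:ℝ)/2 - n) := by
    rw [mul_comm, ← Real.rpow_add_one hlam.ne']; congr 1; ring
  have l2 : lam ^ ((n:ℝ)/2 - (n-2)) = lam * lam ^ ((n:ℝ)/2 - (n-1)) := by
    rw [mul_comm, ← Real.rpow_add_one hlam.ne']; congr 1; ring
  have p2 : 0 < Real.Gamma ((n:ℝ)-2) := Real.Gamma_pos_of_pos (by linarith)
  have q2 : 0 < Real.Gamma ((n:ℝ)-2-n/2) := Real.Gamma_pos_of_pos (by linarith)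
  have n1 : (n:ℝ) - 1 ≠ 0 := by linarith
  have n2 : (n:ℝ) - 2 ≠ 0 := by linarith
  have n4 : (n:ℝ) - 4 ≠ 0 := by linarith
  have n0 : (n:ℝ) ≠ 0 := by linarith
  have n24 : (n:ℝ)^2 - 4 ≠ 0 := by nlinarith
  have E1 : ∫ x : EuclideanSpace ℝ (Fin n), (lam + ‖x‖^2) ^ (-((n:ℝ)-1)) =
      lam * I0 * (2 * (n-1) / (n-2)) := by
    rw [e1, e0, l1, g1, g2, g3]
    field_simp
  have E2 : ∫ x : EuclideanSpace ℝ (Fin n), (lam + ‖x‖^2) ^ (-((n:ℝ)-2)) =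
      lam^2 * I0 * (4 * (n-1) / (n-4)) := by
    rw [e2, e0, l2, l1, g1, g2, g3, g4]
    field_simp
    ring
  have hS : 4 * ((n:ℝ)-4)^2 * (lam^2 * I0 * (4 * (n-1) / (n-4))) +
      4 * ((n:ℝ)-4)^2 * (n-2) * lam * (lam * I0 * (2 * (n-1) / (n-2))) +
      ((n:ℝ)-4)^2 * (n-2)^2 * lam^2 * I0 = (n * (n-4) * (n^2-4)) * (lam^2 * I0) := by
    field_simp
    ring
  rw [E1, E2, hS]
  have G0 : 0 < Real.Gamma (n:ℝ) := Real.Gamma_pos_of_pos (by linarith)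
  have G1 : 0 < Real.Gamma ((n:ℝ)/2) := Real.Gamma_pos_of_pos (by linarith)
  set R := Real.Gamma (n:ℝ) / Real.Gamma ((n:ℝ)/2) with hR
  have hRp : 0 < R := by positivity
  have hI : I0 = Real.pi ^ ((n:ℝ)/2) * lam ^ (-((n:ℝ)/2)) * R⁻¹ := by
    rw [e0, hR, show (n:ℝ) - n/2 = n/2 by ring, show (n:ℝ)/2 - n = -(n/2) by ring, inv_div]
    ring
  have hIp : 0 < I0 := by rw [hI]; positivity
  have hk : I0 ^ (-((4:ℝ)/n)) = (Real.pi^2)⁻¹ * lam^2 * R ^ ((4:ℝ)/n) := by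
    rw [hI, Real.mul_rpow (by positivity) (by positivity), Real.mul_rpow (by positivity) (by positivity),
      ← Real.rpow_mul Real.pi_pos.le, ← Real.rpow_mul hlam.le, Real.inv_rpow hRp.le,
      ← Real.rpow_neg hRp.le, neg_neg,
      show (n:ℝ)/2 * -(4/n) = -(2:ℕ) by field_simp; norm_num,
      show -((n:ℝ)/2) * -(4/n) = (2:ℕ) by field_simp; norm_num,
      Real.rpow_neg Real.pi_pos.le, Real.rpow_natCast, Real.rpow_natCast]
  have hl : I0 ^ (((n:ℝ)-4)/n) = I0 ^ (-((4:ℝ)/n)) * I0 := by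
    rw [← Real.rpow_add_one hIp.ne']; congr 1; field_simp; ring
  rw [hl, hk]
  have := Real.pi_pos.ne'
  field_simp
end

section
/- Let n ≥ 5 be an integer, 2♯ = 2n/(n-4), and K₀ = [π² n(n-4)(n²-4)]^{-1} (Γ(n)/Γ(n/2))^{4/n}. Then for every smooth compactly supported function u : ℝⁿ → ℝ, (∫_{ℝⁿ} |u|^{2♯} dx)^{2/2♯} ≤ K₀ ∫_{ℝⁿ} (Δu)² dx. -/
open MeasureTheory

namespace HLS

set_option linter.unusedSectionVars false

section abs

variable {X : Type*} [MeasurableSpace X]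

/-- potential -/
noncomputable def pot (μ : Measure X) (K : X → X → ℝ) (F : X → ℝ) (x : X) : ℝ :=
  ∫ y, K x y * F y ∂μ

/-- energy -/
noncomputable def en (μ : Measure X) (K : X → X → ℝ) (F : X → ℝ) : ℝ :=
  ∫ x, pot μ K F x * F x ∂μ

/-- bounded measurable -/
def Bd (F : X → ℝ) : Prop := Measurable F ∧ ∃ C, ∀ x, |F x| ≤ C

structure Ker (μ : Measure X) (K : X → X → ℝ) (κ : ℝ) : Prop where
  meas : Measurable (Function.uncurry K)
  nonneg : ∀ x y, 0 ≤ K x y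
  int : ∀ x, Integrable (K x) μ
  tot : ∀ x, ∫ y, K x y ∂μ = κ
  symm : ∀ x y, K x y = K y x

theorem Bd.add {F G : X → ℝ} (hF : Bd F) (hG : Bd G) : Bd (fun x => F x + G x) := by
  obtain ⟨hF, C, hC⟩ := hF
  obtain ⟨hG, D, hD⟩ := hG
  exact ⟨hF.add hG, C + D, fun x => (abs_add_le _ _).trans (add_le_add (hC x) (hD x))⟩

theorem Bd.sub {F G : X → ℝ} (hF : Bd F) (hG : Bd G) : Bd (fun x => F x - G x) := by
  obtain ⟨hF, C, hC⟩ := hF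
  obtain ⟨hG, D, hD⟩ := hG
  exact ⟨hF.sub hG, C + D, fun x => (abs_sub _ _).trans (add_le_add (hC x) (hD x))⟩

theorem Bd.mul {F G : X → ℝ} (hF : Bd F) (hG : Bd G) : Bd (fun x => F x * G x) := by
  obtain ⟨hF, C, hC⟩ := hF
  obtain ⟨hG, D, hD⟩ := hG
  refine ⟨hF.mul hG, C * D, fun x => ?_⟩
  rw [abs_mul]
  exact mul_le_mul (hC x) (hD x) (abs_nonneg _) ((abs_nonneg _).trans (hC x))

theorem Bd.integrable {μ : Measure X} [IsFiniteMeasure μ] {F : X → ℝ} (hF : Bd F) :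
    Integrable F μ := by
  obtain ⟨hF, C, hC⟩ := hF
  exact Integrable.of_bound hF.aestronglyMeasurable C (Filter.Eventually.of_forall hC)

variable {μ : Measure X} [IsFiniteMeasure μ] {K : X → X → ℝ} {κ : ℝ}

theorem Ker.intmul (hK : Ker μ K κ) {F : X → ℝ} (hF : Bd F) (x : X) :
    Integrable (fun y => K x y * F y) μ := by
  obtain ⟨hF, C, hC⟩ := hF
  exact (hK.int x).mul_bdd (c := C) hF.aestronglyMeasurable (Filter.Eventually.of_forall hC)

theorem Ker.bd_pot (hK : Ker μ K κ) {F : X → ℝ} (hF : Bd F) : Bd (pot μ K F) := by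
  have h0 := hF
  obtain ⟨hF, C, hC⟩ := hF
  refine ⟨?_, κ * C, fun x => ?_⟩
  · have : Measurable (Function.uncurry fun x y => K x y * F y) :=
      hK.meas.mul (hF.comp measurable_snd)
    exact (this.stronglyMeasurable.integral_prod_right (ν := μ)).measurable
  · unfold pot
    calc |∫ y, K x y * F y ∂μ| ≤ ∫ y, |K x y * F y| ∂μ := abs_integral_le_integral_abs
      _ ≤ ∫ y, K x y * C ∂μ := by
        apply integral_mono (hK.intmul h0 x).abs ((hK.int x).mul_const C)
        intro y
        simp only [abs_mul, abs_of_nonneg (hK.nonneg x y)]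
        exact mul_le_mul_of_nonneg_left (hC y) (hK.nonneg x y)
      _ = κ * C := by rw [integral_mul_const, hK.tot]

theorem Ker.pot_add (hK : Ker μ K κ) {F G : X → ℝ} (hF : Bd F) (hG : Bd G) (x : X) :
    pot μ K (fun x => F x + G x) x = pot μ K F x + pot μ K G x := by
  unfold pot
  rw [← integral_add (hK.intmul hF x) (hK.intmul hG x)]
  congr 1; ext y; ring

theorem Ker.pot_sub (hK : Ker μ K κ) {F G : X → ℝ} (hF : Bd F) (hG : Bd G) (x : X) :
    pot μ K (fun x => F x - G x) x = pot μ K F x - pot μ K G x := by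
  unfold pot
  rw [← integral_sub (hK.intmul hF x) (hK.intmul hG x)]
  congr 1; ext y; ring

theorem Ker.parallelogram (hK : Ker μ K κ) {F G : X → ℝ} (hF : Bd F) (hG : Bd G) :
    en μ K (fun x => F x + G x) + en μ K (fun x => F x - G x) = 2 * en μ K F + 2 * en μ K G := by
  unfold en
  have e1 := ((hK.bd_pot (hF.add hG)).mul (hF.add hG)).integrable (μ := μ)
  have e2 := ((hK.bd_pot (hF.sub hG)).mul (hF.sub hG)).integrable (μ := μ)
  have e3 := (((hK.bd_pot hF).mul hF).integrable (μ := μ)).const_mul 2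
  have e4 := (((hK.bd_pot hG).mul hG).integrable (μ := μ)).const_mul 2
  rw [← integral_const_mul, ← integral_const_mul, ← integral_add e1 e2, ← integral_add e3 e4]
  congr 1; ext x
  rw [hK.pot_add hF hG, hK.pot_sub hF hG]; ring

structure Refl (μ : Measure X) (K : X → X → ℝ) (σ : X → X) (m : X → ℝ) (a b : ℝ) (N : Set X) :
    Prop where
  ha : 0 < a
  hb : 0 < b
  hσ : Measurable σ
  hm : Measurable m
  pos : ∀ x, 0 < m x
  bdd : ∃ C, ∀ x, m x ≤ C
  inv : ∀ x, σ (σ x) = x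
  minv : ∀ x, m (σ x) * m x = 1
  cv : ∀ g : X → ℝ, ∫ y, g (σ y) * ((m y) ^ a * (m y) ^ b) ∂μ = ∫ y, g y ∂μ
  null : μ N = 0
  Nσ : ∀ x, x ∉ N → σ x ∉ N
  cK : ∀ x, x ∉ N → ∀ᵐ y ∂μ, K (σ x) (σ y) * ((m x) ^ a * (m y) ^ a) = K x y
  sg : ∀ x, x ∉ N → ∀ᵐ y ∂μ, 0 ≤ (K x y - K x (σ y) * (m y) ^ a) * ((1 - m x) * (1 - m y))
  ne1 : ∀ᵐ y ∂μ, m y ≠ 1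

/-- pullback -/
noncomputable def pb (σ : X → X) (m : X → ℝ) (b : ℝ) (F : X → ℝ) (x : X) : ℝ :=
  (m x) ^ b * F (σ x)

/-- polarization -/
noncomputable def pol (σ : X → X) (m : X → ℝ) (b : ℝ) (F : X → ℝ) (x : X) : ℝ :=
  open Classical in if m x < 1 then max (F x) (pb σ m b F x) else min (F x) (pb σ m b F x)

variable {σ : X → X} {m : X → ℝ} {a b : ℝ} {N : Set X}

theorem Refl.mpow (h : Refl μ K σ m a b N) (c : ℝ) (x : X) : (m (σ x)) ^ c * (m x) ^ c = 1 := by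
  rw [← Real.mul_rpow (h.pos _).le (h.pos _).le, h.minv, Real.one_rpow]

theorem Refl.bdpow (h : Refl μ K σ m a b N) {c : ℝ} (hc : 0 < c) : Bd (fun x => (m x) ^ c) := by
  obtain ⟨C, hC⟩ := h.bdd
  refine ⟨h.hm.pow_const c, C ^ c, fun x => ?_⟩
  rw [abs_of_nonneg (Real.rpow_nonneg (h.pos x).le _)]
  exact Real.rpow_le_rpow (h.pos x).le (hC x) hc.le

theorem Refl.bdcomp (h : Refl μ K σ m a b N) {F : X → ℝ} (hF : Bd F) : Bd (fun x => F (σ x)) := by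
  obtain ⟨hF, C, hC⟩ := hF
  exact ⟨hF.comp h.hσ, C, fun x => hC _⟩

theorem Refl.bdpb (h : Refl μ K σ m a b N) {F : X → ℝ} (hF : Bd F) : Bd (pb σ m b F) :=
  (h.bdpow h.hb).mul (h.bdcomp hF)

theorem Refl.pbpb (h : Refl μ K σ m a b N) (F : X → ℝ) (x : X) :
    pb σ m b (pb σ m b F) x = F x := by
  unfold pb
  rw [h.inv, ← mul_assoc, mul_comm (m x ^ b), h.mpow, one_mul]

theorem Refl.bdpol (h : Refl μ K σ m a b N) {F : X → ℝ} (hF : Bd F) : Bd (pol σ m b F) := by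
  have h1 := h.bdpb hF
  obtain ⟨hF, C, hC⟩ := hF
  obtain ⟨hG, D, hD⟩ := h1
  refine ⟨?_, max C D, fun x => ?_⟩
  · unfold pol
    exact Measurable.ite (measurableSet_lt h.hm measurable_const) (hF.max hG) (hF.min hG)
  · unfold pol
    split_ifs
    · rcases max_choice (F x) (pb σ m b F x) with h | h <;> rw [h]
      · exact (hC x).trans (le_max_left _ _)
      · exact (hD x).trans (le_max_right _ _)
    · rcases min_choice (F x) (pb σ m b F x) with h | h <;> rw [h]
      · exact (hC x).trans (le_max_left _ _)
      · exact (hD x).trans (le_max_right _ _)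

theorem Refl.pb_pol (h : Refl μ K σ m a b N) (F : X → ℝ) (x : X) (hx : m x ≠ 1) :
    pb σ m b (pol σ m b F) x =
      if m x < 1 then min (F x) (pb σ m b F x) else max (F x) (pb σ m b F x) := by
  have hp := h.pos x
  have hp2 := h.pos (σ x)
  have hv := h.minv x
  have hb := h.mpow b x
  have hbn : 0 ≤ m x ^ b := Real.rpow_nonneg hp.le _
  have e1 : pb σ m b F (σ x) * m x ^ b = F x := by
    unfold pb; rw [h.inv, mul_right_comm, hb, one_mul]
  unfold pb pol
  change m x ^ b * (if m (σ x) < 1 then max (F (σ x)) (pb σ m b F (σ x)) else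
    min (F (σ x)) (pb σ m b F (σ x))) = _
  rcases lt_or_gt_of_ne hx with h1 | h1
  · have : ¬ m (σ x) < 1 := by
      intro h2; nlinarith
    rw [if_neg this, if_pos h1, mul_min_of_nonneg _ _ hbn, mul_comm _ (pb σ m b F (σ x)), e1,
      min_comm]
  · have : m (σ x) < 1 := by
      by_contra h2; nlinarith
    rw [if_pos this, if_neg (not_lt.2 h1.le), mul_max_of_nonneg _ _ hbn,
      mul_comm _ (pb σ m b F (σ x)), e1, max_comm]

theorem Refl.pot_pb (h : Refl μ K σ m a b N) (F : X → ℝ) (x : X) (hx : x ∉ N) :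
    pot μ K (pb σ m b F) x = (m x) ^ a * pot μ K F (σ x) := by
  unfold pot
  rw [← h.cv (fun y => K (σ x) y * F y), ← integral_const_mul]
  apply integral_congr_ae
  filter_upwards [h.cK x hx] with y hy
  rw [← hy]; unfold pb; ring

theorem Refl.aeN (h : Refl μ K σ m a b N) : ∀ᵐ x ∂μ, x ∉ N :=
  measure_eq_zero_iff_ae_notMem.1 h.null

theorem Refl.en_pb (h : Refl μ K σ m a b N) (F : X → ℝ) :
    en μ K (pb σ m b F) = en μ K F := by
  unfold en
  rw [← h.cv (fun x => pot μ K F x * F x)]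
  apply integral_congr_ae
  filter_upwards [h.aeN] with x hx
  rw [h.pot_pb F x hx]; unfold pb; ring

theorem Refl.pot_anti (h : Refl μ K σ m a b N) (hK : Ker μ K κ) {D : X → ℝ} (hD : Bd D)
    (hanti : ∀ᵐ y ∂μ, pb σ m b D y = - D y) (x : X) (hx : x ∉ N) :
    Integrable (fun y => (K x y - K x (σ y) * (m y) ^ a) * D y) μ ∧
    pot μ K D x = 2⁻¹ * ∫ y, (K x y - K x (σ y) * (m y) ^ a) * D y ∂μ := by
  have e : ∫ y, K x (σ y) * (m y) ^ a * D y ∂μ = - pot μ K D x := by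
    unfold pot
    rw [← h.cv (fun y => K x y * D y), ← integral_neg]
    apply integral_congr_ae
    filter_upwards [hanti] with y hy
    have : D y = - pb σ m b D y := by rw [hy]; ring
    rw [this]; unfold pb; ring
  have hi : Integrable (fun y => K x (σ y) * (m y) ^ a * D y) μ := by
    refine ((hK.intmul hD (σ x)).const_mul (m x ^ a)).congr ?_
    filter_upwards [h.cK (σ x) (h.Nσ x hx)] with y hy
    rw [h.inv] at hy
    rw [← hy]
    linear_combination (K x (σ y) * m y ^ a * D y) * h.mpow a x
  have : (fun y => (K x y - K x (σ y) * (m y) ^ a) * D y) =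
      fun y => K x y * D y - K x (σ y) * (m y) ^ a * D y := by ext y; ring
  rw [this]
  refine ⟨(hK.intmul hD x).sub hi, ?_⟩
  rw [integral_sub (hK.intmul hD x) hi, e]
  unfold pot; ring

/-- sign -/
noncomputable def eps (m : X → ℝ) (x : X) : ℝ := if m x < 1 then 1 else -1

theorem eps_sq (m : X → ℝ) (x : X) : eps m x * eps m x = 1 := by
  unfold eps; split_ifs <;> norm_num

theorem Refl.diff_pol (h : Refl μ K σ m a b N) (F : X → ℝ) (x : X) (hx : m x ≠ 1) :
    pol σ m b F x - pb σ m b (pol σ m b F) x = eps m x * |F x - pb σ m b F x| ∧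
    pol σ m b F x + pb σ m b (pol σ m b F) x = F x + pb σ m b F x := by
  rw [h.pb_pol F x hx]
  unfold pol eps
  split_ifs
  · rw [one_mul, max_add_min, max_sub_min_eq_abs, abs_sub_comm]; exact ⟨rfl, rfl⟩
  · rw [min_add_max, neg_one_mul, ← max_sub_min_eq_abs']; exact ⟨by ring, rfl⟩

theorem Refl.sub_anti (h : Refl μ K σ m a b N) (F : X → ℝ) (x : X) :
    pb σ m b (fun x => F x - pb σ m b F x) x = - (F x - pb σ m b F x) := by
  have := h.pbpb F x
  have e : pb σ m b (fun x => F x - pb σ m b F x) x = pb σ m b F x - pb σ m b (pb σ m b F) x := by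
    unfold pb; ring
  rw [e, this]; ring

theorem Refl.sgk (h : Refl μ K σ m a b N) (x : X) (hx : x ∉ N) (hx1 : m x ≠ 1) :
    ∀ᵐ y ∂μ, 0 ≤ (K x y - K x (σ y) * (m y) ^ a) * (eps m x * eps m y) := by
  filter_upwards [h.sg x hx, h.ne1] with y hy hy1
  unfold eps
  rcases lt_or_gt_of_ne hx1 with h1 | h1 <;> rcases lt_or_gt_of_ne hy1 with h2 | h2
  · rw [if_pos h1, if_pos h2]
    have := nonneg_of_mul_nonneg_left hy (mul_pos (sub_pos.2 h1) (sub_pos.2 h2))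
    linarith
  · rw [if_pos h1, if_neg (not_lt.2 h2.le)]
    have := nonpos_of_mul_nonneg_left hy (mul_neg_of_pos_of_neg (sub_pos.2 h1) (sub_neg.2 h2))
    linarith
  · rw [if_neg (not_lt.2 h1.le), if_pos h2]
    have := nonpos_of_mul_nonneg_left hy (mul_neg_of_neg_of_pos (sub_neg.2 h1) (sub_pos.2 h2))
    linarith
  · rw [if_neg (not_lt.2 h1.le), if_neg (not_lt.2 h2.le)]
    have := nonneg_of_mul_nonneg_left hy (mul_pos_of_neg_of_neg (sub_neg.2 h1) (sub_neg.2 h2))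
    linarith

theorem Refl.en_pol (h : Refl μ K σ m a b N) (hK : Ker μ K κ) {F : X → ℝ} (hF : Bd F) :
    en μ K F ≤ en μ K (pol σ m b F) := by
  set P := pol σ m b F with hP
  have bP : Bd P := h.bdpol hF
  have p1 := hK.parallelogram hF (h.bdpb hF)
  have p2 := hK.parallelogram bP (h.bdpb bP)
  rw [h.en_pb] at p1 p2
  have hS : en μ K (fun x => P x + pb σ m b P x) = en μ K (fun x => F x + pb σ m b F x) := by
    have ae : ∀ᵐ x ∂μ, P x + pb σ m b P x = F x + pb σ m b F x := by
      filter_upwards [h.ne1] with x hx using (h.diff_pol F x hx).2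
    have hp : ∀ x, pot μ K (fun x => P x + pb σ m b P x) x =
        pot μ K (fun x => F x + pb σ m b F x) x := by
      intro x
      apply integral_congr_ae
      filter_upwards [ae] with y hy
      rw [hy]
    unfold en
    apply integral_congr_ae
    filter_upwards [ae] with x hx
    rw [hx, hp]
  have bD := hF.sub (h.bdpb hF)
  have bDP := bP.sub (h.bdpb bP)
  have hDD : en μ K (fun x => F x - pb σ m b F x) ≤ en μ K (fun x => P x - pb σ m b P x) := by
    unfold en
    apply integral_mono_ae ((hK.bd_pot bD).mul bD).integrable ((hK.bd_pot bDP).mul bDP).integrable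
    filter_upwards [h.aeN, h.ne1] with x hx hx1
    obtain ⟨i1, e1⟩ := h.pot_anti hK bD (Filter.Eventually.of_forall (h.sub_anti F)) x hx
    obtain ⟨i2, e2⟩ := h.pot_anti hK bDP (Filter.Eventually.of_forall (h.sub_anti P)) x hx
    rw [e1, e2, mul_assoc, mul_assoc, ← integral_mul_const, ← integral_mul_const]
    apply mul_le_mul_of_nonneg_left _ (by norm_num)
    apply integral_mono_ae (i1.mul_const _) (i2.mul_const _)
    filter_upwards [h.sgk x hx hx1, h.ne1] with y hy hy1
    rw [(h.diff_pol F x hx1).1, (h.diff_pol F y hy1).1]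
    set D1 := F x - pb σ m b F x
    set D2 := F y - pb σ m b F y
    set k := (K x y - K x (σ y) * (m y) ^ a)
    have hk : |k| = k * (eps m x * eps m y) := by
      rw [← abs_of_nonneg hy, abs_mul, abs_mul]
      have : ∀ z, |eps m z| = 1 := by intro z; unfold eps; split_ifs <;> norm_num
      rw [this, this]; ring
    calc k * D2 * D1 ≤ |k * D2 * D1| := le_abs_self _
      _ = |k| * |D2| * |D1| := by rw [abs_mul, abs_mul]
      _ = _ := by rw [hk]; ring
  linarith

theorem Refl.pw (h : Refl μ K σ m a b N) (F : X → ℝ) (hF0 : ∀ x, 0 ≤ F x) (p : ℝ)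
    (hp : b * p = a + b) :
    ∫ x, (pb σ m b F x) ^ p ∂μ = ∫ x, (F x) ^ p ∂μ := by
  rw [← h.cv (fun x => F x ^ p)]
  congr 1; ext x
  unfold pb
  rw [Real.mul_rpow (Real.rpow_nonneg (h.pos x).le _) (hF0 _), ← Real.rpow_mul (h.pos x).le, hp,
    Real.rpow_add (h.pos x)]
  ring

theorem Bd.rpow {F : X → ℝ} (hF : Bd F) (hF0 : ∀ x, 0 ≤ F x) {p : ℝ} (hp : 0 ≤ p) :
    Bd (fun x => F x ^ p) := by
  obtain ⟨hF, C, hC⟩ := hF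
  refine ⟨hF.pow_const p, C ^ p, fun x => ?_⟩
  rw [abs_of_nonneg (Real.rpow_nonneg (hF0 x) _)]
  exact Real.rpow_le_rpow (hF0 x) ((le_abs_self _).trans (hC x)) hp

theorem Refl.pb_nonneg (h : Refl μ K σ m a b N) {F : X → ℝ} (hF0 : ∀ x, 0 ≤ F x) (x : X) :
    0 ≤ pb σ m b F x := mul_nonneg (Real.rpow_nonneg (h.pos x).le _) (hF0 _)

theorem Refl.pol_nonneg (h : Refl μ K σ m a b N) {F : X → ℝ} (hF0 : ∀ x, 0 ≤ F x) (x : X) :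
    0 ≤ pol σ m b F x := by
  unfold pol
  split_ifs
  · exact (hF0 x).trans (le_max_left _ _)
  · exact le_min (hF0 x) (h.pb_nonneg hF0 x)

theorem Refl.pol_le (h : Refl μ K σ m a b N) {F : X → ℝ} {M : ℝ} (hM : 0 ≤ M)
    (hFM : ∀ x, F x ≤ M) (x : X) : pol σ m b F x ≤ M := by
  unfold pol
  split_ifs with h1
  · refine max_le (hFM x) ?_
    unfold pb
    have : m x ^ b ≤ 1 := Real.rpow_le_one (h.pos x).le h1.le h.hb.le
    have h0 : 0 ≤ m x ^ b := Real.rpow_nonneg (h.pos x).le _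
    calc m x ^ b * F (σ x) ≤ m x ^ b * M := mul_le_mul_of_nonneg_left (hFM _) h0
      _ ≤ 1 * M := mul_le_mul_of_nonneg_right this hM
      _ = M := one_mul _
  · exact (min_le_left _ _).trans (hFM x)

theorem Refl.pol_pow (h : Refl μ K σ m a b N) {F : X → ℝ} (hF : Bd F) (hF0 : ∀ x, 0 ≤ F x) (p : ℝ)
    (hp : b * p = a + b) (hp0 : 0 ≤ p) :
    ∫ x, (pol σ m b F x) ^ p ∂μ = ∫ x, (F x) ^ p ∂μ := by
  have e1 := h.pw F hF0 p hp
  have e2 := h.pw _ (h.pol_nonneg hF0) p hp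
  have b1 := (hF.rpow hF0 hp0).integrable (μ := μ)
  have b2 := ((h.bdpb hF).rpow (h.pb_nonneg hF0) hp0).integrable (μ := μ)
  have b3 := ((h.bdpol hF).rpow (h.pol_nonneg hF0) hp0).integrable (μ := μ)
  have b4 := ((h.bdpb (h.bdpol hF)).rpow (h.pb_nonneg (h.pol_nonneg hF0)) hp0).integrable (μ := μ)
  have : ∫ x, (F x ^ p + pb σ m b F x ^ p) ∂μ =
      ∫ x, (pol σ m b F x ^ p + pb σ m b (pol σ m b F) x ^ p) ∂μ := by
    apply integral_congr_ae
    filter_upwards [h.ne1] with x hx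
    rw [h.pb_pol F x hx]
    unfold pol
    rcases le_total (F x) (pb σ m b F x) with h1 | h1 <;> split_ifs <;> simp [h1, add_comm]
  rw [integral_add b1 b2, integral_add b3 b4] at this
  linarith

/-- If polarization does not increase the total mass, then `F` is polarized. -/
theorem Refl.polarized (h : Refl μ K σ m a b N) {F : X → ℝ} (hF : Bd F)
    (hJ : ∫ x, pol σ m b F x ∂μ ≤ ∫ x, F x ∂μ) :
    ∀ᵐ x ∂μ, 0 ≤ eps m x * (F x - pb σ m b F x) := by
  set P := pol σ m b F with hP
  have bP : Bd P := h.bdpol hF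
  set E : X → ℝ := fun x => P x - F x with hE
  have bE : Bd E := bP.sub hF
  have hEx : ∀ᵐ x ∂μ, E x = 2⁻¹ * (eps m x * |F x - pb σ m b F x| - (F x - pb σ m b F x)) := by
    filter_upwards [h.ne1] with x hx
    obtain ⟨h1, h2⟩ := h.diff_pol F x hx
    rw [hE, ← h1]; simp only [← hP] at h2 ⊢; linarith
  have hEa : ∀ᵐ x ∂μ, pb σ m b E x = - E x := by
    filter_upwards [h.ne1] with x hx
    obtain ⟨h1, h2⟩ := h.diff_pol F x hx
    have : pb σ m b E x = pb σ m b P x - pb σ m b F x := by unfold pb; simp only [hE]; ring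
    rw [this]; simp only [hE, ← hP] at h2 ⊢; linarith
  have hint : ∫ x, E x * (1 - m x ^ a) ∂μ = 2 * ∫ x, E x ∂μ := by
    have : ∫ x, E x * m x ^ a ∂μ = - ∫ x, E x ∂μ := by
      rw [← h.cv E, ← integral_neg]
      apply integral_congr_ae
      filter_upwards [hEa] with x hx
      have : E x = - pb σ m b E x := by rw [hx]; ring
      rw [this]; unfold pb; ring
    simp only [mul_sub, mul_one]
    rw [integral_sub bE.integrable (bE.mul (h.bdpow h.ha)).integrable, this]; ring
  have hJ' : ∫ x, E x ∂μ ≤ 0 := by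
    rw [hE, integral_sub bP.integrable hF.integrable]; linarith
  have hnn : ∀ᵐ x ∂μ, 0 ≤ E x * (1 - m x ^ a) := by
    filter_upwards [hEx, h.ne1] with x hx hx1
    rw [hx]
    unfold eps
    rcases lt_or_gt_of_ne hx1 with h1 | h1
    · rw [if_pos h1]
      have := Real.rpow_lt_one (h.pos x).le h1 h.ha
      have h3 := le_abs_self (F x - pb σ m b F x)
      exact mul_nonneg (by linarith) (by linarith)
    · rw [if_neg (not_lt.2 h1.le)]
      have := Real.one_lt_rpow h1 h.ha
      have h3 := neg_abs_le (F x - pb σ m b F x)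
      exact mul_nonneg_of_nonpos_of_nonpos (by linarith) (by linarith)
  have hb1 : Bd (fun x => E x * (1 - m x ^ a)) :=
    bE.mul (Bd.sub ⟨measurable_const, 1, fun x => by simp⟩ (h.bdpow h.ha))
  have h0 : ∫ x, E x * (1 - m x ^ a) ∂μ = 0 :=
    le_antisymm (by linarith) (integral_nonneg_of_ae hnn)
  have hz := (integral_eq_zero_iff_of_nonneg_ae hnn hb1.integrable).1 h0
  filter_upwards [hz, hEx, h.ne1] with x hx hx2 hx1
  have hne : (1 - m x ^ a) ≠ 0 := by
    rcases lt_or_gt_of_ne hx1 with h1 | h1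
    · have := Real.rpow_lt_one (h.pos x).le h1 h.ha
      intro h; linarith
    · have := Real.one_lt_rpow h1 h.ha
      intro h; linarith
  have hE0 : E x = 0 := by
    rcases mul_eq_zero.1 hx with h | h
    · exact h
    · exact absurd h hne
  rw [hE0] at hx2
  have : F x - pb σ m b F x = eps m x * |F x - pb σ m b F x| := by linarith
  rw [this, ← mul_assoc, eps_sq, one_mul]
  exact abs_nonneg _

theorem Refl.pot_le (h : Refl μ K σ m a b N) (hK : Ker μ K κ) {F : X → ℝ} (hF : Bd F)
    (hpol : ∀ᵐ x ∂μ, 0 ≤ eps m x * (F x - pb σ m b F x)) (x : X) (hx : x ∉ N) (hx1 : m x < 1) :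
    m x ^ a * pot μ K F (σ x) ≤ pot μ K F x := by
  rw [← h.pot_pb F x hx]
  have e := hK.pot_sub hF (h.bdpb hF) x
  have bD := hF.sub (h.bdpb hF)
  obtain ⟨i1, e1⟩ := h.pot_anti hK bD (Filter.Eventually.of_forall (h.sub_anti F)) x hx
  rw [e] at e1
  have : 0 ≤ ∫ y, (K x y - K x (σ y) * (m y) ^ a) * (F y - pb σ m b F y) ∂μ := by
    apply integral_nonneg_of_ae
    filter_upwards [hpol, h.sgk x hx hx1.ne] with y hy hk
    have he : eps m x = 1 := if_pos hx1
    rw [he, one_mul] at hk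
    have := mul_nonneg hk hy
    simp only [Pi.zero_apply]
    calc (0:ℝ) ≤ _ := this
      _ = (K x y - K x (σ y) * (m y) ^ a) * (F y - pb σ m b F y) * (eps m y * eps m y) := by ring
      _ = _ := by rw [eps_sq, mul_one]
  linarith

end abs

section maxi

variable {X : Type*} [MeasurableSpace X] {μ : Measure X} [IsFiniteMeasure μ]

theorem cont_quad {T : Type*} [TopologicalSpace T] {M : ℝ} (Fs : T → X → ℝ)
    (hm : ∀ t, Measurable (Fs t)) (h0 : ∀ t x, 0 ≤ Fs t x) (hM : ∀ t x, Fs t x ≤ M)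
    (hc : ∀ g : X → ℝ, Bd g → Continuous (fun t => ∫ x, Fs t x * g x ∂μ))
    (H : X × X → ℝ) (hH : Integrable H (μ.prod μ)) :
    Continuous (fun t => ∫ z, H z * (Fs t z.1 * Fs t z.2) ∂(μ.prod μ)) := by
  have hbm : ∀ t, Measurable (fun z : X × X => Fs t z.1 * Fs t z.2) := fun t =>
    ((hm t).comp measurable_fst).mul ((hm t).comp measurable_snd)
  have hbb : ∀ t (z : X × X), |Fs t z.1 * Fs t z.2| ≤ M * M := by
    intro t z
    rw [abs_of_nonneg (mul_nonneg (h0 _ _) (h0 _ _))]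
    exact mul_le_mul (hM _ _) (hM _ _) (h0 _ _) ((h0 _ _).trans (hM t z.1))
  have hint : ∀ t (G : X × X → ℝ), Integrable G (μ.prod μ) →
      Integrable (fun z => G z * (Fs t z.1 * Fs t z.2)) (μ.prod μ) := fun t G hG =>
    hG.mul_bdd (c := M * M) (hbm t).aestronglyMeasurable (Filter.Eventually.of_forall (hbb t))
  have hbound : ∀ t (G : X × X → ℝ), Integrable G (μ.prod μ) →
      |∫ z, G z * (Fs t z.1 * Fs t z.2) ∂(μ.prod μ)| ≤ (M * M) * ∫ z, |G z| ∂(μ.prod μ) := by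
    intro t G hG
    calc _ ≤ ∫ z, |G z * (Fs t z.1 * Fs t z.2)| ∂(μ.prod μ) := abs_integral_le_integral_abs
      _ ≤ ∫ z, (M * M) * |G z| ∂(μ.prod μ) := by
        apply integral_mono (hint t G hG).abs (hG.abs.const_mul _)
        intro z
        simp only [abs_mul (G z)]
        rw [mul_comm]
        exact mul_le_mul_of_nonneg_right (hbb t z) (abs_nonneg _)
      _ = _ := integral_const_mul _ _
  have hset : ∀ s : Set (X × X), MeasurableSet s →
      Continuous (fun t => ∫ z in s, (Fs t z.1 * Fs t z.2) ∂(μ.prod μ)) := by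
    have hintc : ∀ t, Integrable (fun z : X × X => Fs t z.1 * Fs t z.2) (μ.prod μ) := fun t =>
      Integrable.of_bound (hbm t).aestronglyMeasurable (M * M) (Filter.Eventually.of_forall (hbb t))
    have hrect : ∀ s₁ s₂ : Set X, MeasurableSet s₁ → MeasurableSet s₂ →
        Continuous (fun t => ∫ z in s₁ ×ˢ s₂, (Fs t z.1 * Fs t z.2) ∂(μ.prod μ)) := by
      intro s₁ s₂ h1 h2
      have hone : ∀ s : Set X, MeasurableSet s → Continuous (fun t => ∫ x in s, Fs t x ∂μ) := by
        intro s hs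
        have := hc (s.indicator 1) ⟨measurable_one.indicator hs, 1, fun x => by
          by_cases hx : x ∈ s <;> simp [hx]⟩
        refine this.congr fun t => ?_
        rw [← integral_indicator hs]
        congr 1; ext x
        by_cases hx : x ∈ s <;> simp [hx]
      refine ((hone s₁ h1).mul (hone s₂ h2)).congr fun t => ?_
      rw [setIntegral_prod_mul]; rfl
    intro s hs
    induction s, hs using MeasurableSpace.induction_on_inter
      (h_eq := generateFrom_prod.symm) (h_inter := isPiSystem_prod) with
    | empty => simpa using continuous_const
    | basic t ht =>
      obtain ⟨s₁, h1, s₂, h2, rfl⟩ := ht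
      exact hrect s₁ s₂ h1 h2
    | compl s hs ih =>
      have := hrect Set.univ Set.univ MeasurableSet.univ MeasurableSet.univ
      simp only [Set.univ_prod_univ, Measure.restrict_univ] at this
      refine (this.sub ih).congr fun t => ?_
      have := integral_add_compl hs (hintc t)
      simp only [Pi.sub_apply]
      linarith
    | iUnion f hd hfm ih =>
      have hs : Summable (fun i => (M * M) * ((μ.prod μ) (f i)).toReal) := by
        apply Summable.mul_left
        apply ENNReal.summable_toReal
        rw [← measure_iUnion hd hfm]
        exact measure_ne_top _ _
      refine (continuous_tsum ih hs fun i t => ?_).congr fun t => ?_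
      · have := norm_setIntegral_le_of_norm_le_const (μ := μ.prod μ) (s := f i) (C := M * M)
          (f := fun z : X × X => Fs t z.1 * Fs t z.2) (measure_lt_top _ _)
          (fun z _ => hbb t z)
        exact this
      · exact (integral_iUnion hfm hd (hintc t).integrableOn).symm
  refine Integrable.induction (μ := μ.prod μ)
    (fun H => Continuous (fun t => ∫ z, H z * (Fs t z.1 * Fs t z.2) ∂(μ.prod μ))) ?_ ?_ ?_ ?_ hH
  · intro c s hs _
    refine ((hset s hs).const_mul c).congr fun t => ?_
    rw [← integral_const_mul, ← integral_indicator hs]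
    congr 1; ext z
    by_cases hz : z ∈ s <;> simp [hz]
  · intro f g _ hf hg h1 h2
    refine (h1.add h2).congr fun t => ?_
    rw [Pi.add_apply, ← integral_add (hint t f hf) (hint t g hg)]
    congr 1; ext z; simp only [Pi.add_apply]; ring
  · apply isClosed_of_closure_subset
    intro f hf
    rw [Metric.mem_closure_iff] at hf
    apply continuous_of_uniform_approx_of_continuous
    intro u hu
    obtain ⟨ε, hε, hu⟩ := Metric.mem_uniformity_dist.1 hu
    obtain ⟨g, hg, hd⟩ := hf (ε / (M * M + 1))
      (div_pos hε (by have := mul_self_nonneg M; linarith))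
    refine ⟨_, hg, fun t => hu ?_⟩
    rw [Real.dist_eq, ← integral_sub (hint t f (L1.integrable_coeFn f))
      (hint t g (L1.integrable_coeFn g))]
    have e : (fun z => f z * (Fs t z.1 * Fs t z.2) - g z * (Fs t z.1 * Fs t z.2)) =
      fun z => (f z - g z) * (Fs t z.1 * Fs t z.2) := by ext z; ring
    rw [e]
    have h1 := hbound t (fun z => f z - g z)
      ((L1.integrable_coeFn f).sub (L1.integrable_coeFn g))
    have h2 : ∫ z, |f z - g z| ∂(μ.prod μ) = dist f g := by
      rw [L1.dist_eq_integral_dist]; rfl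
    rw [h2] at h1
    refine h1.trans_lt ?_
    have h3 : 0 ≤ M * M := mul_self_nonneg M
    have h4 : M * M * dist f g ≤ M * M * (ε / (M * M + 1)) :=
      mul_le_mul_of_nonneg_left hd.le h3
    refine h4.trans_lt ?_
    rw [mul_div_assoc', div_lt_iff₀ (by linarith)]
    nlinarith
  · intro f g hfg _ h
    refine h.congr fun t => ?_
    apply integral_congr_ae
    filter_upwards [hfg] with z hz
    rw [hz]

theorem Bd.memLp {F : X → ℝ} (hF : Bd F) (p : ENNReal) : MemLp F p μ := by
  obtain ⟨hF, C, hC⟩ := hF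
  exact MemLp.of_bound hF.aestronglyMeasurable C (Filter.Eventually.of_forall hC)

theorem Ker.en_eq {K : X → X → ℝ} {κ : ℝ} (hK : Ker μ K κ) {F : X → ℝ} (hF : Bd F) :
    Integrable (Function.uncurry K) (μ.prod μ) ∧
    en μ K F = ∫ z, Function.uncurry K z * (F z.1 * F z.2) ∂(μ.prod μ) := by
  have h1 : Integrable (Function.uncurry K) (μ.prod μ) := by
    rw [integrable_prod_iff hK.meas.aestronglyMeasurable]
    refine ⟨Filter.Eventually.of_forall hK.int, ?_⟩
    have : (fun x => ∫ y, ‖Function.uncurry K (x, y)‖ ∂μ) = fun _ => κ := by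
      ext x
      rw [← hK.tot x]
      congr 1; ext y
      exact abs_of_nonneg (hK.nonneg x y)
    rw [this]; exact integrable_const _
  refine ⟨h1, ?_⟩
  have hB : Bd (fun z : X × X => F z.1 * F z.2) := by
    obtain ⟨hF, C, hC⟩ := hF
    exact Bd.mul ⟨hF.comp measurable_fst, C, fun z => hC _⟩
      ⟨hF.comp measurable_snd, C, fun z => hC _⟩
  obtain ⟨hBm, C, hC⟩ := hB
  have h2 : Integrable (fun z => Function.uncurry K z * (F z.1 * F z.2)) (μ.prod μ) :=
    h1.mul_bdd (c := C) hBm.aestronglyMeasurable (Filter.Eventually.of_forall hC)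
  rw [integral_prod _ h2]
  unfold en pot
  congr 1; ext x
  rw [← integral_mul_const]
  congr 1; ext y
  simp only [Function.uncurry]; ring

theorem exists_max {K : X → X → ℝ} {κ : ℝ} (hK : Ker μ K κ) (M A p : ℝ) (hp : 1 < p)
    (hM : 0 ≤ M) (hA : 0 ≤ A) :
    ∃ F : X → ℝ, Measurable F ∧ (∀ x, 0 ≤ F x) ∧ (∀ x, F x ≤ M) ∧ ∫ x, F x ^ p ∂μ ≤ A ∧
      ∀ G : X → ℝ, Measurable G → (∀ x, 0 ≤ G x) → (∀ x, G x ≤ M) → ∫ x, G x ^ p ∂μ ≤ A →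
        en μ K G ≤ en μ K F ∧ (en μ K F ≤ en μ K G → ∫ x, G x ∂μ ≤ ∫ x, F x ∂μ) := by
  classical
  let E := Lp ℝ 2 μ
  let toE : (X → ℝ) → E := fun g => if hg : MemLp g 2 μ then hg.toLp g else 0
  have toE_ae : ∀ g, Bd g → toE g =ᵐ[μ] g := by
    intro g hg
    have : toE g = (hg.memLp 2).toLp g := dif_pos (hg.memLp 2)
    rw [this]; exact MemLp.coeFn_toLp _
  let cond : WeakDual ℝ E → Prop := fun φ => ∀ g : X → ℝ, Bd g → (∀ x, 0 ≤ g x) →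
    0 ≤ φ (toE g) ∧ φ (toE g) ≤ M * ∫ x, g x ∂μ ∧
    p * φ (toE fun x => g x ^ (p - 1)) ≤ A + (p - 1) * ∫ x, g x ^ p ∂μ
  let S : Set (WeakDual ℝ E) :=
    (WeakDual.toStrongDual ⁻¹' Metric.closedBall 0 ((measureUnivNNReal μ : ℝ) ^ (2 : ENNReal).toReal⁻¹ * M)) ∩ {φ | cond φ}
  have hScl : IsClosed {φ | cond φ} := by
    simp only [cond, Set.ofPred_forall]
    refine isClosed_iInter fun g => isClosed_iInter fun _ => isClosed_iInter fun _ => ?_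
    simp only [Set.ofPred_and]
    refine IsClosed.inter ?_ (IsClosed.inter ?_ ?_)
    · exact isClosed_le continuous_const (WeakDual.eval_continuous _)
    · exact isClosed_le (WeakDual.eval_continuous _) continuous_const
    · exact isClosed_le (continuous_const.mul (WeakDual.eval_continuous _)) continuous_const
  have hScp : IsCompact S := (WeakDual.isCompact_closedBall 0 _).inter_right hScl
  -- representation
  have hrep : ∀ φ : S, ∃ F : X → ℝ, Measurable F ∧ (∀ x, 0 ≤ F x) ∧ (∀ x, F x ≤ M) ∧
      ∀ g : X → ℝ, Bd g → (φ : WeakDual ℝ E) (toE g) = ∫ x, F x * g x ∂μ := by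
    rintro ⟨φ, -, hφ⟩
    let f : E := (InnerProductSpace.toDual ℝ E).symm (WeakDual.toStrongDual φ)
    have hf : ∀ g, Bd g → φ (toE g) = ∫ x, f x * g x ∂μ := by
      intro g hg
      have h1 : φ (toE g) = inner ℝ f (toE g) :=
        (InnerProductSpace.toDual_symm_apply (𝕜 := ℝ) (x := toE g)
          (y := WeakDual.toStrongDual φ)).symm
      rw [h1, L2.inner_def]
      apply integral_congr_ae
      filter_upwards [toE_ae g hg] with x hx
      rw [hx]; simp [mul_comm]
    have hfi : Integrable f μ := (Lp.memLp f).integrable (by norm_num)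
    have hind : ∀ s, MeasurableSet s → Bd (s.indicator (1 : X → ℝ)) := fun s hs =>
      ⟨measurable_one.indicator hs, 1, fun x => by by_cases hx : x ∈ s <;> simp [hx]⟩
    have hind0 : ∀ s : Set X, ∀ x, 0 ≤ s.indicator (1 : X → ℝ) x := fun s x => by
      by_cases hx : x ∈ s <;> simp [hx]
    have hse : ∀ s, MeasurableSet s → φ (toE (s.indicator 1)) = ∫ x in s, f x ∂μ := by
      intro s hs
      rw [hf _ (hind s hs), ← integral_indicator hs]
      congr 1; ext x; by_cases hx : x ∈ s <;> simp [hx]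
    have hf0 : 0 ≤ᵐ[μ] f := by
      apply ae_nonneg_of_forall_setIntegral_nonneg hfi
      intro s hs _
      rw [← hse s hs]
      exact (hφ _ (hind s hs) (hind0 s)).1
    have hfM : f ≤ᵐ[μ] fun _ => M := by
      apply ae_le_of_forall_setIntegral_le hfi (integrable_const _)
      intro s hs _
      rw [← hse s hs]
      have := (hφ _ (hind s hs) (hind0 s)).2.1
      rw [← integral_const_mul] at this
      rw [← integral_indicator hs]
      refine this.trans (le_of_eq ?_)
      congr 1; ext x; by_cases hx : x ∈ s <;> simp [hx]
    have hfm : Measurable f := (Lp.stronglyMeasurable f).measurable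
    refine ⟨fun x => max 0 (min M (f x)), ?_, ?_, ?_, ?_⟩
    · exact measurable_const.max (measurable_const.min hfm)
    · exact fun x => le_max_left _ _
    · exact fun x => max_le hM (min_le_left _ _)
    · intro g hg
      rw [hf g hg]
      apply integral_congr_ae
      filter_upwards [hf0, hfM] with x h1 h2
      have h1' : 0 ≤ f x := h1
      rw [min_eq_right h2, max_eq_right h1']
  choose Fs hm h0 hFM hev using hrep
  have hbd : ∀ t, Bd (Fs t) := fun t => ⟨hm t, M, fun x => by
    rw [abs_of_nonneg (h0 t x)]; exact hFM t x⟩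
  have hc : ∀ g : X → ℝ, Bd g → Continuous (fun t => ∫ x, Fs t x * g x ∂μ) := by
    intro g hg
    refine Continuous.congr ?_ (fun t => hev t g hg)
    exact (WeakDual.eval_continuous (toE g)).comp continuous_subtype_val
  have hFA : ∀ t, ∫ x, Fs t x ^ p ∂μ ≤ A := by
    intro t
    have := (t.2.2 (Fs t) (hbd t) (h0 t)).2.2
    rw [hev t _ ((hbd t).rpow (h0 t) (by linarith : 0 ≤ p - 1))] at this
    have e : ∫ x, Fs t x * Fs t x ^ (p - 1) ∂μ = ∫ x, Fs t x ^ p ∂μ := by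
      congr 1; ext x
      rw [← Real.rpow_one_add' (h0 t x) (by linarith)]; congr 1; ring
    rw [e] at this
    linarith
  -- conversely
  have hconv : ∀ G : X → ℝ, Measurable G → (∀ x, 0 ≤ G x) → (∀ x, G x ≤ M) →
      ∫ x, G x ^ p ∂μ ≤ A → ∃ t : S, G =ᵐ[μ] Fs t := by
    intro G hG hG0 hGM hGA
    have hB : Bd G := ⟨hG, M, fun x => by rw [abs_of_nonneg (hG0 x)]; exact hGM x⟩
    let φ : WeakDual ℝ E := StrongDual.toWeakDual (InnerProductSpace.toDual ℝ E (toE G))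
    have hφ : ∀ g, Bd g → φ (toE g) = ∫ x, G x * g x ∂μ := by
      intro g hg
      have h1 : φ (toE g) = inner ℝ (toE G) (toE g) := InnerProductSpace.toDual_apply_apply
      rw [h1, L2.inner_def]
      apply integral_congr_ae
      filter_upwards [toE_ae g hg, toE_ae G hB] with x hx hx2
      rw [hx, hx2]; simp [mul_comm]
    have hφS : φ ∈ S := by
      refine ⟨?_, ?_⟩
      · have h1 : ‖toE G‖ ≤ ((measureUnivNNReal μ : ℝ) ^ (2 : ENNReal).toReal⁻¹ * M) := by
          exact Lp.norm_le_of_ae_bound (p := 2) (f := toE G) hM (by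
            filter_upwards [toE_ae G hB] with x hx
            rw [hx, Real.norm_eq_abs, abs_of_nonneg (hG0 x)]; exact hGM x)
        have h2 : ‖InnerProductSpace.toDual ℝ E (toE G)‖ = ‖toE G‖ :=
          LinearIsometryEquiv.norm_map _ _
        simp only [Set.mem_preimage, Metric.mem_closedBall, dist_zero_right]
        exact h2.le.trans h1
      · intro g hg hg0
        refine ⟨?_, ?_, ?_⟩
        · rw [hφ g hg]; exact integral_nonneg fun x => mul_nonneg (hG0 x) (hg0 x)
        · rw [hφ g hg, ← integral_const_mul]
          apply integral_mono (hB.mul hg).integrable (hg.integrable.const_mul M)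
          exact fun x => mul_le_mul_of_nonneg_right (hGM x) (hg0 x)
        · have hgp := hg.rpow hg0 (by linarith : 0 ≤ p - 1)
          rw [hφ _ hgp, ← integral_const_mul]
          have i1 := (hB.rpow hG0 (by linarith : 0 ≤ p)).integrable (μ := μ)
          have i2 := ((hg.rpow hg0 (by linarith : 0 ≤ p)).integrable (μ := μ)).const_mul (p - 1)
          calc ∫ x, p * (G x * g x ^ (p - 1)) ∂μ ≤ ∫ x, (G x ^ p + (p - 1) * g x ^ p) ∂μ := by
                apply integral_mono ((hB.mul hgp).integrable.const_mul p) (i1.add i2)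
                intro x
                have hq : p.HolderConjugate (p / (p - 1)) := Real.HolderConjugate.conjExponent hp
                have y := Real.young_inequality_of_nonneg (hG0 x)
                  (Real.rpow_nonneg (hg0 x) (p - 1)) hq
                rw [← Real.rpow_mul (hg0 x), mul_div_cancel₀ _ (by linarith : p - 1 ≠ 0)] at y
                have hp0 : 0 < p := by linarith
                have := mul_le_mul_of_nonneg_left y hp0.le
                refine this.trans (le_of_eq ?_)
                simp only [Pi.add_apply]
                field_simp
            _ ≤ _ := by
                rw [integral_add i1 i2, integral_const_mul]; linarith
    refine ⟨⟨φ, hφS⟩, ?_⟩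
    apply Integrable.ae_eq_of_forall_setIntegral_eq _ _ hB.integrable (hbd _).integrable
    intro s hs _
    have hi : Bd (s.indicator (1 : X → ℝ)) :=
      ⟨measurable_one.indicator hs, 1, fun x => by by_cases hx : x ∈ s <;> simp [hx]⟩
    have e := (hφ _ hi).symm.trans (hev ⟨φ, hφS⟩ _ hi)
    rw [← integral_indicator hs, ← integral_indicator hs]
    convert e using 2
    · ext x; by_cases hx : x ∈ s <;> simp [hx]
    · ext x; by_cases hx : x ∈ s <;> simp [hx]
  have hIc : Continuous (fun t : S => en μ K (Fs t)) := by
    have h1 := (hK.en_eq (F := fun _ => 0) ⟨measurable_const, 0, by simp⟩).1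
    exact (cont_quad Fs hm h0 hFM hc _ h1).congr fun t => ((hK.en_eq (hbd t)).2).symm
  have hJc : Continuous (fun t : S => ∫ x, Fs t x ∂μ) := by
    have := hc (fun _ => 1) ⟨measurable_const, 1, by simp⟩
    simpa using this
  have : CompactSpace S := isCompact_iff_compactSpace.1 hScp
  have hne : Nonempty S := by
    obtain ⟨t, -⟩ := hconv (fun _ => 0) measurable_const (fun _ => le_rfl) (fun _ => hM) (by
      simp [Real.zero_rpow (by linarith : p ≠ 0), hA])
    exact ⟨t⟩
  obtain ⟨t0, -, ht0⟩ := isCompact_univ.exists_isMaxOn Set.univ_nonempty hIc.continuousOn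
  have hcl : IsClosed {t : S | en μ K (Fs t0) ≤ en μ K (Fs t)} :=
    isClosed_le continuous_const hIc
  obtain ⟨t1, ht1, hmax⟩ := hcl.isCompact.exists_isMaxOn ⟨t0, by simp⟩ hJc.continuousOn
  have ht1 : en μ K (Fs t0) ≤ en μ K (Fs t1) := by simpa using ht1
  refine ⟨Fs t1, hm t1, h0 t1, hFM t1, hFA t1, fun G hG hG0 hGM hGA => ?_⟩
  obtain ⟨t, ht⟩ := hconv G hG hG0 hGM hGA
  have e1 : en μ K G = en μ K (Fs t) := by
    have hp : ∀ x, pot μ K G x = pot μ K (Fs t) x := by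
      intro x
      apply integral_congr_ae
      filter_upwards [ht] with y hy
      rw [hy]
    unfold en
    apply integral_congr_ae
    filter_upwards [ht] with x hx
    rw [hx, hp]
  have e2 : ∫ x, G x ∂μ = ∫ x, Fs t x ∂μ := integral_congr_ae ht
  rw [e1, e2]
  refine ⟨le_trans (ht0 (Set.mem_univ t)) ht1, fun h => hmax ?_⟩
  simpa using le_trans ht1 h

open Filter Topology in
theorem hls_abs {K : X → X → ℝ} {κ a b p : ℝ} (hK : Ker μ K κ) (r : X → ℝ) (hp1 : 1 < p)
    (hp : b * p = a + b)
    (hR : ∀ x y, r x < r y → ∀ᶠ θ in 𝓝[≠] (1 : ℝ), ∃ (σ : X → X) (m : X → ℝ) (N : Set X),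
      Refl μ K σ m a b N ∧ x ∉ N ∧ y ∉ N ∧ σ x = y ∧ m x = θ)
    (hr : ∀ x y, ∃ z, r x < r z ∧ r y < r z)
    (hμ : 0 < μ.real Set.univ)
    (G : X → ℝ) (M : ℝ) (hG : Measurable G) (hG0 : ∀ x, 0 ≤ G x) (hGM : ∀ x, G x ≤ M)
    (hM : 0 ≤ M) :
    en μ K G ≤ κ * (μ.real Set.univ) ^ (1 - 2 / p) * (∫ x, G x ^ p ∂μ) ^ (2 / p) := by
  set A := ∫ x, G x ^ p ∂μ with hA
  have hA0 : 0 ≤ A := integral_nonneg fun x => Real.rpow_nonneg (hG0 x) _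
  obtain ⟨F, hF, hF0, hFM, hFA, hmax⟩ := exists_max hK M A p hp1 hM hA0
  have bF : Bd F := ⟨hF, M, fun x => by rw [abs_of_nonneg (hF0 x)]; exact hFM x⟩
  refine (hmax G hG hG0 hGM le_rfl).1.trans ?_
  -- comparison
  have hcmp : ∀ (σ : X → X) (m : X → ℝ) (N : Set X) (x : X), Refl μ K σ m a b N → x ∉ N →
      m x < 1 → m x ^ a * pot μ K F (σ x) ≤ pot μ K F x := by
    intro σ m N x h hx hx1
    have h2 := hmax (pol σ m b F) (h.bdpol bF).1 (h.pol_nonneg hF0) (h.pol_le hM hFM)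
      ((h.pol_pow bF hF0 p hp (by linarith)).le.trans hFA)
    exact h.pot_le hK bF (h.polarized bF (h2.2 (h.en_pol hK bF))) x hx hx1
  have hlt : Tendsto (fun θ : ℝ => θ) (𝓝[<] 1) (𝓝 1) := tendsto_id.mono_left nhdsWithin_le_nhds
  have hgt : Tendsto (fun θ : ℝ => θ) (𝓝[>] 1) (𝓝 1) := tendsto_id.mono_left nhdsWithin_le_nhds
  have hle : 𝓝[<] (1:ℝ) ≤ 𝓝[≠] 1 := nhdsWithin_mono _ fun x hx => ne_of_lt hx
  have hge : 𝓝[>] (1:ℝ) ≤ 𝓝[≠] 1 := nhdsWithin_mono _ fun x hx => ne_of_gt hx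
  have heq1 : ∀ x y, r x < r y → pot μ K F x = pot μ K F y := by
    intro x y hxy
    have h := hR x y hxy
    apply le_antisymm
    · have h1 : Tendsto (fun θ : ℝ => θ⁻¹ ^ a * pot μ K F x) (𝓝[>] 1)
          (𝓝 ((1:ℝ)⁻¹ ^ a * pot μ K F x)) :=
        ((hgt.inv₀ one_ne_zero).rpow_const (Or.inl (by norm_num))).mul_const _
      simp only [inv_one, Real.one_rpow, one_mul] at h1
      refine le_of_tendsto h1 ?_
      filter_upwards [hge h, self_mem_nhdsWithin] with θ hθ hθ1
      obtain ⟨σ, m, N, hRf, hx, hy, hs, hm⟩ := hθ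
      have hθ1 : 1 < θ := hθ1
      have e := hRf.minv x
      rw [hs, hm] at e
      have e2 : m y = θ⁻¹ := eq_inv_of_mul_eq_one_left e
      have := hcmp σ m N y hRf hy (by rw [e2]; exact inv_lt_one_of_one_lt₀ hθ1)
      rwa [e2, ← hs, hRf.inv, hs] at this
    · have h1 : Tendsto (fun θ : ℝ => θ ^ a * pot μ K F y) (𝓝[<] 1)
          (𝓝 ((1:ℝ) ^ a * pot μ K F y)) :=
        (hlt.rpow_const (Or.inl (by norm_num))).mul_const _
      simp only [Real.one_rpow, one_mul] at h1
      refine le_of_tendsto h1 ?_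
      filter_upwards [hle h, self_mem_nhdsWithin] with θ hθ hθ1
      obtain ⟨σ, m, N, hRf, hx, hy, hs, hm⟩ := hθ
      have hθ1 : θ < 1 := hθ1
      have := hcmp σ m N x hRf hx (by rw [hm]; exact hθ1)
      rwa [hm, hs] at this
  have heq : ∀ x y, pot μ K F x = pot μ K F y := by
    intro x y
    obtain ⟨z, h1, h2⟩ := hr x y
    rw [heq1 x z h1, heq1 y z h2]
  have hne : Nonempty X := by
    by_contra h
    rw [not_nonempty_iff] at h
    have : (Set.univ : Set X) = ∅ := Set.eq_empty_of_isEmpty _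
    rw [this] at hμ; simp at hμ
  obtain ⟨x0⟩ := hne
  set c := pot μ K F x0 with hc
  set m0 := μ.real Set.univ with hm0
  set J := ∫ x, F x ∂μ with hJ
  have hen : en μ K F = c * J := by
    unfold en
    rw [hJ, ← integral_const_mul]
    congr 1; ext x; rw [heq x x0]
  have hcJ : c * m0 = κ * J := by
    have h1 : ∫ x, pot μ K F x ∂μ = c * m0 := by
      have : (fun x => pot μ K F x) = fun _ => c := by ext x; rw [heq x x0]
      rw [this, integral_const, smul_eq_mul, mul_comm]
    rw [← h1]
    unfold pot
    have hi : Integrable (Function.uncurry fun x y => K x y * F y) (μ.prod μ) := by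
      have := (hK.en_eq bF).1
      exact this.mul_bdd (c := M) (hF.comp measurable_snd).aestronglyMeasurable
        (Filter.Eventually.of_forall fun z => by
          rw [Real.norm_eq_abs, abs_of_nonneg (hF0 _)]; exact hFM _)
    rw [integral_integral_swap hi, hJ, ← integral_const_mul]
    congr 1; ext y
    rw [integral_mul_const, ← hK.tot y]
    congr 2; ext x; rw [hK.symm]
  have hκ : 0 ≤ κ := by rw [← hK.tot x0]; exact integral_nonneg fun y => hK.nonneg _ _
  have hJ0 : 0 ≤ J := integral_nonneg hF0
  have hHol : J ≤ A ^ (1 / p) * m0 ^ (1 - 1 / p) := by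
    have hq : p.HolderConjugate (p / (p - 1)) := Real.HolderConjugate.conjExponent hp1
    have := integral_mul_le_Lp_mul_Lq_of_nonneg hq (μ := μ) (f := F) (g := fun _ => 1)
      (Eventually.of_forall hF0) (Eventually.of_forall fun _ => zero_le_one)
      (bF.memLp _) (Bd.memLp ⟨measurable_const, 1, by simp⟩ _)
    simp only [mul_one, Real.one_rpow, integral_const, smul_eq_mul] at this
    have e : 1 / (p / (p - 1)) = 1 - 1 / p := by
      have : p ≠ 0 := by linarith
      field_simp
    rw [e] at this
    refine this.trans (mul_le_mul_of_nonneg_right ?_ (Real.rpow_nonneg hμ.le _))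
    exact Real.rpow_le_rpow (integral_nonneg fun x => Real.rpow_nonneg (hF0 x) _) hFA
      (by positivity)
  have hcc : c = κ * J / m0 := by rw [← hcJ]; field_simp
  rw [hen, hcc]
  have h2 : J * J ≤ (A ^ (1 / p) * m0 ^ (1 - 1 / p)) * (A ^ (1 / p) * m0 ^ (1 - 1 / p)) :=
    mul_self_le_mul_self hJ0 hHol
  have e1 : (A ^ (1 / p) * m0 ^ (1 - 1 / p)) * (A ^ (1 / p) * m0 ^ (1 - 1 / p)) / m0 =
      m0 ^ (1 - 2 / p) * A ^ (2 / p) := by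
    have ea : A ^ (2 / p) = A ^ (1 / p) * A ^ (1 / p) := by
      rw [← Real.rpow_add_of_nonneg hA0 (by positivity) (by positivity)]; congr 1; ring
    have em : m0 ^ (1 - 2 / p) = m0 ^ (1 - 1 / p) * m0 ^ (1 - 1 / p) / m0 := by
      rw [← Real.rpow_add hμ, ← Real.rpow_sub_one hμ.ne']; congr 1; ring
    rw [ea, em]; ring
  calc κ * J / m0 * J = κ * (J * J / m0) := by ring
    _ ≤ κ * ((A ^ (1 / p) * m0 ^ (1 - 1 / p)) * (A ^ (1 / p) * m0 ^ (1 - 1 / p)) / m0) := by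
      apply mul_le_mul_of_nonneg_left _ hκ
      exact div_le_div_of_nonneg_right h2 hμ.le
    _ = _ := by rw [e1]; ring

end maxi

section geo

/-- space -/
abbrev E (n : ℕ) := EuclideanSpace ℝ (Fin n)

variable {n : ℕ}

/-- weight -/
noncomputable def W (x : E n) : ℝ := 1 + ‖x‖ ^ 2

theorem W_pos (x : E n) : 0 < W x := by unfold W; positivity
theorem W_one (x : E n) : 1 ≤ W x := by unfold W; nlinarith [sq_nonneg ‖x‖]
theorem W_cont : Continuous (W : E n → ℝ) := by unfold W; fun_prop

/-- measure -/
noncomputable def ms (n : ℕ) : Measure (E n) :=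
  volume.withDensity (fun x => ENNReal.ofReal ((W x) ^ (-(n : ℝ))))

/-- kernel -/
noncomputable def Kn (x y : E n) : ℝ := (W x * W y / ‖x - y‖ ^ 2) ^ (((n : ℝ) - 4) / 2)

theorem dens_meas : Measurable (fun x : E n => ENNReal.ofReal ((W x) ^ (-(n : ℝ)))) := by
  have := W_cont (n := n) |>.measurable
  fun_prop

theorem int_ms (g : E n → ℝ) : ∫ x, g x ∂(ms n) = ∫ x, (W x) ^ (-(n : ℝ)) * g x := by
  unfold ms
  rw [integral_withDensity_eq_integral_toReal_smul dens_meas (by simp)]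
  congr 1; ext x
  rw [ENNReal.toReal_ofReal (Real.rpow_nonneg (W_pos x).le _), smul_eq_mul]

theorem ae_ms {P : E n → Prop} (h : ∀ᵐ x, P x) : ∀ᵐ x ∂(ms n), P x :=
  (withDensity_absolutelyContinuous _ _).ae_le h

open EuclideanGeometry

theorem inv_id (c w y : E n) {R : ℝ} (hR : 0 < R) (hy : y ≠ c) :
    ‖w - inversion c R y‖ ^ 2 * (‖y - c‖ ^ 2 / R ^ 2) =
      ‖w - y‖ ^ 2 + (1 - ‖y - c‖ ^ 2 / R ^ 2) * (R ^ 2 - ‖w - c‖ ^ 2) := by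
  have hd : ‖y - c‖ ≠ 0 := by simpa [sub_eq_zero] using hy
  have e1 : w - inversion c R y = (w - c) - (R / ‖y - c‖) ^ 2 • (y - c) := by
    rw [inversion, dist_eq_norm, vsub_eq_sub, vadd_eq_add]; abel
  have e2 : w - y = (w - c) - (y - c) := by abel
  rw [e1, e2]
  generalize w - c = z at *
  generalize y - c = v at *
  rw [norm_sub_sq_real, norm_sub_sq_real, inner_smul_right, norm_smul]
  simp only [Real.norm_eq_abs, abs_pow, mul_pow, abs_div, abs_norm]
  rw [abs_of_pos hR]
  field_simp
  ring

/-- shift -/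
noncomputable def sh (c : E n) (R : ℝ) : ℝ := R ^ 2 - 1 - ‖c‖ ^ 2

theorem W_inv (c x : E n) {R : ℝ} (hR : 0 < R) (hx : x ≠ c) :
    W (inversion c R x) * (‖x - c‖ ^ 2 / R ^ 2) =
      W x + sh c R * (1 - ‖x - c‖ ^ 2 / R ^ 2) := by
  have := inv_id c 0 x hR hx
  simp only [zero_sub, norm_neg] at this
  unfold W sh
  linear_combination this

open Classical in
/-- conformal factor -/
noncomputable def cf (c : E n) (R : ℝ) (x : E n) : ℝ :=
  if x = c then 1 else (R ^ 2 / ‖x - c‖ ^ 2) * W x / W (inversion c R x)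

theorem cf_ne {c x : E n} (R : ℝ) (hx : x ≠ c) :
    cf c R x = (R ^ 2 / ‖x - c‖ ^ 2) * W x / W (inversion c R x) := by
  simp [cf, hx]

theorem cf_self (c : E n) (R : ℝ) : cf c R c = 1 := by simp [cf]

theorem cf_pos (c x : E n) {R : ℝ} (hR : 0 < R) : 0 < cf c R x := by
  by_cases hx : x = c
  · rw [hx, cf_self]; exact one_pos
  · have hd : 0 < ‖x - c‖ := by simpa [sub_eq_zero] using hx
    rw [cf_ne R hx]
    have := W_pos x
    have := W_pos (inversion c R x)
    positivity

theorem cf_mul (c x : E n) {R : ℝ} (hR : 0 < R) (hx : x ≠ c) :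
    cf c R x * (W x + sh c R * (1 - ‖x - c‖ ^ 2 / R ^ 2)) = W x := by
  rw [← W_inv c x hR hx, cf_ne R hx]
  have hd : ‖x - c‖ ≠ 0 := by simpa [sub_eq_zero] using hx
  have := (W_pos (inversion c R x)).ne'
  field_simp

theorem cf_inv (c x : E n) {R : ℝ} (hR : 0 < R) :
    cf c R (inversion c R x) * cf c R x = 1 := by
  by_cases hx : x = c
  · simp [hx, cf_self]
  · have hx' : inversion c R x ≠ c := by rwa [Ne, inversion_eq_center hR.ne']
    rw [cf_ne R hx, cf_ne R hx', inversion_inversion c hR.ne']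
    have hd : ‖x - c‖ ≠ 0 := by simpa [sub_eq_zero] using hx
    have h1 := (W_pos (inversion c R x)).ne'
    have h2 := (W_pos x).ne'
    rw [← dist_eq_norm, dist_inversion_center, dist_eq_norm]
    field_simp

theorem cf_bdd (c : E n) {R : ℝ} (hR : 0 < R) : ∃ C, ∀ x, cf c R x ≤ C := by
  set s := sh c R
  set C := 1 + |s| * (1 + 2 * (1 + ‖c‖ ^ 2) / R ^ 2) with hC
  have hC1 : 1 ≤ C := by
    have : 0 ≤ |s| * (1 + 2 * (1 + ‖c‖ ^ 2) / R ^ 2) := by positivity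
    linarith
  have key : ∀ x, 1 ≤ C * cf c R x := by
    intro x
    by_cases hx : x = c
    · rw [hx, cf_self]; linarith
    · have h1 := cf_mul c x hR hx
      have h2 : W x + s * (1 - ‖x - c‖ ^ 2 / R ^ 2) ≤ C * W x := by
        have h3 : s * (1 - ‖x - c‖ ^ 2 / R ^ 2) ≤ |s| * (1 + ‖x - c‖ ^ 2 / R ^ 2) := by
          have hq : 0 ≤ ‖x - c‖ ^ 2 / R ^ 2 := by positivity
          nlinarith [le_abs_self s, neg_abs_le s]
        have h4 : ‖x - c‖ ^ 2 ≤ 2 * (1 + ‖c‖ ^ 2) * W x := by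
          have := norm_sub_le x c
          have h0 := norm_nonneg (x - c)
          unfold W
          nlinarith [sq_nonneg (‖x‖ - ‖c‖), sq_nonneg ‖x‖, sq_nonneg ‖c‖,
            mul_nonneg (sq_nonneg ‖x‖) (sq_nonneg ‖c‖)]
        have h5 : 1 + ‖x - c‖ ^ 2 / R ^ 2 ≤ (1 + 2 * (1 + ‖c‖ ^ 2) / R ^ 2) * W x := by
          have : ‖x - c‖ ^ 2 / R ^ 2 ≤ 2 * (1 + ‖c‖ ^ 2) * W x / R ^ 2 := by gcongr
          have e : (1 + 2 * (1 + ‖c‖ ^ 2) / R ^ 2) * W x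
            = W x + 2 * (1 + ‖c‖ ^ 2) * W x / R ^ 2 := by ring
          rw [e]; linarith [W_one x]
        have h6 := mul_le_mul_of_nonneg_left h5 (abs_nonneg s)
        rw [hC]; linarith
      have h3 := mul_le_mul_of_nonneg_left h2 (cf_pos c x hR).le
      have : W x * 1 ≤ W x * (C * cf c R x) := by rw [h1] at h3; linarith
      exact le_of_mul_le_mul_left this (W_pos x)
  refine ⟨C, fun x => ?_⟩
  have h1 := key (inversion c R x)
  have h2 := cf_inv c x hR
  have h3 := mul_le_mul_of_nonneg_right h1 (cf_pos c x hR).le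
  rw [mul_assoc, h2] at h3
  linarith

theorem inv_meas (c : E n) (R : ℝ) : Measurable (inversion c R) := by
  unfold inversion
  simp only [vsub_eq_sub, vadd_eq_add]
  fun_prop

theorem cf_meas (c : E n) (R : ℝ) : Measurable (cf c R) := by
  unfold cf
  have := W_cont (n := n) |>.measurable
  have h2 := this.comp (inv_meas c R)
  apply Measurable.ite (measurableSet_eq) measurable_const
  simp only [Function.comp_def] at h2
  fun_prop

theorem det_inv (c x : E n) {R : ℝ} :
    |((R / dist x c) ^ 2 • (((ℝ ∙ (x - c))ᗮ.reflection : E n →L[ℝ] E n))).det|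
      = ((R / dist x c) ^ 2) ^ n := by
  have h : ((R / dist x c) ^ 2 • (((ℝ ∙ (x - c))ᗮ.reflection : E n →L[ℝ] E n))).det
    = LinearMap.det ((R / dist x c) ^ 2 • ((ℝ ∙ (x - c))ᗮ.reflection.toLinearMap)) := rfl
  rw [h, LinearMap.det_smul, Submodule.det_reflection, abs_mul, abs_pow _ (Module.finrank ℝ _), abs_pow (-1),
    abs_neg, abs_one, one_pow, mul_one]
  simp

theorem cf_cv [NeZero n] (c : E n) {R : ℝ} (hR : 0 < R) (g : E n → ℝ) {a b : ℝ} (hab : a + b = n) :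
    ∫ y, g (inversion c R y) * ((cf c R y) ^ a * (cf c R y) ^ b) ∂(ms n) = ∫ y, g y ∂(ms n) := by
  rw [int_ms, int_ms]
  have him : inversion c R '' {c}ᶜ = {c}ᶜ := by
    rw [Set.image_compl_eq (inversion_bijective c hR.ne'), Set.image_singleton, inversion_self]
  have hnull : ∀ᵐ y : E n, y ∈ ({c}ᶜ : Set (E n)) := by
    simp [ae_iff]
  have hr : (volume : Measure (E n)).restrict {c}ᶜ = volume :=
    Measure.restrict_eq_self_of_ae_mem hnull
  have := integral_image_eq_integral_abs_det_fderiv_smul (μ := (volume : Measure (E n)))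
    (s := ({c}ᶜ : Set (E n))) (f := inversion c R) (measurableSet_singleton c).compl
    (fun x hx => (hasFDerivAt_inversion (R := R) (by simpa using hx)).hasFDerivWithinAt)
    (inversion_injective c hR.ne').injOn (fun x => (W x) ^ (-(n : ℝ)) * g x)
  rw [him, hr] at this
  rw [this]
  apply integral_congr_ae
  filter_upwards [hnull] with y hy
  have hy : y ≠ c := by simpa using hy
  rw [det_inv, ← Real.rpow_add (cf_pos c y hR), hab, cf_ne R hy, smul_eq_mul, dist_eq_norm]
  have hd : 0 < ‖y - c‖ := by simpa [sub_eq_zero] using hy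
  have h1 := (W_pos (inversion c R y))
  have h2 := (W_pos y)
  rw [Real.rpow_neg h2.le, Real.rpow_neg h1.le, Real.rpow_natCast, Real.rpow_natCast,
    Real.rpow_natCast]
  simp only [div_pow, mul_pow]
  field_simp

theorem Kn_sw (c x y : E n) {R : ℝ} (hR : 0 < R) (hx : x ≠ c) (hy : y ≠ c) :
    Kn (inversion c R x) (inversion c R y) *
      ((cf c R x) ^ (((n : ℝ) - 4) / 2) * (cf c R y) ^ (((n : ℝ) - 4) / 2)) = Kn x y := by
  have h1 := (W_pos (inversion c R y))
  have h2 := (W_pos y)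
  have h3 := (W_pos (inversion c R x))
  have h4 := (W_pos x)
  have hd : 0 < ‖y - c‖ := by simpa [sub_eq_zero] using hy
  have hd' : 0 < ‖x - c‖ := by simpa [sub_eq_zero] using hx
  unfold Kn
  rw [← Real.mul_rpow (cf_pos c x hR).le (cf_pos c y hR).le, ← Real.mul_rpow (by positivity)
    (mul_pos (cf_pos c x hR) (cf_pos c y hR)).le]
  congr 1
  rw [cf_ne R hx, cf_ne R hy, ← dist_eq_norm (inversion c R x), dist_inversion_inversion hx hy,
    dist_eq_norm, dist_eq_norm, dist_eq_norm]
  by_cases hxy : x = y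
  · simp [hxy]
  have : ‖x - y‖ ≠ 0 := by simpa [sub_eq_zero] using hxy
  field_simp

theorem Kn_ref (c x y : E n) {R : ℝ} (hR : 0 < R) (hy : y ≠ c) :
    Kn x (inversion c R y) * (cf c R y) ^ (((n : ℝ) - 4) / 2) =
      (W x * W y / (‖x - inversion c R y‖ ^ 2 * (‖y - c‖ ^ 2 / R ^ 2))) ^ (((n : ℝ) - 4) / 2) := by
  have h1 := (W_pos (inversion c R y))
  have h2 := (W_pos y)
  have h4 := (W_pos x)
  have hd : 0 < ‖y - c‖ := by simpa [sub_eq_zero] using hy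
  unfold Kn
  rw [← Real.mul_rpow (by positivity) (cf_pos c y hR).le]
  congr 1
  rw [cf_ne R hy]
  by_cases hxy : ‖x - inversion c R y‖ = 0
  · simp [hxy]
  field_simp


theorem cf_one_sub (c x : E n) {R : ℝ} (hR : 0 < R) (hx : x ≠ c) : ∃ D, 0 < D ∧
    1 - cf c R x = D * (sh c R * (R ^ 2 - ‖x - c‖ ^ 2)) := by
  have h := cf_mul c x hR hx
  have hp := cf_pos c x hR
  refine ⟨cf c R x / (W x * R ^ 2), div_pos hp (mul_pos (W_pos x) (by positivity)), ?_⟩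
  have h2 := (W_pos x).ne'
  have e : cf c R x * (sh c R * (R ^ 2 - ‖x - c‖ ^ 2)) = (W x - cf c R x * W x) * R ^ 2 := by
    have : sh c R * (R ^ 2 - ‖x - c‖ ^ 2) = sh c R * (1 - ‖x - c‖ ^ 2 / R ^ 2) * R ^ 2 := by
      field_simp
    rw [this]; linear_combination R ^ 2 * h
  rw [div_mul_eq_mul_div, e]
  field_simp

theorem Kn_sg (hn : 5 ≤ n) (c x y : E n) {R : ℝ} (hR : 0 < R) (hx : x ≠ c) (hy : y ≠ c)
    (hxy : x ≠ y) (hxy' : x ≠ inversion c R y) :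
    0 ≤ (Kn x y - Kn x (inversion c R y) * (cf c R y) ^ (((n : ℝ) - 4) / 2)) *
      ((1 - cf c R x) * (1 - cf c R y)) := by
  have hn' : (5 : ℝ) ≤ n := by exact_mod_cast hn
  have ha : 0 ≤ ((n : ℝ) - 4) / 2 := by linarith
  rw [Kn_ref c x y hR hy]
  obtain ⟨D, hD, eD⟩ := cf_one_sub c x hR hx
  obtain ⟨D', hD', eD'⟩ := cf_one_sub c y hR hy
  rw [eD, eD']
  have hid := inv_id c x y hR hy
  have hWx := W_pos x
  have hWy := W_pos y
  have p1 : 0 < ‖x - y‖ := by simpa [sub_eq_zero] using hxy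
  have p2 : 0 < ‖x - inversion c R y‖ := by simpa [sub_eq_zero] using hxy'
  have p3 : 0 < ‖y - c‖ := by simpa [sub_eq_zero] using hy
  set A := ‖x - inversion c R y‖ ^ 2 * (‖y - c‖ ^ 2 / R ^ 2) with hA
  have hA0 : 0 < A := by positivity
  set B := ‖x - y‖ ^ 2 with hB
  have hB0 : 0 < B := by positivity
  have hAB : (A - B) * R ^ 2 = (R ^ 2 - ‖x - c‖ ^ 2) * (R ^ 2 - ‖y - c‖ ^ 2) := by
    rw [hid]; field_simp; ring
  have e : (D * (sh c R * (R ^ 2 - ‖x - c‖ ^ 2))) * (D' * (sh c R * (R ^ 2 - ‖y - c‖ ^ 2)))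
      = (D * D' * sh c R ^ 2 * R ^ 2) * (A - B) := by
    linear_combination (-D * D' * sh c R ^ 2) * hAB
  rw [e]
  have hpos : 0 ≤ D * D' * sh c R ^ 2 * R ^ 2 := by positivity
  unfold Kn
  rcases le_total A B with h | h
  · apply mul_nonneg_of_nonpos_of_nonpos
    · rw [sub_nonpos]
      apply Real.rpow_le_rpow (by positivity) _ ha
      gcongr
    · exact mul_nonpos_of_nonneg_of_nonpos hpos (by linarith)
  · apply mul_nonneg
    · rw [sub_nonneg]
      apply Real.rpow_le_rpow (by positivity) _ ha
      gcongr
    · exact mul_nonneg hpos (by linarith)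

theorem refl_inv [NeZero n] (hn : 5 ≤ n) (c : E n) {R : ℝ} (hR : 0 < R) (hs : sh c R ≠ 0) :
    Refl (ms n) Kn (inversion c R) (cf c R) (((n : ℝ) - 4) / 2) (((n : ℝ) + 4) / 2) {c} := by
  have hn' : (5 : ℝ) ≤ n := by exact_mod_cast hn
  have aen : ∀ z : E n, ∀ᵐ y ∂(ms n), y ≠ z := fun z => ae_ms (by simp [ae_iff])
  refine ⟨by linarith, by linarith, inv_meas c R, cf_meas c R, fun x => cf_pos c x hR,
    cf_bdd c hR, inversion_inversion c hR.ne', fun x => cf_inv c x hR,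
    fun g => cf_cv c hR g (by ring), ?_, ?_, ?_, ?_, ?_⟩
  · have := aen c
    simpa [ae_iff] using this
  · intro x hx
    simpa [inversion_eq_center hR.ne'] using hx
  · intro x hx
    filter_upwards [aen c] with y hy
    exact Kn_sw c x y hR (by simpa using hx) hy
  · intro x hx
    filter_upwards [aen c, aen x, aen (inversion c R x)] with y hy h1 h2
    refine Kn_sg hn c x y hR (by simpa using hx) hy (Ne.symm h1) ?_
    rintro h
    apply h2
    rw [h, inversion_inversion c hR.ne']
  · have h1 : ∀ᵐ y ∂(ms n), ‖y - c‖ ≠ R := by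
      apply ae_ms
      have := Measure.addHaar_sphere (volume : Measure (E n)) c R
      rw [ae_iff]
      convert this using 2
      ext y; simp
    filter_upwards [aen c, h1] with y hy h1
    obtain ⟨D, hD, eD⟩ := cf_one_sub c y hR hy
    have : R ^ 2 - ‖y - c‖ ^ 2 ≠ 0 := by
      intro h
      apply h1
      have h3 : ‖y - c‖ ^ 2 = R ^ 2 := by linarith
      exact (pow_left_inj₀ (norm_nonneg _) hR.le two_ne_zero).1 h3
    intro h
    rw [h, sub_self] at eD
    exact (mul_ne_zero hD.ne' (mul_ne_zero hs this)) eD.symm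

theorem exists_inv (x y : E n) (hxy : x ≠ y) (θ : ℝ) (h : W x < θ * W y) :
    ∃ (c : E n) (R : ℝ), 0 < R ∧ x ≠ c ∧ y ≠ c ∧ inversion c R x = y ∧ cf c R x = θ ∧
      (‖x‖ < ‖y‖ → (sh c R = 0 ↔ θ = 1)) := by
  have hWx := W_pos x
  have hWy := W_pos y
  set ρ := θ * W y / W x with hρ
  have hρ1 : 1 < ρ := by rw [hρ, lt_div_iff₀ hWx]; linarith
  set τ := ρ / (ρ - 1) with hτ
  have hρ0 : 0 < ρ - 1 := by linarith
  have hτ1 : 1 < τ := by rw [hτ, lt_div_iff₀ hρ0]; linarith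
  have hd : 0 < ‖x - y‖ := by simpa [sub_eq_zero] using hxy
  set c := y + τ • (x - y) with hc
  have exc : x - c = (1 - τ) • (x - y) := by
    rw [hc, sub_smul, one_smul]; abel
  have eyc : y - c = (-τ) • (x - y) := by
    rw [hc, neg_smul]; abel
  have nxc : ‖x - c‖ = (τ - 1) * ‖x - y‖ := by
    rw [exc, norm_smul, Real.norm_eq_abs, abs_of_neg (by linarith)]; ring
  have hxc : x ≠ c := by
    intro h
    rw [← sub_eq_zero, ← norm_eq_zero, nxc] at h
    exact (mul_pos (by linarith) hd).ne' h
  have hyc : y ≠ c := by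
    intro h
    rw [← sub_eq_zero, ← norm_eq_zero, eyc, norm_smul, Real.norm_eq_abs, abs_neg,
      abs_of_pos (by linarith)] at h
    exact (mul_pos (by linarith) hd).ne' h
  have hR2 : 0 < τ * (τ - 1) * ‖x - y‖ ^ 2 := by
    have : 0 < τ - 1 := by linarith
    have : 0 < τ := by linarith
    positivity
  set R := Real.sqrt (τ * (τ - 1) * ‖x - y‖ ^ 2) with hR
  have hRsq : R ^ 2 = τ * (τ - 1) * ‖x - y‖ ^ 2 := Real.sq_sqrt hR2.le
  have hR0 : 0 < R := Real.sqrt_pos.2 hR2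
  have hτ1' : τ - 1 ≠ 0 := by linarith
  have hσ : inversion c R x = y := by
    rw [inversion, dist_eq_norm, vsub_eq_sub, vadd_eq_add, div_pow, hRsq, nxc, exc, smul_smul]
    have : τ * (τ - 1) * ‖x - y‖ ^ 2 / ((τ - 1) * ‖x - y‖) ^ 2 * (1 - τ) = -τ := by
      field_simp; ring
    rw [this, ← eyc]; abel
  refine ⟨c, R, hR0, hxc, hyc, hσ, ?_, ?_⟩
  · rw [cf_ne R hxc, hσ, hRsq, nxc]
    have : τ * (τ - 1) * ‖x - y‖ ^ 2 / ((τ - 1) * ‖x - y‖) ^ 2 = ρ := by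
      have : τ = ρ * (τ - 1) := by rw [hτ]; field_simp; ring
      field_simp; linarith
    rw [this, hρ]; field_simp
  · intro hlt
    have hs : sh c R = -W y - τ * (W x - W y) := by
      unfold sh W
      rw [hRsq, hc, norm_add_sq_real, norm_smul, Real.norm_eq_abs, abs_of_pos (by linarith),
        inner_smul_right, inner_sub_right, real_inner_self_eq_norm_sq, mul_pow, norm_sub_sq_real,
        real_inner_comm]
      ring
    have e : sh c R * (ρ - 1) = W y - ρ * W x := by
      rw [hs, hτ]; field_simp; ring
    have e2 : ρ * W x = θ * W y := by rw [hρ]; field_simp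
    rw [e2] at e
    constructor
    · intro h0
      rw [h0, zero_mul] at e
      have : (1 - θ) * W y = 0 := by linarith
      rcases mul_eq_zero.1 this with h | h
      · linarith
      · exact absurd h hWy.ne'
    · intro h0
      rw [h0, one_mul, sub_self] at e
      exact (mul_eq_zero.1 e).resolve_right hρ0.ne'

theorem Kn_tot [NeZero n] (x : E n) : ∫ y, Kn x y ∂(ms n) = ∫ y, Kn 0 y ∂(ms n) := by
  by_cases hx : x = 0
  · rw [hx]
  have hx' : 0 < ‖x‖ := by simpa using hx
  obtain ⟨c, R, hR, h1, h2, h3, h4, h5⟩ := exists_inv 0 x (Ne.symm hx) 1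
    (by unfold W; simp; positivity)
  have hs : sh c R = 0 := (h5 (by simpa using hx)).2 rfl
  have hm : ∀ y, cf c R y = 1 := by
    intro y
    by_cases hy : y = c
    · rw [hy, cf_self]
    · obtain ⟨D, hD, e⟩ := cf_one_sub c y hR hy
      rw [hs] at e
      linarith
  rw [← cf_cv c hR (fun y => Kn x y) (a := 0) (b := n) (by simp)]
  apply integral_congr_ae
  have : ∀ᵐ y ∂(ms n), y ≠ c := ae_ms (by simp [ae_iff])
  filter_upwards [this] with y hy
  have := Kn_sw c 0 y hR h1 hy
  rw [h3] at this
  simpa [hm] using this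

theorem Kn_symm (x y : E n) : Kn x y = Kn y x := by
  unfold Kn; rw [mul_comm, norm_sub_rev]

theorem Kn_meas : Measurable (Function.uncurry (Kn : E n → E n → ℝ)) := by
  unfold Kn Function.uncurry
  have := W_cont (n := n) |>.measurable
  fun_prop

theorem Kn_ker [NeZero n] (h : ∫ y, Kn (0 : E n) y ∂(ms n) ≠ 0) :
    Ker (ms n) (Kn : E n → E n → ℝ) (∫ y, Kn (0 : E n) y ∂(ms n)) where
  meas := Kn_meas
  nonneg x y := Real.rpow_nonneg (div_nonneg (mul_pos (W_pos x) (W_pos y)).le (by positivity)) _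
  int x := by
    by_contra hc
    rw [← Kn_tot x] at h
    exact h (integral_undef hc)
  tot := Kn_tot
  symm := Kn_symm

open Filter Topology in
theorem hls_E [NeZero n] (hn : 5 ≤ n) (h : ∫ y, Kn (0 : E n) y ∂(ms n) ≠ 0)
    [IsFiniteMeasure (ms n)] (hμ : 0 < (ms n).real Set.univ)
    (G : E n → ℝ) (M : ℝ) (hG : Measurable G) (hG0 : ∀ x, 0 ≤ G x) (hGM : ∀ x, G x ≤ M)
    (hM : 0 ≤ M) :
    en (ms n) Kn G ≤ (∫ y, Kn (0 : E n) y ∂(ms n)) * ((ms n).real Set.univ) ^ (-4 / (n : ℝ)) *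
      (∫ x, G x ^ (2 * n / (n + 4) : ℝ) ∂(ms n)) ^ ((n + 4) / n : ℝ) := by
  have hn' : (5 : ℝ) ≤ n := by exact_mod_cast hn
  have := hls_abs (a := ((n : ℝ) - 4) / 2) (b := ((n : ℝ) + 4) / 2) (p := 2 * n / (n + 4))
    (Kn_ker h) (fun x => ‖x‖) (by rw [lt_div_iff₀ (by linarith)]; linarith) (by field_simp; ring)
    ?_ ?_ hμ G M hG hG0 hGM hM
  · convert this using 3
    · congr 1; field_simp; ring
    · field_simp
  · intro x y hxy
    have hne : x ≠ y := by rintro rfl; exact lt_irrefl _ hxy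
    have hW : W x < 1 * W y := by
      unfold W; nlinarith [norm_nonneg x]
    have h1 : ∀ᶠ θ in 𝓝 (1 : ℝ), W x < θ * W y :=
      (continuous_id.mul continuous_const).continuousAt.eventually (lt_mem_nhds hW)
    filter_upwards [h1.filter_mono nhdsWithin_le_nhds, self_mem_nhdsWithin] with θ h2 h3
    obtain ⟨c, R, hR, i1, i2, i3, i4, i5⟩ := exists_inv x y hne θ h2
    refine ⟨inversion c R, cf c R, {c}, refl_inv hn c hR ?_, by simpa using i1, by simpa using i2,
      i3, i4⟩
    intro hs
    exact h3 ((i5 hxy).1 hs)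
  · intro x y
    obtain ⟨v, hv⟩ : ∃ v : E n, ‖x‖ + ‖y‖ < ‖v‖ := NormedSpace.exists_lt_norm ℝ (E n) _
    exact ⟨v, by linarith [norm_nonneg y], by linarith [norm_nonneg x]⟩

end geo

section const

variable {n : ℕ}

theorem lgam {a R : ℝ} (ha : 0 < a) (hR : 0 < R) :
    ∫⁻ t in Set.Ioi (0 : ℝ), ENNReal.ofReal (t ^ (a - 1) * Real.exp (-(R * t))) =
      ENNReal.ofReal ((1 / R) ^ a * Real.Gamma a) := by
  have h := Real.integral_rpow_mul_exp_neg_mul_Ioi ha hR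
  rw [← h, ofReal_integral_eq_lintegral_ofReal]
  · by_contra hc
    have h0 := integral_undef hc
    rw [h] at h0
    have : 0 < (1 / R) ^ a * Real.Gamma a := mul_pos (by positivity) (Real.Gamma_pos_of_pos ha)
    exact this.ne' h0
  · filter_upwards [ae_restrict_mem measurableSet_Ioi] with t ht
    have : (0 : ℝ) < t := ht
    simp only [Pi.zero_apply]
    positivity

theorem lgauss {b : ℝ} (hb : 0 < b) :
    ∫⁻ v : E n, ENNReal.ofReal (Real.exp (-b * ‖v‖ ^ 2)) =
      ENNReal.ofReal ((Real.pi / b) ^ ((n : ℝ) / 2)) := by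
  have h := GaussianFourier.integral_rexp_neg_mul_sq_norm (V := E n) hb
  simp only [finrank_euclideanSpace, Fintype.card_fin] at h
  have hp : 0 < (Real.pi / b) ^ ((n : ℝ) / 2) := by positivity
  rw [← h, ofReal_integral_eq_lintegral_ofReal]
  · by_contra hc
    have h0 := integral_undef hc
    rw [h] at h0
    exact hp.ne' h0
  · exact Filter.Eventually.of_forall fun v => (Real.exp_pos _).le

theorem ljap {s : ℝ} (hs : (n : ℝ) / 2 < s) :
    ∫⁻ x : E n, ENNReal.ofReal ((W x) ^ (-s)) =
      ENNReal.ofReal (Real.pi ^ ((n : ℝ) / 2) * Real.Gamma (s - n / 2) / Real.Gamma s) := by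
  have hs0 : 0 < s := lt_of_le_of_lt (by positivity) hs
  have hG := Real.Gamma_pos_of_pos hs0
  have hWm := (W_cont (n := n)).measurable
  have h1 : ∀ x : E n, ENNReal.ofReal (Real.Gamma s) * ENNReal.ofReal ((W x) ^ (-s)) =
      ∫⁻ t in Set.Ioi (0 : ℝ), ENNReal.ofReal (t ^ (s - 1) * Real.exp (-(W x * t))) := by
    intro x
    rw [lgam hs0 (W_pos x), ← ENNReal.ofReal_mul hG.le, one_div, Real.inv_rpow (W_pos x).le,
      Real.rpow_neg (W_pos x).le, mul_comm]
  have h2 : ENNReal.ofReal (Real.Gamma s) * ∫⁻ x : E n, ENNReal.ofReal ((W x) ^ (-s)) =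
      ENNReal.ofReal (Real.pi ^ ((n : ℝ) / 2) * Real.Gamma (s - n / 2)) := by
    rw [← lintegral_const_mul _ (by fun_prop)]
    simp_rw [h1]
    rw [lintegral_lintegral_swap (by fun_prop)]
    have h3 : ∀ t ∈ Set.Ioi (0 : ℝ),
        ∫⁻ x : E n, ENNReal.ofReal (t ^ (s - 1) * Real.exp (-(W x * t))) =
        ENNReal.ofReal (Real.pi ^ ((n : ℝ) / 2)) *
          ENNReal.ofReal (t ^ ((s - n / 2) - 1) * Real.exp (-(1 * t))) := by
      intro t ht
      have ht : 0 < t := ht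
      have e : ∀ x : E n, ENNReal.ofReal (t ^ (s - 1) * Real.exp (-(W x * t))) =
        ENNReal.ofReal (t ^ (s - 1) * Real.exp (-(1 * t))) *
          ENNReal.ofReal (Real.exp (-t * ‖x‖ ^ 2)) := by
        intro x
        rw [← ENNReal.ofReal_mul (by positivity), mul_assoc, ← Real.exp_add]
        congr 3; unfold W; ring
      simp_rw [e]
      rw [lintegral_const_mul _ (by fun_prop), lgauss ht, ← ENNReal.ofReal_mul (by positivity),
        ← ENNReal.ofReal_mul (by positivity)]
      congr 1
      rw [Real.div_rpow Real.pi_pos.le ht.le, show s - n / 2 - 1 = (s - 1) - n / 2 by ring,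
        Real.rpow_sub ht (s - 1)]
      ring
    rw [setLIntegral_congr_fun measurableSet_Ioi h3, lintegral_const_mul _ (by fun_prop),
      lgam (by linarith) one_pos, ← ENNReal.ofReal_mul (by positivity)]
    simp
  rw [ENNReal.ofReal_div_of_pos hG, ← h2, mul_comm, mul_div_assoc, ENNReal.div_self, mul_one]
  · simpa using hG
  · simp

theorem ms_univ (hn : 5 ≤ n) : (ms n) Set.univ =
    ENNReal.ofReal (Real.pi ^ ((n : ℝ) / 2) * Real.Gamma (n / 2) / Real.Gamma n) := by
  have hn' : (5 : ℝ) ≤ n := by exact_mod_cast hn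
  unfold ms
  rw [withDensity_apply _ MeasurableSet.univ, Measure.restrict_univ, ljap (by linarith)]
  congr 4; ring

theorem ms_fin (hn : 5 ≤ n) : IsFiniteMeasure (ms n) := ⟨by rw [ms_univ hn]; simp⟩

theorem ms_real (hn : 5 ≤ n) : (ms n).real Set.univ =
    Real.pi ^ ((n : ℝ) / 2) * Real.Gamma (n / 2) / Real.Gamma n := by
  have hn' : (5 : ℝ) ≤ n := by exact_mod_cast hn
  have h1 := Real.Gamma_pos_of_pos (s := (n : ℝ)) (by linarith)
  have h2 := Real.Gamma_pos_of_pos (s := (n : ℝ) / 2) (by linarith)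
  rw [Measure.real, ms_univ hn, ENNReal.toReal_ofReal (by positivity)]

/-- volume of the ball -/
noncomputable def V (n : ℕ) : ℝ := Real.pi ^ ((n : ℝ) / 2) / Real.Gamma (n / 2 + 1)

theorem V_pos : 0 < V n := by
  have h2 := Real.Gamma_pos_of_pos (s := (n : ℝ) / 2 + 1) (by positivity)
  unfold V; positivity

theorem vol_ball [NeZero n] : (volume : Measure (E n)).real (Metric.ball 0 1) = V n := by
  have := V_pos (n := n)
  rw [Measure.real, EuclideanSpace.volume_ball]
  unfold V at *
  simp only [ENNReal.ofReal_one, one_pow, one_mul, Fintype.card_fin]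
  rw [ENNReal.toReal_ofReal]
  · congr 1
    rw [Real.sqrt_eq_rpow, ← Real.rpow_natCast, ← Real.rpow_mul Real.pi_pos.le]
    congr 1; ring
  · have h2 := Real.Gamma_pos_of_pos (s := (n : ℝ) / 2 + 1) (by positivity)
    positivity

theorem radial {k : ℝ} (hk : 0 < k) :
    ∫ r in Set.Ioi (0 : ℝ), r ^ 3 * (1 + r ^ 2) ^ (-(k + 4) / 2) = 2 / (k * (k + 2)) := by
  have hd : ∀ r ∈ Set.Ici (0 : ℝ), HasDerivAt (fun r : ℝ => -(1 / k) * (1 + r ^ 2) ^ (-k / 2) +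
      1 / (k + 2) * (1 + r ^ 2) ^ (-(k + 2) / 2)) (r ^ 3 * (1 + r ^ 2) ^ (-(k + 4) / 2)) r := by
    intro r _
    have h0 : HasDerivAt (fun r : ℝ => 1 + r ^ 2) (2 * r) r := by
      simpa using (hasDerivAt_pow 2 r).const_add 1
    have hp : 0 < 1 + r ^ 2 := by positivity
    have h1 := (h0.rpow_const (p := -k / 2) (Or.inl hp.ne')).const_mul (-(1 / k))
    have h2 := (h0.rpow_const (p := -(k + 2) / 2) (Or.inl hp.ne')).const_mul (1 / (k + 2))
    refine (h1.add h2).congr_deriv ?_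
    have e1 : (1 + r ^ 2) ^ (-k / 2 - 1) = (1 + r ^ 2) * (1 + r ^ 2) ^ (-(k + 4) / 2) := by
      rw [← Real.rpow_one_add' hp.le]
      · congr 1; ring
      · intro h; linarith
    have e2 : (1 + r ^ 2) ^ (-(k + 2) / 2 - 1) = (1 + r ^ 2) ^ (-(k + 4) / 2) := by
      congr 1; ring
    rw [e1, e2]
    field_simp
    ring
  have ht : ∀ c : ℝ, 0 < c → Filter.Tendsto (fun r : ℝ => (1 + r ^ 2) ^ (-c)) Filter.atTop (nhds 0) := by
    intro c hc
    refine (tendsto_rpow_neg_atTop hc).comp ?_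
    exact Filter.tendsto_atTop_add_const_left _ _ (Filter.tendsto_pow_atTop two_ne_zero)
  have hlim : Filter.Tendsto (fun r : ℝ => -(1 / k) * (1 + r ^ 2) ^ (-k / 2) +
      1 / (k + 2) * (1 + r ^ 2) ^ (-(k + 2) / 2)) Filter.atTop (nhds 0) := by
    have h1 := ((ht (k / 2) (by positivity)).const_mul (-(1 / k))).add
      ((ht ((k + 2) / 2) (by positivity)).const_mul (1 / (k + 2)))
    simp only [mul_zero, add_zero] at h1
    convert h1 using 5
    · ring
    · ring
  rw [integral_Ioi_of_hasDerivAt_of_nonneg' hd _ hlim]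
  · simp; field_simp; ring
  · intro r hr
    have : (0 : ℝ) < r := hr
    positivity

theorem kappa [NeZero n] (hn : 5 ≤ n) : ∫ y, Kn (0 : E n) y ∂(ms n) = 2 * V n / (n + 2) := by
  have hn' : (5 : ℝ) ≤ n := by exact_mod_cast hn
  rw [int_ms]
  have e : ∀ y : E n, W y ^ (-(n : ℝ)) * Kn 0 y =
    (fun r : ℝ => (1 + r ^ 2) ^ (-(n : ℝ)) * ((1 + r ^ 2) / r ^ 2) ^ (((n : ℝ) - 4) / 2)) ‖y‖ := by
    intro y
    simp [Kn, W]
  rw [(integral_congr_ae (Filter.Eventually.of_forall e)).trans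
    (integral_fun_norm_addHaar (volume : Measure (E n))
      (fun r : ℝ => (1 + r ^ 2) ^ (-(n : ℝ)) * ((1 + r ^ 2) / r ^ 2) ^ (((n : ℝ) - 4) / 2)))]
  have e2 : ∀ r ∈ Set.Ioi (0 : ℝ), r ^ (Module.finrank ℝ (E n) - 1) •
      ((1 + r ^ 2) ^ (-(n : ℝ)) * ((1 + r ^ 2) / r ^ 2) ^ (((n : ℝ) - 4) / 2)) =
      r ^ 3 * (1 + r ^ 2) ^ (-((n : ℝ) + 4) / 2) := by
    intro r hr
    have hr : 0 < r := hr
    have hp : 0 < 1 + r ^ 2 := by positivity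
    rw [finrank_euclideanSpace, Fintype.card_fin, smul_eq_mul, Real.div_rpow hp.le (by positivity)]
    have h1 : (r ^ 2) ^ (((n : ℝ) - 4) / 2) = r ^ (n - 4) := by
      rw [← Real.rpow_natCast r 2, ← Real.rpow_mul hr.le, ← Real.rpow_natCast]
      congr 1
      push_cast [Nat.cast_sub (show 4 ≤ n by omega)]
      ring
    have h2 : r ^ (n - 1) = r ^ 3 * r ^ (n - 4) := by
      rw [← pow_add]; congr 1; omega
    have h3 : (1 + r ^ 2) ^ (-((n : ℝ) + 4) / 2) =
        (1 + r ^ 2) ^ (-(n : ℝ)) * (1 + r ^ 2) ^ (((n : ℝ) - 4) / 2) := by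
      rw [← Real.rpow_add hp]; congr 1; ring
    rw [h1, h2, h3]
    have : r ^ (n - 4) ≠ 0 := by positivity
    field_simp
  rw [setIntegral_congr_fun measurableSet_Ioi e2, radial (by linarith), vol_ball,
    finrank_euclideanSpace, Fintype.card_fin, nsmul_eq_mul, smul_eq_mul]
  field_simp

theorem hls_F (hn : 5 ≤ n) 
    (G : E n → ℝ) (M : ℝ) (hG : Measurable G) (hG0 : ∀ x, 0 ≤ G x) (hGM : ∀ x, G x ≤ M)
    (hM : 0 ≤ M) :
    en (ms n) Kn G ≤ (2 * V n / (n + 2)) *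
      (Real.pi ^ ((n : ℝ) / 2) * Real.Gamma (n / 2) / Real.Gamma n) ^ (-4 / (n : ℝ)) *
      (∫ x, G x ^ (2 * n / (n + 4) : ℝ) ∂(ms n)) ^ ((n + 4) / n : ℝ) := by
  have : NeZero n := ⟨by omega⟩
  have hn' : (5 : ℝ) ≤ n := by exact_mod_cast hn
  have := ms_fin hn
  have h1 := Real.Gamma_pos_of_pos (s := (n : ℝ)) (by linarith)
  have h2 := Real.Gamma_pos_of_pos (s := (n : ℝ) / 2) (by linarith)
  have hk := kappa hn
  have hV := V_pos (n := n)
  have := hls_E hn (by rw [hk]; positivity) (by rw [ms_real hn]; positivity) G M hG hG0 hGM hM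
  rwa [hk, ms_real hn] at this

end const

section comp

variable {n : ℕ}

theorem lgam_inv {a R : ℝ} (ha : 0 < a) (hR : 0 < R) :
    ∫⁻ t in Set.Ioi (0 : ℝ), ENNReal.ofReal (t ^ (-a - 1) * Real.exp (-(R / t))) =
      ENNReal.ofReal ((1 / R) ^ a * Real.Gamma a) := by
  have h := Real.integral_rpow_mul_exp_neg_mul_Ioi ha hR
  rw [← integral_comp_rpow_Ioi _ (show (-1 : ℝ) ≠ 0 by norm_num)] at h
  have e : ∀ t ∈ Set.Ioi (0 : ℝ), (|(-1 : ℝ)| * t ^ ((-1 : ℝ) - 1)) •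
      ((t ^ (-1 : ℝ)) ^ (a - 1) * Real.exp (-(R * t ^ (-1 : ℝ)))) =
      t ^ (-a - 1) * Real.exp (-(R / t)) := by
    intro t ht
    have ht : 0 < t := ht
    rw [← Real.rpow_mul ht.le, smul_eq_mul, abs_neg, abs_one, one_mul, ← mul_assoc,
      ← Real.rpow_add ht, Real.rpow_neg_one, div_eq_mul_inv]
    congr 2; ring
  rw [setIntegral_congr_fun measurableSet_Ioi e] at h
  rw [← h, ofReal_integral_eq_lintegral_ofReal]
  · by_contra hc
    have h0 := integral_undef hc
    rw [h] at h0
    have : 0 < (1 / R) ^ a * Real.Gamma a := mul_pos (by positivity) (Real.Gamma_pos_of_pos ha)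
    exact this.ne' h0
  · filter_upwards [ae_restrict_mem measurableSet_Ioi] with t ht
    have : (0 : ℝ) < t := ht
    simp only [Pi.zero_apply]
    positivity

theorem conv_add (φ : ℝ → ENNReal) (hφ : Measurable φ) :
    ∫⁻ t in Set.Ioi (0 : ℝ), ∫⁻ s in Set.Ioi (0 : ℝ), φ (t + s) =
      ∫⁻ τ in Set.Ioi (0 : ℝ), ENNReal.ofReal τ * φ τ := by
  have h1 : ∀ t : ℝ, ∫⁻ s in Set.Ioi (0 : ℝ), φ (t + s) =
      ∫⁻ τ, (Set.Ioi (0 : ℝ)).indicator 1 (τ - t) * φ τ := by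
    intro t
    rw [← lintegral_indicator measurableSet_Ioi,
      ← lintegral_sub_right_eq_self _ t]
    congr 1; ext τ
    by_cases h : τ - t ∈ Set.Ioi (0 : ℝ) <;> simp [Set.indicator, h]
  have hm : Measurable (fun p : ℝ × ℝ => (Set.Ioi (0 : ℝ)).indicator (1 : ℝ → ENNReal) (p.2 - p.1) * φ p.2) := by
    refine Measurable.mul ?_ (hφ.comp measurable_snd)
    exact (measurable_one.indicator measurableSet_Ioi).comp (measurable_snd.sub measurable_fst)
  simp_rw [h1]
  rw [lintegral_lintegral_swap hm.aemeasurable]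
  rw [← lintegral_indicator measurableSet_Ioi]
  congr 1; ext τ
  have hmi : Measurable (fun t : ℝ => (Set.Ioi (0 : ℝ)).indicator (1 : ℝ → ENNReal) (τ - t)) :=
    (measurable_one.indicator measurableSet_Ioi).comp (measurable_const.sub measurable_id)
  rw [lintegral_mul_const _ hmi]
  have h2 : ∫⁻ t in Set.Ioi (0 : ℝ), (Set.Ioi (0 : ℝ)).indicator (1 : ℝ → ENNReal) (τ - t) =
      ENNReal.ofReal τ := by
    have : ∀ t : ℝ, (Set.Ioi (0 : ℝ)).indicator (1 : ℝ → ENNReal) (τ - t) =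
        (Set.Iio τ).indicator 1 t := by
      intro t
      by_cases h : t < τ <;> simp [h]
    simp_rw [this]
    rw [lintegral_indicator_one measurableSet_Iio, Measure.restrict_apply measurableSet_Iio,
      Set.Iio_inter_Ioi]
    simp
  rw [h2]
  by_cases h : 0 < τ
  · simp [h]
  · simp [h, ENNReal.ofReal_of_nonpos (not_lt.1 h)]

theorem gauss_id (x y z : E n) {t s : ℝ} (ht : 0 < t) (hs : 0 < s) :
    ‖x - z‖ ^ 2 / t + ‖z - y‖ ^ 2 / s =
      ((t + s) / (t * s)) * ‖z - (t + s)⁻¹ • (s • x + t • y)‖ ^ 2 + ‖x - y‖ ^ 2 / (t + s) := by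
  have hts : 0 < t + s := by positivity
  have e1 : z - (t + s)⁻¹ • (s • x + t • y) = (t + s)⁻¹ • (t • (z - y) - s • (x - z)) := by
    have : z = (t + s)⁻¹ • ((t + s) • z) := by rw [smul_smul, inv_mul_cancel₀ hts.ne', one_smul]
    nth_rewrite 1 [this]
    rw [← smul_sub]
    congr 1
    simp only [smul_sub, add_smul]; abel
  have e2 : x - y = (x - z) + (z - y) := by abel
  rw [e1, e2]
  generalize x - z = p
  generalize z - y = q
  rw [norm_smul, mul_pow, norm_sub_sq_real, norm_add_sq_real, norm_smul, norm_smul, inner_smul_left,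
    inner_smul_right, real_inner_comm]
  simp only [Real.norm_eq_abs, mul_pow, sq_abs, conj_trivial]
  field_simp
  ring

theorem gauss_conv (x y : E n) {t s : ℝ} (ht : 0 < t) (hs : 0 < s) :
    ∫⁻ z, ENNReal.ofReal (Real.exp (-(‖x - z‖ ^ 2 / t)) * Real.exp (-(‖z - y‖ ^ 2 / s))) =
      ENNReal.ofReal ((Real.pi * (t * s) / (t + s)) ^ ((n : ℝ) / 2) *
        Real.exp (-(‖x - y‖ ^ 2 / (t + s)))) := by
  set w := (t + s)⁻¹ • (s • x + t • y) with hw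
  have e : ∀ z : E n, ENNReal.ofReal (Real.exp (-(‖x - z‖ ^ 2 / t)) * Real.exp (-(‖z - y‖ ^ 2 / s)))
      = (fun v : E n => ENNReal.ofReal (Real.exp (-((t + s) / (t * s)) * ‖v‖ ^ 2)) *
        ENNReal.ofReal (Real.exp (-(‖x - y‖ ^ 2 / (t + s))))) (z - w) := by
    intro z
    simp only []
    rw [← ENNReal.ofReal_mul (Real.exp_pos _).le, ← Real.exp_add, ← Real.exp_add]
    congr 2
    have := gauss_id x y z ht hs
    rw [← hw] at this
    linarith
  rw [lintegral_congr e, lintegral_sub_right_eq_self (fun v : E n => ENNReal.ofReal (Real.exp (-((t + s) / (t * s)) * ‖v‖ ^ 2)) *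
        ENNReal.ofReal (Real.exp (-(‖x - y‖ ^ 2 / (t + s))))),
    lintegral_mul_const _ (by fun_prop), lgauss (by positivity),
    ← ENNReal.ofReal_mul (by positivity)]
  congr 3
  field_simp

/-- composition constant -/
noncomputable def c3 (n : ℕ) : ℝ :=
  Real.pi ^ ((n : ℝ) / 2) * Real.Gamma (n / 2 - 2) / Real.Gamma (n / 2 - 1) ^ 2

theorem riesz_rep (hn : 5 ≤ n) (v : E n) (hv : v ≠ 0) :
    ENNReal.ofReal (Real.Gamma (n / 2 - 1)) * ENNReal.ofReal (‖v‖ ^ (2 - (n : ℝ))) =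
      ∫⁻ t in Set.Ioi (0 : ℝ), ENNReal.ofReal (t ^ (-((n : ℝ) / 2)) * Real.exp (-(‖v‖ ^ 2 / t))) := by
  have hn' : (5 : ℝ) ≤ n := by exact_mod_cast hn
  have hv' : 0 < ‖v‖ := by simpa using hv
  have hG := Real.Gamma_pos_of_pos (s := (n : ℝ) / 2 - 1) (by linarith)
  have := lgam_inv (a := (n : ℝ) / 2 - 1) (R := ‖v‖ ^ 2) (by linarith) (by positivity)
  rw [show -((n : ℝ) / 2 - 1) - 1 = -((n : ℝ) / 2) by ring] at this
  rw [this, ← ENNReal.ofReal_mul hG.le, mul_comm]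
  congr 2
  rw [one_div, Real.inv_rpow (by positivity), ← Real.rpow_neg (by positivity),
    ← Real.rpow_natCast, ← Real.rpow_mul hv'.le]
  congr 1; push_cast; ring

theorem comp (hn : 5 ≤ n) (x y : E n) (hxy : x ≠ y) :
    ∫⁻ z, ENNReal.ofReal (‖x - z‖ ^ (2 - (n : ℝ))) * ENNReal.ofReal (‖z - y‖ ^ (2 - (n : ℝ))) =
      ENNReal.ofReal (c3 n * ‖x - y‖ ^ (4 - (n : ℝ))) := by
  have : NeZero n := ⟨by omega⟩
  have hn' : (5 : ℝ) ≤ n := by exact_mod_cast hn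
  have hG := Real.Gamma_pos_of_pos (s := (n : ℝ) / 2 - 1) (by linarith)
  have hG2 := Real.Gamma_pos_of_pos (s := (n : ℝ) / 2 - 2) (by linarith)
  have hd : 0 < ‖x - y‖ := by simpa [sub_eq_zero] using hxy
  set g := ENNReal.ofReal (Real.Gamma (n / 2 - 1)) with hg
  have aen : ∀ w : E n, ∀ᵐ z : E n, z ≠ w := fun w => by simp [ae_iff]
  have h1 : g ^ 2 * ∫⁻ z, ENNReal.ofReal (‖x - z‖ ^ (2 - (n : ℝ))) *
      ENNReal.ofReal (‖z - y‖ ^ (2 - (n : ℝ))) =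
      ∫⁻ z : E n, ∫⁻ t in Set.Ioi (0 : ℝ), ∫⁻ s in Set.Ioi (0 : ℝ),
        ENNReal.ofReal (t ^ (-((n : ℝ) / 2)) * Real.exp (-(‖x - z‖ ^ 2 / t))) *
        ENNReal.ofReal (s ^ (-((n : ℝ) / 2)) * Real.exp (-(‖z - y‖ ^ 2 / s))) := by
    rw [← lintegral_const_mul _ (by fun_prop)]
    apply lintegral_congr_ae
    filter_upwards [aen x, aen y] with z hzx hzy
    have r1 := riesz_rep hn (x - z) (sub_ne_zero.2 (Ne.symm hzx))
    have r2 := riesz_rep hn (z - y) (sub_ne_zero.2 hzy)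
    rw [← hg] at r1 r2
    rw [lintegral_lintegral_mul (by fun_prop) (by fun_prop), ← r1, ← r2]
    ring
  have h2 : ∫⁻ z : E n, ∫⁻ t in Set.Ioi (0 : ℝ), ∫⁻ s in Set.Ioi (0 : ℝ),
        ENNReal.ofReal (t ^ (-((n : ℝ) / 2)) * Real.exp (-(‖x - z‖ ^ 2 / t))) *
        ENNReal.ofReal (s ^ (-((n : ℝ) / 2)) * Real.exp (-(‖z - y‖ ^ 2 / s))) =
      ∫⁻ t in Set.Ioi (0 : ℝ), ∫⁻ s in Set.Ioi (0 : ℝ), ∫⁻ z : E n,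
        ENNReal.ofReal (t ^ (-((n : ℝ) / 2)) * Real.exp (-(‖x - z‖ ^ 2 / t))) *
        ENNReal.ofReal (s ^ (-((n : ℝ) / 2)) * Real.exp (-(‖z - y‖ ^ 2 / s))) := by
    rw [lintegral_lintegral_swap]
    · apply lintegral_congr
      intro t
      rw [lintegral_lintegral_swap (by fun_prop)]
    · apply Measurable.aemeasurable
      apply Measurable.lintegral_prod_right' (f := fun (q : (E n × ℝ) × ℝ) =>
        ENNReal.ofReal (q.1.2 ^ (-((n : ℝ) / 2)) * Real.exp (-(‖x - q.1.1‖ ^ 2 / q.1.2))) *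
        ENNReal.ofReal (q.2 ^ (-((n : ℝ) / 2)) * Real.exp (-(‖q.1.1 - y‖ ^ 2 / q.2))))
      fun_prop
  have h3 : ∀ t ∈ Set.Ioi (0 : ℝ), ∫⁻ s in Set.Ioi (0 : ℝ), ∫⁻ z : E n,
        ENNReal.ofReal (t ^ (-((n : ℝ) / 2)) * Real.exp (-(‖x - z‖ ^ 2 / t))) *
        ENNReal.ofReal (s ^ (-((n : ℝ) / 2)) * Real.exp (-(‖z - y‖ ^ 2 / s))) =
      ∫⁻ s in Set.Ioi (0 : ℝ), (fun τ : ℝ => ENNReal.ofReal (Real.pi ^ ((n : ℝ) / 2) *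
        (τ ^ (-((n : ℝ) / 2)) * Real.exp (-(‖x - y‖ ^ 2 / τ))))) (t + s) := by
    intro t ht
    have ht : 0 < t := ht
    apply setLIntegral_congr_fun measurableSet_Ioi
    intro s hs
    have hs : 0 < s := hs
    have e : ∀ z : E n, ENNReal.ofReal (t ^ (-((n : ℝ) / 2)) * Real.exp (-(‖x - z‖ ^ 2 / t))) *
        ENNReal.ofReal (s ^ (-((n : ℝ) / 2)) * Real.exp (-(‖z - y‖ ^ 2 / s))) =
        ENNReal.ofReal (t ^ (-((n : ℝ) / 2)) * s ^ (-((n : ℝ) / 2))) *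
        ENNReal.ofReal (Real.exp (-(‖x - z‖ ^ 2 / t)) * Real.exp (-(‖z - y‖ ^ 2 / s))) := by
      intro z
      rw [← ENNReal.ofReal_mul (by positivity), ← ENNReal.ofReal_mul (by positivity)]
      congr 1; ring
    simp only []
    rw [lintegral_congr e, lintegral_const_mul _ (by fun_prop), gauss_conv x y ht hs,
      ← ENNReal.ofReal_mul (by positivity)]
    congr 1
    rw [Real.div_rpow (by positivity) (by positivity), Real.mul_rpow Real.pi_pos.le (by positivity),
      Real.mul_rpow ht.le hs.le, Real.rpow_neg ht.le, Real.rpow_neg hs.le,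
      Real.rpow_neg (by positivity)]
    field_simp
  rw [h2, setLIntegral_congr_fun measurableSet_Ioi h3] at h1
  have h1 := h1.trans (conv_add (fun τ : ℝ => ENNReal.ofReal (Real.pi ^ ((n : ℝ) / 2) *
        (τ ^ (-((n : ℝ) / 2)) * Real.exp (-(‖x - y‖ ^ 2 / τ))))) (by fun_prop))
  have h4 : ∀ τ ∈ Set.Ioi (0 : ℝ), ENNReal.ofReal τ * ENNReal.ofReal (Real.pi ^ ((n : ℝ) / 2) *
        (τ ^ (-((n : ℝ) / 2)) * Real.exp (-(‖x - y‖ ^ 2 / τ)))) =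
      ENNReal.ofReal (Real.pi ^ ((n : ℝ) / 2)) *
        ENNReal.ofReal (τ ^ (-((n : ℝ) / 2 - 2) - 1) * Real.exp (-(‖x - y‖ ^ 2 / τ))) := by
    intro τ hτ
    have hτ : 0 < τ := hτ
    rw [← ENNReal.ofReal_mul hτ.le, ← ENNReal.ofReal_mul (by positivity),
      show -((n : ℝ) / 2 - 2) - 1 = 1 + -((n : ℝ) / 2) by ring, Real.rpow_add hτ, Real.rpow_one]
    congr 1; ring
  rw [setLIntegral_congr_fun measurableSet_Ioi h4, lintegral_const_mul _ (by fun_prop),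
    lgam_inv (by linarith) (by positivity), ← ENNReal.ofReal_mul (by positivity)] at h1
  have hg0 : g ≠ 0 := by simpa [hg] using hG
  have hgt : g ≠ ⊤ := by simp [hg]
  have h5 : g ^ 2 * ENNReal.ofReal (c3 n * ‖x - y‖ ^ (4 - (n : ℝ))) =
      ENNReal.ofReal (Real.pi ^ ((n : ℝ) / 2) *
        ((1 / ‖x - y‖ ^ 2) ^ ((n : ℝ) / 2 - 2) * Real.Gamma (n / 2 - 2))) := by
    rw [hg, ← ENNReal.ofReal_pow hG.le, ← ENNReal.ofReal_mul (by positivity)]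
    congr 1
    have : (1 / ‖x - y‖ ^ 2) ^ ((n : ℝ) / 2 - 2) = ‖x - y‖ ^ (4 - (n : ℝ)) := by
      rw [one_div, Real.inv_rpow (by positivity), ← Real.rpow_neg (by positivity),
        ← Real.rpow_natCast, ← Real.rpow_mul hd.le]
      congr 1; push_cast; ring
    rw [this, c3]
    have hG' := hG.ne'
    clear_value g
    clear h1
    generalize Real.Gamma ((n : ℝ) / 2 - 1) = γ at *
    generalize Real.Gamma ((n : ℝ) / 2 - 2) = δ at *
    generalize ‖x - y‖ ^ (4 - (n : ℝ)) = η at *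
    generalize Real.pi ^ ((n : ℝ) / 2) = ζ at *
    field_simp
  rw [← h5] at h1
  exact (ENNReal.mul_right_inj (pow_ne_zero 2 hg0) (ENNReal.pow_ne_top hgt)).1 h1

theorem c3_eq (hn : 5 ≤ n) : c3 n = V n * (n * (n - 2)) / (2 * (n - 4)) := by
  have hn' : (5 : ℝ) ≤ n := by exact_mod_cast hn
  have hG2 := Real.Gamma_pos_of_pos (s := (n : ℝ) / 2 - 2) (by linarith)
  have a1 : Real.Gamma ((n : ℝ) / 2 - 1) = (n / 2 - 2) * Real.Gamma (n / 2 - 2) := by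
    rw [← Real.Gamma_add_one (by linarith)]; congr 1; ring
  have a2 : Real.Gamma ((n : ℝ) / 2) = (n / 2 - 1) * Real.Gamma (n / 2 - 1) := by
    rw [← Real.Gamma_add_one (by linarith)]; congr 1; ring
  have a3 : Real.Gamma ((n : ℝ) / 2 + 1) = (n / 2) * Real.Gamma (n / 2) :=
    Real.Gamma_add_one (by linarith)
  unfold c3 V
  rw [a3, a2, a1]
  have b1 : (n : ℝ) - 4 ≠ 0 := by linarith
  have b2 : (n : ℝ) - 2 ≠ 0 := by linarith
  have b3 : (n : ℝ) / 2 - 1 = (n - 2) / 2 := by ring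
  have b4 : (n : ℝ) / 2 - 2 = (n - 4) / 2 := by ring
  rw [b3]
  rw [b4] at hG2 ⊢
  generalize Real.Gamma (((n : ℝ) - 4) / 2) = γ at *
  field_simp
  try ring

end comp

section green
variable {n : ℕ}

theorem cfd {f : E n → ℝ} (hf : ContDiff ℝ 1 f) (v : E n) :
    Continuous (fun z => fderiv ℝ f z v) :=
  (hf.continuous_fderiv one_ne_zero).clm_apply continuous_const

theorem ibp1 {f g : E n → ℝ} (hf : ContDiff ℝ 1 f) (hg : ContDiff ℝ 1 g)
    (hs : HasCompactSupport g) (v : E n) :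
    ∫ x, f x * fderiv ℝ g x v = - ∫ x, fderiv ℝ f x v * g x := by
  have cf := cfd hf v
  have cg := cfd hg v
  refine integral_mul_fderiv_eq_neg_fderiv_mul_of_integrable ?_ ?_ ?_
    (fun x _ => (hf.differentiable one_ne_zero) x) (fun x _ => (hg.differentiable one_ne_zero) x)
  · exact (cf.mul hg.continuous).integrable_of_hasCompactSupport hs.mul_left
  · exact (hf.continuous.mul cg).integrable_of_hasCompactSupport
      ((hs.fderiv_apply (𝕜 := ℝ) v).mul_left)
  · exact (hf.continuous.mul hg.continuous).integrable_of_hasCompactSupport hs.mul_left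

theorem lap_eq {f : E n → ℝ} (hf : ContDiff ℝ 2 f) (x : E n) :
    laplacian f x = ∑ i : Fin n, fderiv ℝ (fun z => fderiv ℝ f z (EuclideanSpace.single i 1)) x
      (EuclideanSpace.single i 1) := by
  unfold laplacian
  refine Finset.sum_congr rfl fun i _ => ?_
  rw [iteratedFDeriv_two_apply]
  have : DifferentiableAt ℝ (fderiv ℝ f) x :=
    ((hf.fderiv_right (m := 1) (by norm_num)).differentiable one_ne_zero) x
  rw [fderiv_clm_apply this (by fun_prop)]
  simp

theorem cd1 {f : E n → ℝ} (hf : ContDiff ℝ 2 f) (v : E n) :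
    ContDiff ℝ 1 (fun z => fderiv ℝ f z v) :=
  (hf.fderiv_right (m := 1) (by norm_num)).clm_apply contDiff_const

theorem lap_cont {f : E n → ℝ} (hf : ContDiff ℝ 2 f) : Continuous (laplacian f) := by
  have : laplacian f = fun x => ∑ i : Fin n,
      fderiv ℝ (fun z => fderiv ℝ f z (EuclideanSpace.single i 1)) x
      (EuclideanSpace.single i 1) := funext fun x => lap_eq hf x
  rw [this]
  exact continuous_finsetSum _ fun i _ =>
    cfd (cd1 hf _) _

theorem lap_supp {f : E n → ℝ} (hs : HasCompactSupport f) :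
    HasCompactSupport (laplacian f) := by
  refine hs.iteratedFDeriv (𝕜 := ℝ) 2 |>.mono' ?_
  intro x hx
  apply subset_tsupport
  intro h
  apply hx
  simp [laplacian, h]

theorem green {f g : E n → ℝ} (hf : ContDiff ℝ 2 f) (hg : ContDiff ℝ 2 g)
    (hs : HasCompactSupport g) :
    ∫ x, f x * laplacian g x = ∫ x, laplacian f x * g x := by
  have h (i : Fin n) := ibp1 (hf.of_le one_le_two) (cd1 hg (EuclideanSpace.single i 1))
    (hs.fderiv_apply (𝕜 := ℝ) _) (EuclideanSpace.single i 1)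
  have h' (i : Fin n) := ibp1 (cd1 hf (EuclideanSpace.single i 1)) (hg.of_le one_le_two)
    hs (EuclideanSpace.single i 1)
  simp_rw [lap_eq hf, lap_eq hg, Finset.mul_sum, Finset.sum_mul]
  rw [integral_finsetSum, integral_finsetSum]
  · refine Finset.sum_congr rfl fun i _ => ?_
    rw [h i, h' i, neg_neg]
  · intro i _
    exact ((cfd (cd1 hf _) _).mul hg.continuous).integrable_of_hasCompactSupport hs.mul_left
  · intro i _
    exact (hf.continuous.mul (cfd (cd1 hg _) _)).integrable_of_hasCompactSupport
      (((hs.fderiv_apply (𝕜 := ℝ) _).fderiv_apply (𝕜 := ℝ) _).mul_left)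

theorem fdQ (x : E n) {ε : ℝ} (hε : 0 < ε) (a : ℝ) (z : E n) :
    HasFDerivAt (fun z : E n => (‖z - x‖ ^ 2 + ε ^ 2) ^ a)
      ((a * (‖z - x‖ ^ 2 + ε ^ 2) ^ (a - 1)) • (2 • (innerSL ℝ (z - x)))) z := by
  have h1 : HasFDerivAt (fun z : E n => ‖z - x‖ ^ 2 + ε ^ 2) (2 • (innerSL ℝ (z - x))) z := by
    have := ((hasStrictFDerivAt_norm_sq (z - x)).hasFDerivAt.comp z
      ((hasFDerivAt_id z).sub_const x)).add_const (ε ^ 2)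
    refine this.congr_fderiv ?_
    ext; simp
  exact h1.rpow_const (Or.inl (by positivity))

theorem cdQ (x : E n) {ε : ℝ} (hε : 0 < ε) (a : ℝ) :
    ContDiff ℝ 2 (fun z : E n => (‖z - x‖ ^ 2 + ε ^ 2) ^ a) := by
  refine ContDiff.rpow_const_of_ne ?_ (fun z => by positivity)
  exact ((contDiff_id.sub contDiff_const).norm_sq ℝ).add contDiff_const

theorem lapQ (x : E n) {ε : ℝ} (hε : 0 < ε) (z : E n) :
    laplacian (fun z : E n => (‖z - x‖ ^ 2 + ε ^ 2) ^ ((2 - (n : ℝ)) / 2)) z =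
      - (n * (n - 2) * ε ^ 2 * (‖z - x‖ ^ 2 + ε ^ 2) ^ (-((n : ℝ) + 2) / 2)) := by
  rw [lap_eq (cdQ x hε _)]
  have hQ : 0 < ‖z - x‖ ^ 2 + ε ^ 2 := by positivity
  have key (i : Fin n) : fderiv ℝ (fun z => fderiv ℝ
      (fun z : E n => (‖z - x‖ ^ 2 + ε ^ 2) ^ ((2 - (n : ℝ)) / 2)) z
      (EuclideanSpace.single i 1)) z (EuclideanSpace.single i 1) =
      (2 - n) * (‖z - x‖ ^ 2 + ε ^ 2) ^ (-(n : ℝ) / 2) +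
      (2 - n) * (-n) * ((z i - x i) ^ 2 * (‖z - x‖ ^ 2 + ε ^ 2) ^ (-((n : ℝ) + 2) / 2)) := by
    have e1 : (fun z => fderiv ℝ
      (fun z : E n => (‖z - x‖ ^ 2 + ε ^ 2) ^ ((2 - (n : ℝ)) / 2)) z
      (EuclideanSpace.single i 1)) = fun z : E n =>
        (2 - n) * ((‖z - x‖ ^ 2 + ε ^ 2) ^ (-(n : ℝ) / 2) * (z i - x i)) := by
      ext w
      rw [(fdQ x hε _ w).fderiv]
      have : (2 - (n : ℝ)) / 2 - 1 = -(n : ℝ) / 2 := by ring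
      rw [this]
      simp [EuclideanSpace.inner_single_right]
      ring
    rw [e1]
    have h2 : HasFDerivAt (fun z : E n => z i - x i) (EuclideanSpace.proj (𝕜 := ℝ) i : E n →L[ℝ] ℝ) z :=
      ((EuclideanSpace.proj (𝕜 := ℝ) i : E n →L[ℝ] ℝ).hasFDerivAt).sub_const _
    have h3 := ((fdQ x hε (-(n : ℝ) / 2) z).mul h2).const_mul (2 - (n : ℝ))
    refine (congrArg (fun L => L (EuclideanSpace.single i 1)) (HasFDerivAt.fderiv h3)).trans ?_
    have : -(n : ℝ) / 2 - 1 = -((n : ℝ) + 2) / 2 := by ring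
    rw [this]
    simp [EuclideanSpace.inner_single_right]
    ring
  simp_rw [key]
  rw [Finset.sum_add_distrib, ← Finset.mul_sum, ← Finset.mul_sum, ← Finset.sum_mul]
  have : ∑ i, (z i - x i) ^ 2 = ‖z - x‖ ^ 2 := by
    rw [EuclideanSpace.norm_sq_eq]; simp
  rw [this]
  have h4 : (‖z - x‖ ^ 2 + ε ^ 2) ^ (-(n : ℝ) / 2) =
      (‖z - x‖ ^ 2 + ε ^ 2) * (‖z - x‖ ^ 2 + ε ^ 2) ^ (-((n : ℝ) + 2) / 2) := by
    nth_rewrite 2 [← Real.rpow_one (‖z - x‖ ^ 2 + ε ^ 2)]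
    rw [← Real.rpow_add hQ]; congr 1; ring
  rw [h4]
  simp
  ring
end green

section repr
variable {n : ℕ}
open Filter Topology

theorem WV : Integrable (fun w : E n => (W w) ^ (-((n : ℝ) + 2) / 2)) ∧
    ∫ w : E n, (W w) ^ (-((n : ℝ) + 2) / 2) = V n := by
  have h := ljap (n := n) (s := ((n : ℝ) + 2) / 2) (by linarith)
  have e : Real.pi ^ ((n : ℝ) / 2) * Real.Gamma (((n : ℝ) + 2) / 2 - n / 2) /
      Real.Gamma (((n : ℝ) + 2) / 2) = V n := by
    have e1 : ((n : ℝ) + 2) / 2 - n / 2 = 1 := by ring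
    have e2 : ((n : ℝ) + 2) / 2 = n / 2 + 1 := by ring
    rw [e1, Real.Gamma_one, e2, mul_one, V]
  rw [e, ← neg_div] at h
  have hm : Measurable (fun w : E n => (W w) ^ (-((n : ℝ) + 2) / 2)) :=
    W_cont.measurable.pow_const _
  have h0 : ∀ w : E n, 0 ≤ (W w) ^ (-((n : ℝ) + 2) / 2) := fun w => (Real.rpow_pos_of_pos (W_pos w) _).le
  constructor
  · refine ⟨hm.aestronglyMeasurable, ?_⟩
    rw [hasFiniteIntegral_iff_ofReal (Eventually.of_forall h0), h]
    exact ENNReal.ofReal_lt_top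
  · rw [integral_eq_lintegral_of_nonneg_ae (Eventually.of_forall h0) hm.aestronglyMeasurable, h,
      ENNReal.toReal_ofReal (V_pos (n := n)).le]

theorem subst_eps (u : E n → ℝ) (x : E n) {ε : ℝ} (hε : 0 < ε) :
    ∫ w : E n, (W w) ^ (-((n : ℝ) + 2) / 2) * u (x + ε • w) =
    ∫ z : E n, ε ^ 2 * (‖z - x‖ ^ 2 + ε ^ 2) ^ (-((n : ℝ) + 2) / 2) * u z := by
  set g : E n → ℝ := fun z => ε ^ 2 * (‖z‖ ^ 2 + ε ^ 2) ^ (-((n : ℝ) + 2) / 2) * u (z + x) with hg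
  have h1 : ∫ z : E n, ε ^ 2 * (‖z - x‖ ^ 2 + ε ^ 2) ^ (-((n : ℝ) + 2) / 2) * u z = ∫ z, g z := by
    rw [← integral_sub_right_eq_self g x]
    simp [hg]
  rw [h1]
  have h2 := Measure.integral_comp_smul (volume : Measure (E n)) g ε
  have h3 : ∀ w : E n, g (ε • w) = (ε ^ n)⁻¹ * ((W w) ^ (-((n : ℝ) + 2) / 2) * u (x + ε • w)) := by
    intro w
    have : ‖ε • w‖ ^ 2 + ε ^ 2 = ε ^ 2 * W w := by
      rw [norm_smul, Real.norm_eq_abs, mul_pow, sq_abs, W]; ring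
    simp only [hg]
    rw [this, Real.mul_rpow (by positivity) (W_pos w).le, add_comm x]
    have e : ε ^ 2 * (ε ^ 2) ^ (-((n : ℝ) + 2) / 2) = (ε ^ n)⁻¹ := by
      rw [← Real.rpow_natCast ε n, ← Real.rpow_neg hε.le, ← Real.rpow_natCast ε 2,
        ← Real.rpow_mul hε.le, ← Real.rpow_add hε]
      congr 1; push_cast; ring
    rw [← e]; ring
  simp_rw [h3] at h2
  rw [integral_const_mul] at h2
  have hp : 0 < (ε ^ n)⁻¹ := by positivity
  rw [finrank_euclideanSpace, Fintype.card_fin, abs_of_pos hp, smul_eq_mul] at h2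
  exact mul_left_cancel₀ hp.ne' h2

theorem approx {u : E n → ℝ} (hu : Continuous u) (hs : HasCompactSupport u) (x : E n) :
    Tendsto (fun ε : ℝ => ∫ w : E n, (W w) ^ (-((n : ℝ) + 2) / 2) * u (x + ε • w)) (𝓝[>] 0)
      (𝓝 (V n * u x)) := by
  obtain ⟨C, hC⟩ := hs.exists_bound_of_continuous hu
  rw [← (WV (n := n)).2, ← integral_mul_const]
  refine tendsto_integral_filter_of_dominated_convergence
    (fun w => (W w) ^ (-((n : ℝ) + 2) / 2) * C) ?_ ?_ ((WV (n := n)).1.mul_const C) ?_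
  · refine Eventually.of_forall fun ε => ?_
    exact ((W_cont.measurable.pow_const _).mul (by fun_prop)).aestronglyMeasurable
  · refine Eventually.of_forall fun ε => Eventually.of_forall fun w => ?_
    rw [norm_mul, Real.norm_of_nonneg (Real.rpow_pos_of_pos (W_pos w) _).le]
    exact mul_le_mul_of_nonneg_left (hC _) (Real.rpow_pos_of_pos (W_pos w) _).le
  · refine Eventually.of_forall fun w => ?_
    refine Tendsto.const_mul _ ?_
    have : Continuous fun ε : ℝ => u (x + ε • w) := by fun_prop
    have h := this.tendsto 0
    simp only [zero_smul, add_zero] at h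
    exact h.mono_left nhdsWithin_le_nhds

theorem rep (hn : 5 ≤ n) {u : E n → ℝ} (hu : ContDiff ℝ 2 u) (hs : HasCompactSupport u) (x : E n) :
    ENNReal.ofReal |u x| ≤ ENNReal.ofReal (1 / (n * (n - 2) * V n)) *
      ∫⁻ z, ENNReal.ofReal (‖x - z‖ ^ (2 - (n : ℝ))) * ENNReal.ofReal |laplacian u z| := by
  have hn' : (5 : ℝ) ≤ n := by exact_mod_cast hn
  have hV := V_pos (n := n)
  have hc : 0 < (n : ℝ) * (n - 2) := by nlinarith
  have main : ENNReal.ofReal (n * (n - 2) * V n * |u x|) ≤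
      ∫⁻ z, ENNReal.ofReal (‖x - z‖ ^ (2 - (n : ℝ))) * ENNReal.ofReal |laplacian u z| := by
    have ht := ((approx hu.continuous hs x).abs.const_mul ((n : ℝ) * (n - 2)))
    have ht' := (ENNReal.continuous_ofReal.tendsto _).comp ht
    have e0 : (n : ℝ) * (n - 2) * |V n * u x| = n * (n - 2) * V n * |u x| := by
      rw [abs_mul, abs_of_pos hV]; ring
    rw [e0] at ht'
    refine le_of_tendsto ht' ?_
    filter_upwards [self_mem_nhdsWithin] with ε hε
    have hε : 0 < ε := hε
    simp only [Function.comp]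
    rw [subst_eps u x hε]
    have hg := green (cdQ x hε ((2 - (n : ℝ)) / 2)) hu hs
    simp_rw [lapQ x hε] at hg
    have e1 : (n : ℝ) * (n - 2) * |∫ z : E n, ε ^ 2 * (‖z - x‖ ^ 2 + ε ^ 2) ^ (-((n : ℝ) + 2) / 2) * u z|
        = |∫ z : E n, (‖z - x‖ ^ 2 + ε ^ 2) ^ ((2 - (n : ℝ)) / 2) * laplacian u z| := by
      rw [hg, ← abs_of_pos hc, ← abs_mul, abs_of_pos hc, ← integral_const_mul, ← abs_neg,
        ← integral_neg]
      congr 2; ext z; ring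
    rw [e1, ← Real.norm_eq_abs]
    refine (ENNReal.ofReal_le_ofReal (norm_integral_le_lintegral_norm _)).trans ?_
    refine ENNReal.ofReal_toReal_le.trans ?_
    have hne : ∀ᵐ z : E n, z ≠ x := by
      have : Nonempty (Fin n) := ⟨⟨0, by omega⟩⟩
      exact (measure_eq_zero_iff_ae_notMem.1 (measure_singleton (μ := (volume : Measure (E n))) x)).mono
        fun z hz => by simpa using hz
    refine lintegral_mono_ae ?_
    filter_upwards [hne] with z hz
    have hd : 0 < ‖x - z‖ := norm_pos_iff.2 (sub_ne_zero.2 hz.symm)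
    rw [← ENNReal.ofReal_mul (by positivity), norm_mul, Real.norm_eq_abs (laplacian u z)]
    refine ENNReal.ofReal_le_ofReal (mul_le_mul_of_nonneg_right ?_ (abs_nonneg _))
    rw [Real.norm_of_nonneg (by positivity), norm_sub_rev z x]
    have : ‖x - z‖ ^ (2 - (n : ℝ)) = (‖x - z‖ ^ 2) ^ ((2 - (n : ℝ)) / 2) := by
      rw [← Real.rpow_natCast, ← Real.rpow_mul hd.le]; congr 1; push_cast; ring
    rw [this]
    exact Real.rpow_le_rpow_of_nonpos (by positivity) (by nlinarith) (by linarith)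
  calc ENNReal.ofReal |u x| = ENNReal.ofReal (1 / (n * (n - 2) * V n)) *
        ENNReal.ofReal (n * (n - 2) * V n * |u x|) := by
        rw [← ENNReal.ofReal_mul (by positivity)]
        congr 1
        have h2 : (n : ℝ) - 2 ≠ 0 := by linarith
        field_simp
    _ ≤ _ := by gcongr
end repr

section fin
variable {n : ℕ}
open Filter Topology

theorem k_meas (s : ℝ) : Measurable (fun p : E n × E n => ENNReal.ofReal (‖p.1 - p.2‖ ^ s)) := by
  fun_prop

theorem k_swap (s : ℝ) (x z : E n) : ENNReal.ofReal (‖x - z‖ ^ s) = ENNReal.ofReal (‖z - x‖ ^ s) := by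
  rw [norm_sub_rev]

theorem sq3 {α : Type*} [MeasurableSpace α] {μ : Measure α} [SFinite μ] {k : α → α → ENNReal}
    (km : Measurable (fun p : α × α => k p.1 p.2)) (ks : ∀ x y, k x y = k y x)
    {φ : α → ENNReal} (hφ : Measurable φ) :
    ∫⁻ z, (∫⁻ x, k x z * φ x ∂μ) ^ 2 ∂μ =
      ∫⁻ x, ∫⁻ y, (∫⁻ z, k x z * k z y ∂μ) * (φ x * φ y) ∂μ ∂μ := by
  have m1 : ∀ z, Measurable fun x => k x z := fun z =>
    km.comp (measurable_id.prodMk measurable_const)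
  have m2 : ∀ z, Measurable fun x => k z x := fun z =>
    km.comp (measurable_const.prodMk measurable_id)
  have m3 : ∀ z, Measurable fun x => k x z * φ x := fun z => (m1 z).mul hφ
  have m4 : ∀ x y, Measurable fun z => k x z * k z y := fun x y => (m2 x).mul (m1 y)
  have h1 : ∀ z, (∫⁻ x, k x z * φ x ∂μ) ^ 2 =
      ∫⁻ x, ∫⁻ y, (k x z * k z y) * (φ x * φ y) ∂μ ∂μ := by
    intro z
    rw [sq, ← lintegral_mul_const _ (m3 z)]
    refine lintegral_congr fun x => ?_
    rw [← lintegral_const_mul _ (m3 z)]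
    refine lintegral_congr fun y => ?_
    rw [ks y z]; ring
  have hm : Measurable (fun p : (α × α) × α =>
      (k p.1.2 p.1.1 * k p.1.1 p.2) * (φ p.1.2 * φ p.2)) := by
    have a1 : Measurable (fun p : (α × α) × α => k p.1.2 p.1.1) :=
      km.comp (g := fun p : α × α => k p.1 p.2) (f := fun p : (α × α) × α => (p.1.2, p.1.1))
        (by fun_prop)
    have a2 : Measurable (fun p : (α × α) × α => k p.1.1 p.2) :=
      km.comp (g := fun p : α × α => k p.1 p.2) (f := fun p : (α × α) × α => (p.1.1, p.2))
        (by fun_prop)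
    exact (a1.mul a2).mul ((hφ.comp (measurable_snd.comp measurable_fst)).mul
      (hφ.comp measurable_snd))
  simp_rw [h1]
  rw [lintegral_lintegral_swap]
  swap
  · exact (Measurable.lintegral_prod_right (f := fun (p : α × α) (y : α) =>
      (k p.2 p.1 * k p.1 y) * (φ p.2 * φ y)) hm).aemeasurable
  refine lintegral_congr fun x => ?_
  rw [lintegral_lintegral_swap]
  swap
  · have := hm.comp (g := fun p : (α × α) × α =>
      (k p.1.2 p.1.1 * k p.1.1 p.2) * (φ p.1.2 * φ p.2))
      (f := fun p : α × α => ((p.1, x), p.2)) (by fun_prop)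
    exact this.aemeasurable
  refine lintegral_congr fun y => ?_
  rw [lintegral_mul_const _ (m4 x y)]

theorem N_sq (hn : 5 ≤ n) {φ : E n → ENNReal} (hφ : Measurable φ) :
    ∫⁻ z : E n, (∫⁻ x, ENNReal.ofReal (‖x - z‖ ^ (2 - (n : ℝ))) * φ x) ^ 2 =
    ENNReal.ofReal (c3 n) *
      ∫⁻ x : E n, ∫⁻ y : E n, ENNReal.ofReal (‖x - y‖ ^ (4 - (n : ℝ))) * (φ x * φ y) := by
  have : Nonempty (Fin n) := ⟨⟨0, by omega⟩⟩
  have hc : 0 ≤ c3 n := by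
    rw [c3_eq hn]
    have hn' : (5 : ℝ) ≤ n := by exact_mod_cast hn
    have := V_pos (n := n)
    exact div_nonneg (mul_nonneg this.le (by nlinarith)) (by linarith)
  rw [sq3 (k := fun x z : E n => ENNReal.ofReal (‖x - z‖ ^ (2 - (n : ℝ)))) (k_meas _)
    (k_swap _) hφ]
  rw [← lintegral_const_mul' _ _ ENNReal.ofReal_ne_top]
  refine lintegral_congr fun x => ?_
  rw [← lintegral_const_mul' _ _ ENNReal.ofReal_ne_top]
  refine lintegral_congr_ae ?_
  have hne : ∀ᵐ y : E n, y ≠ x :=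
    (measure_eq_zero_iff_ae_notMem.1 (measure_singleton (μ := (volume : Measure (E n))) x)).mono
        fun z hz => by simpa using hz
  filter_upwards [hne] with y hy
  rw [comp hn x y hy.symm, ENNReal.ofReal_mul hc, mul_assoc]

theorem en_flat (hn : 5 ≤ n) {f : E n → ℝ} (hf : Measurable f) (hf0 : ∀ x, 0 ≤ f x) {M : ℝ}
    (hM : ∀ x, f x * (W x) ^ (((n : ℝ) + 4) / 2) ≤ M) :
    ∫⁻ x : E n, ∫⁻ y : E n, ENNReal.ofReal (‖x - y‖ ^ (4 - (n : ℝ))) *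
      (ENNReal.ofReal (f x) * ENNReal.ofReal (f y)) =
    ENNReal.ofReal (en (ms n) Kn (fun x => f x * (W x) ^ (((n : ℝ) + 4) / 2))) := by
  have : NeZero n := ⟨by omega⟩
  have hn' : (5 : ℝ) ≤ n := by exact_mod_cast hn
  have := ms_fin hn
  have hV := V_pos (n := n)
  have hK := Kn_ker (n := n) (by rw [kappa hn]; positivity)
  set F : E n → ℝ := fun x => f x * (W x) ^ (((n : ℝ) + 4) / 2) with hF
  have hFm : Measurable F := hf.mul (W_cont.measurable.pow_const _)
  have hF0 : ∀ x, 0 ≤ F x := fun x => mul_nonneg (hf0 x) (Real.rpow_pos_of_pos (W_pos x) _).le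
  have hFa : ∀ x, |F x| ≤ M := fun x => by rw [abs_of_nonneg (hF0 x)]; exact hM x
  obtain ⟨hi, he⟩ := hK.en_eq (F := F) ⟨hFm, M, hFa⟩
  have hM0 : 0 ≤ M := (hF0 0).trans (hM 0)
  have hi2 : Integrable (fun z : E n × E n => Function.uncurry Kn z * (F z.1 * F z.2))
      ((ms n).prod (ms n)) := by
    refine hi.mul_bdd (c := M * M)
      ((hFm.comp measurable_fst).mul (hFm.comp measurable_snd)).aestronglyMeasurable
      (Eventually.of_forall fun z => ?_)
    rw [norm_mul]
    exact mul_le_mul (hFa _) (hFa _) (norm_nonneg _) hM0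
  have hKm : Measurable (fun z : E n × E n => ENNReal.ofReal (Function.uncurry Kn z * (F z.1 * F z.2))) :=
    (hK.meas.mul ((hFm.comp measurable_fst).mul (hFm.comp measurable_snd))).ennreal_ofReal
  rw [he, ofReal_integral_eq_lintegral_ofReal hi2 (Eventually.of_forall fun z =>
    mul_nonneg (hK.nonneg _ _) (mul_nonneg (hF0 _) (hF0 _))), lintegral_prod _ hKm.aemeasurable]
  have hd : Measurable (fun x : E n => ENNReal.ofReal ((W x) ^ (-(n : ℝ)))) := 
    (W_cont.measurable.pow_const _).ennreal_ofReal
  have hw : ∀ g : E n → ENNReal, Measurable g → ∫⁻ x, g x ∂(ms n) =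
      ∫⁻ x, ENNReal.ofReal ((W x) ^ (-(n : ℝ))) * g x := by
    intro g hg
    rw [ms, lintegral_withDensity_eq_lintegral_mul _ hd hg]
    rfl
  rw [hw _ hKm.lintegral_prod_right']
  refine lintegral_congr fun x => ?_
  rw [hw (fun y => ENNReal.ofReal (Function.uncurry Kn (x, y) * (F (x, y).1 * F (x, y).2)))
    (hKm.comp measurable_prodMk_left), ← lintegral_const_mul' _ _ ENNReal.ofReal_ne_top]
  refine lintegral_congr fun y => ?_
  have p1 := W_pos x
  have p2 := W_pos y
  rw [← ENNReal.ofReal_mul (hf0 x), ← ENNReal.ofReal_mul (by positivity),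
    ← ENNReal.ofReal_mul (by positivity), ← ENNReal.ofReal_mul (by positivity)]
  congr 1
  simp only [Function.uncurry, hF, Kn]
  have e1 : (W x * W y / ‖x - y‖ ^ 2) ^ (((n : ℝ) - 4) / 2) =
      W x ^ (((n : ℝ) - 4) / 2) * W y ^ (((n : ℝ) - 4) / 2) * ‖x - y‖ ^ (4 - (n : ℝ)) := by
    rw [Real.div_rpow (by positivity) (by positivity), Real.mul_rpow p1.le p2.le, div_eq_mul_inv,
      ← Real.rpow_neg (by positivity), ← Real.rpow_natCast, ← Real.rpow_mul (by positivity)]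
    congr 2; push_cast; ring
  have e2 : ∀ w : ℝ, 0 < w → w ^ (-(n : ℝ)) * (w ^ (((n : ℝ) - 4) / 2) * w ^ (((n : ℝ) + 4) / 2)) = 1 := by
    intro w hw
    rw [← Real.rpow_add hw, ← Real.rpow_add hw, ← Real.rpow_zero w]
    congr 1; ring
  rw [e1]
  calc _ = (W x ^ (-(n : ℝ)) * (W x ^ (((n : ℝ) - 4) / 2) * W x ^ (((n : ℝ) + 4) / 2))) *
      (W y ^ (-(n : ℝ)) * (W y ^ (((n : ℝ) - 4) / 2) * W y ^ (((n : ℝ) + 4) / 2))) *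
      (‖x - y‖ ^ (4 - (n : ℝ)) * (f x * f y)) := by rw [e2 _ p1, e2 _ p2]; ring
    _ = _ := by ring

theorem sob (hn : 5 ≤ n) {u : E n → ℝ} (hu : ContDiff ℝ 2 u) (hs : HasCompactSupport u) :
    ((∫ x, |u x| ^ (2 * (n : ℝ) / (n - 4)))) ^ 2 ≤
      (1 / (n * (n - 2) * V n)) ^ 2 * (∫ x, (laplacian u x) ^ 2) *
      (c3 n * ((2 * V n/(n+2)) * (Real.pi^((n:ℝ)/2) * Real.Gamma (n/2) / Real.Gamma n)^(-4/(n:ℝ)) *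
        (∫ x, |u x| ^ (2 * (n : ℝ) / (n - 4))) ^ (((n : ℝ) + 4) / n))) := by
  have hn' : (5 : ℝ) ≤ n := by exact_mod_cast hn
  have hn4 : (0 : ℝ) < n - 4 := by linarith
  have hV := V_pos (n := n)
  have hc : 0 ≤ c3 n := by
    rw [c3_eq hn]
    exact div_nonneg (mul_nonneg hV.le (by nlinarith)) (by linarith)
  set q1 : ℝ := (n + 4) / (n - 4) with hq1
  have hq1p : 0 < q1 := by positivity
  set f : E n → ℝ := fun x => |u x| ^ q1 with hf
  have hfc : Continuous f := hu.continuous.abs.rpow_const fun x => Or.inr hq1p.le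
  have hf0 : ∀ x, 0 ≤ f x := fun x => by positivity
  have hfs : HasCompactSupport f := by
    refine hs.mono fun x hx h => hx ?_
    simp only [hf]
    rw [h, abs_zero, Real.zero_rpow hq1p.ne']
  have hFc : Continuous fun x => f x * (W x) ^ (((n : ℝ) + 4) / 2) :=
    hfc.mul (W_cont.rpow_const fun x => Or.inl (W_pos x).ne')
  obtain ⟨M, hM⟩ := (hfs.mul_right (f' := fun x => (W x) ^ (((n : ℝ) + 4) / 2))).exists_bound_of_continuous hFc
  have hM' : ∀ x, f x * (W x) ^ (((n : ℝ) + 4) / 2) ≤ M := fun x => (le_abs_self _).trans (hM x)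
  have hM0 : 0 ≤ M := (norm_nonneg _).trans (hM 0)
  have hF0 : ∀ x, 0 ≤ f x * (W x) ^ (((n : ℝ) + 4) / 2) :=
    fun x => mul_nonneg (hf0 x) (Real.rpow_pos_of_pos (W_pos x) _).le
  have hls := hls_F hn _ M hFc.measurable hF0 hM' hM0
  have eA : ∫ x, (f x * (W x) ^ (((n : ℝ) + 4) / 2)) ^ (2*n/(n+4) : ℝ) ∂(ms n) =
      ∫ x, |u x| ^ (2 * (n : ℝ) / (n - 4)) := by
    rw [int_ms]
    congr 1; ext x
    rw [Real.mul_rpow (hf0 x) (Real.rpow_pos_of_pos (W_pos x) _).le, ← Real.rpow_mul (W_pos x).le]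
    have e1 : ((n : ℝ) + 4) / 2 * (2 * n / (n + 4)) = n := by field_simp
    have e2 : q1 * (2 * n / (n + 4)) = 2 * (n : ℝ) / (n - 4) := by rw [hq1]; field_simp
    simp only [hf]
    rw [e1, ← Real.rpow_mul (abs_nonneg _), e2, mul_left_comm, ← Real.rpow_add (W_pos x)]
    simp
  rw [eA] at hls
  set A := ∫ x, |u x| ^ (2 * (n : ℝ) / (n - 4)) with hA
  have hA0 : 0 ≤ A := integral_nonneg fun x => by positivity
  set D := ∫ x, (laplacian u x) ^ 2 with hD
  have hD0 : 0 ≤ D := integral_nonneg fun x => by positivity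
  set B := (2 * V n/(n+2)) * (Real.pi^((n:ℝ)/2) * Real.Gamma (n/2) / Real.Gamma n)^(-4/(n:ℝ)) *
    A ^ (((n : ℝ) + 4) / n) with hB
  have hG1 := Real.Gamma_pos_of_pos (s := (n : ℝ)) (by linarith)
  have hG2 := Real.Gamma_pos_of_pos (s := (n : ℝ) / 2) (by linarith)
  have hB0 : 0 ≤ B := by positivity
  set c2 : ℝ := 1 / (n * (n - 2) * V n) with hc2
  have hc20 : 0 ≤ c2 := by
    have : (0 : ℝ) < n - 2 := by linarith
    positivity
  have hq : ∀ x, |u x| ^ (2 * (n : ℝ) / (n - 4)) = |u x| * f x := by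
    intro x
    simp only [hf]
    rw [← Real.rpow_one_add' (abs_nonneg _) (by positivity)]
    congr 1; rw [hq1]; field_simp; ring
  have hAi : Integrable (fun x => |u x| * f x) :=
    (hu.continuous.abs.mul hfc).integrable_of_hasCompactSupport hfs.mul_left
  have a1 : ENNReal.ofReal A = ∫⁻ x, ENNReal.ofReal |u x| * ENNReal.ofReal (f x) := by
    rw [hA]
    simp_rw [hq]
    rw [ofReal_integral_eq_lintegral_ofReal hAi (Eventually.of_forall fun x =>
      mul_nonneg (abs_nonneg _) (hf0 x))]
    exact lintegral_congr fun x => ENNReal.ofReal_mul (abs_nonneg _)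
  have hLc := lap_cont hu
  have d1 : ENNReal.ofReal D = ∫⁻ x, ENNReal.ofReal |laplacian u x| ^ (2 : ℝ) := by
    have : Integrable (fun x => laplacian u x ^ 2) := by
      have h := (hLc.mul hLc).integrable_of_hasCompactSupport (μ := volume) ((lap_supp hs).mul_left)
      exact h.congr (Eventually.of_forall fun x => (sq (laplacian u x)).symm)
    rw [hD, ofReal_integral_eq_lintegral_ofReal this (Eventually.of_forall fun x => sq_nonneg _)]
    refine lintegral_congr fun x => ?_
    rw [ENNReal.rpow_two, ← ENNReal.ofReal_pow (abs_nonneg _), sq_abs]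
  set φ : E n → ENNReal := fun x => ENNReal.ofReal (f x) with hφ
  have hφm : Measurable φ := hfc.measurable.ennreal_ofReal
  set L : E n → ENNReal := fun x => ENNReal.ofReal |laplacian u x| with hL
  have hLm : Measurable L := hLc.abs.measurable.ennreal_ofReal
  set N : E n → ENNReal := fun z => ∫⁻ x, ENNReal.ofReal (‖x - z‖ ^ (2 - (n : ℝ))) * φ x with hN
  have hNm : Measurable N := by
    refine Measurable.lintegral_prod_right (f := fun (z x : E n) =>
      ENNReal.ofReal (‖x - z‖ ^ (2 - (n : ℝ))) * φ x) ?_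
    exact ((k_meas (n := n) (2 - (n : ℝ))).comp measurable_swap).mul (hφm.comp measurable_snd)
  have n1 : ∫⁻ z, N z ^ (2 : ℝ) ≤ ENNReal.ofReal (c3 n * B) := by
    simp_rw [ENNReal.rpow_two]
    rw [N_sq hn hφm, en_flat hn hfc.measurable hf0 hM', ← ENNReal.ofReal_mul hc]
    exact ENNReal.ofReal_le_ofReal (mul_le_mul_of_nonneg_left hls hc)
  have s1 : ENNReal.ofReal A ≤ ENNReal.ofReal c2 * ∫⁻ z, L z * N z := by
    calc ENNReal.ofReal A = ∫⁻ x, ENNReal.ofReal |u x| * φ x := a1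
      _ ≤ ∫⁻ x, ENNReal.ofReal c2 * ∫⁻ z, L z * (ENNReal.ofReal (‖x - z‖ ^ (2 - (n : ℝ))) * φ x) := by
        refine lintegral_mono fun x => ?_
        refine (mul_le_mul_left (rep hn hu hs x) (φ x)).trans_eq ?_
        rw [mul_assoc, ← lintegral_mul_const]
        · congr 1
          refine lintegral_congr fun z => ?_
          simp only [hL]; ring
        · exact ((k_meas (n := n) (2 - (n : ℝ))).comp measurable_prodMk_left).mul hLm
      _ = ENNReal.ofReal c2 * ∫⁻ z, ∫⁻ x, L z * (ENNReal.ofReal (‖x - z‖ ^ (2 - (n : ℝ))) * φ x) := by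
        rw [lintegral_const_mul' _ _ ENNReal.ofReal_ne_top, lintegral_lintegral_swap]
        exact ((hLm.comp measurable_snd).mul
          ((k_meas (n := n) (2 - (n : ℝ))).mul (hφm.comp measurable_fst))).aemeasurable
      _ = _ := by
        congr 1
        refine lintegral_congr fun z => ?_
        rw [lintegral_const_mul' _ _ ENNReal.ofReal_ne_top]
  have s2 : ∫⁻ z, L z * N z ≤ ENNReal.ofReal (D ^ (1 / 2 : ℝ) * (c3 n * B) ^ (1 / 2 : ℝ)) := by
    have h := ENNReal.lintegral_mul_le_Lp_mul_Lq volume Real.HolderConjugate.two_two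
      hLm.aemeasurable hNm.aemeasurable
    refine h.trans ?_
    rw [ENNReal.ofReal_mul (by positivity), ← ENNReal.ofReal_rpow_of_nonneg hD0 (by norm_num),
      ← ENNReal.ofReal_rpow_of_nonneg (mul_nonneg hc hB0) (by norm_num), d1]
    gcongr
  have s3 : ENNReal.ofReal A ≤ ENNReal.ofReal (c2 * (D ^ (1 / 2 : ℝ) * (c3 n * B) ^ (1 / 2 : ℝ))) := by
    rw [ENNReal.ofReal_mul hc20]
    exact s1.trans (by gcongr)
  have hcB : 0 ≤ c3 n * B := mul_nonneg hc hB0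
  have s4 := (ENNReal.ofReal_le_ofReal_iff (by positivity)).1 s3
  rw [← Real.sqrt_eq_rpow, ← Real.sqrt_eq_rpow] at s4
  calc A ^ 2 ≤ (c2 * (√D * √(c3 n * B))) ^ 2 := pow_le_pow_left₀ hA0 s4 2
    _ = _ := by rw [mul_pow, mul_pow, Real.sq_sqrt hD0, Real.sq_sqrt hcB]; ring

theorem fin_ineq (hn : 5 ≤ n) {u : E n → ℝ} (hu : ContDiff ℝ 2 u) (hs : HasCompactSupport u) :
    (∫ x, |u x| ^ (2 * (n : ℝ) / ((n : ℝ) - 4)))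
        ^ (((n : ℝ) - 4) / (n : ℝ)) ≤
      (Real.pi ^ 2 * (n : ℝ) * ((n : ℝ) - 4) * ((n : ℝ) ^ 2 - 4))⁻¹ *
        (Real.Gamma (n : ℝ) / Real.Gamma ((n : ℝ) / 2)) ^ ((4 : ℝ) / (n : ℝ)) *
      ∫ x, (laplacian u x) ^ 2 := by
  have h := sob hn hu hs
  have hn' : (5 : ℝ) ≤ n := by exact_mod_cast hn
  have hn4 : (0 : ℝ) < n - 4 := by linarith
  have hn2 : (0 : ℝ) < n - 2 := by linarith
  have hn22 : (0 : ℝ) < (n : ℝ) ^ 2 - 4 := by nlinarith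
  have hV := V_pos (n := n)
  have hG1 := Real.Gamma_pos_of_pos (s := (n : ℝ)) (by linarith)
  have hG2 := Real.Gamma_pos_of_pos (s := (n : ℝ) / 2) (by linarith)
  have hpi := Real.pi_pos
  have hA0 : 0 ≤ ∫ x, |u x| ^ (2 * (n : ℝ) / (n - 4)) := integral_nonneg fun x => by positivity
  have hD0 : 0 ≤ ∫ x, (laplacian u x) ^ 2 := integral_nonneg fun x => by positivity
  generalize (∫ x, |u x| ^ (2 * (n : ℝ) / (n - 4))) = A at *
  generalize (∫ x, (laplacian u x) ^ 2) = D at *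
  rcases hA0.eq_or_lt with h0 | hA
  · rw [← h0, Real.zero_rpow (by positivity)]
    positivity
  have e1 : (Real.pi^((n:ℝ)/2) * Real.Gamma (n/2) / Real.Gamma n)^(-4/(n:ℝ)) =
      (Real.pi ^ 2)⁻¹ * (Real.Gamma n / Real.Gamma (n / 2)) ^ ((4 : ℝ) / n) := by
    rw [mul_div_assoc, Real.mul_rpow (by positivity) (by positivity), ← Real.rpow_mul hpi.le,
      neg_div, Real.rpow_neg (by positivity), ← Real.inv_rpow (by positivity), inv_div]
    congr 1
    have : (n : ℝ) / 2 * -(4 / n) = -(2 : ℕ) := by push_cast; field_simp; norm_num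
    rw [this, Real.rpow_neg hpi.le, Real.rpow_natCast]
  rw [e1, c3_eq hn] at h
  generalize (Real.Gamma n / Real.Gamma (n / 2)) ^ ((4 : ℝ) / n) = γ at *
  have e2 : A ^ 2 = A ^ (((n : ℝ) - 4) / n) * A ^ (((n : ℝ) + 4) / n) := by
    rw [← Real.rpow_add hA, ← Real.rpow_natCast]
    congr 1; field_simp; push_cast; ring
  rw [e2] at h
  have hp : 0 < A ^ (((n : ℝ) + 4) / n) := Real.rpow_pos_of_pos hA _
  generalize A ^ (((n : ℝ) + 4) / n) = β at *
  generalize A ^ (((n : ℝ) - 4) / n) = α at *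
  generalize V n = v at *
  refine le_of_mul_le_mul_right (h.trans_eq ?_) hp
  have hf : (n : ℝ) ^ 2 - 4 = (n - 2) * (n + 2) := by ring
  rw [hf]
  field_simp
end fin

end HLS

/-- The optimal second-order Sobolev inequality on `ℝⁿ`, `n ≥ 5`:
for every smooth compactly supported `u : ℝⁿ → ℝ`,
`(∫_{ℝⁿ} |u|^{2♯} dx)^{2/2♯} ≤ K₀ ∫_{ℝⁿ} (Δu)² dx`, where `2♯ = 2n/(n-4)` and
`K₀ = [π² n(n-4)(n²-4)]⁻¹ (Γ(n)/Γ(n/2))^{4/n}`. -/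
theorem stmt_7 (n : ℕ) (hn : 5 ≤ n) (u : EuclideanSpace ℝ (Fin n) → ℝ)
    (hu : ContDiff ℝ (⊤ : ℕ∞) u) (hsupp : HasCompactSupport u) :
    (∫ x : EuclideanSpace ℝ (Fin n), |u x| ^ (2 * (n : ℝ) / ((n : ℝ) - 4)))
        ^ (((n : ℝ) - 4) / (n : ℝ)) ≤
      (Real.pi ^ 2 * (n : ℝ) * ((n : ℝ) - 4) * ((n : ℝ) ^ 2 - 4))⁻¹ *
        (Real.Gamma (n : ℝ) / Real.Gamma ((n : ℝ) / 2)) ^ ((4 : ℝ) / (n : ℝ)) *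
      ∫ x : EuclideanSpace ℝ (Fin n), (laplacian u x) ^ 2 := by
  exact HLS.fin_ineq hn (contDiff_infty.1 hu 2) hsupp
end

section
/- Let n ≥ 5 be an integer, C > 0, λ > 0, and t_λ = λ^{-n/2} / (C n (n-4)(n-2)²)^{n/4}. Let F₀, G₀ : (0,∞) → ℝ be differentiable at λ and suppose: (i) 0 < -F₀'(λ)/(λ(n-2)(n-1)) ≤ t_λ and 0 < -G₀'(λ)/(λ(n-2)(n-1)) ≤ t_λ; (ii) (-F₀'(λ)/(λ(n-2)(n-1)))^{(n-4)/n} ≤ C(n-4)²(4F₀(λ) - ((n-2)/(n-1))λF₀'(λ)); (iii) (-G₀'(λ)/(λ(n-2)(n-1)))^{(n-4)/n} = C(n-4)²(4G₀(λ) - ((n-2)/(n-1))λG₀'(λ)); (iv) F₀(λ) ≤ G₀(λ). Then F₀'(λ) ≥ G₀'(λ). -/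
/-- Pointwise derivative comparison (Step 4 of the proof of the main theorem).
Let `n ≥ 5`, `C > 0`, `λ > 0`, `t_λ = λ^{-n/2}/(Cn(n-4)(n-2)²)^{n/4}`, and let `F₀, G₀` be
differentiable at `λ` with derivatives `F₀'`, `G₀'`. If
(i) `0 < -F₀'/(λ(n-2)(n-1)) ≤ t_λ` and `0 < -G₀'/(λ(n-2)(n-1)) ≤ t_λ`,
(ii) `(-F₀'/(λ(n-2)(n-1)))^{(n-4)/n} ≤ C(n-4)²(4F₀(λ) - ((n-2)/(n-1))λF₀')`,
(iii) `(-G₀'/(λ(n-2)(n-1)))^{(n-4)/n} = C(n-4)²(4G₀(λ) - ((n-2)/(n-1))λG₀')`, and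
(iv) `F₀(λ) ≤ G₀(λ)`, then `F₀' ≥ G₀'`. -/
theorem stmt_12 (n : ℕ) (hn : 5 ≤ n) (C lam : ℝ) (hC : 0 < C) (hlam : 0 < lam)
    (F₀ G₀ : ℝ → ℝ) (F₀' G₀' : ℝ)
    (hFd : HasDerivAt F₀ F₀' lam) (hGd : HasDerivAt G₀ G₀' lam)
    (hF1 : 0 < -F₀' / (lam * ((n : ℝ) - 2) * ((n : ℝ) - 1)))
    (hF2 : -F₀' / (lam * ((n : ℝ) - 2) * ((n : ℝ) - 1)) ≤
      lam ^ (-(n : ℝ) / 2) / (C * (n : ℝ) * ((n : ℝ) - 4) * ((n : ℝ) - 2) ^ 2) ^ ((n : ℝ) / 4))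
    (hG1 : 0 < -G₀' / (lam * ((n : ℝ) - 2) * ((n : ℝ) - 1)))
    (hG2 : -G₀' / (lam * ((n : ℝ) - 2) * ((n : ℝ) - 1)) ≤
      lam ^ (-(n : ℝ) / 2) / (C * (n : ℝ) * ((n : ℝ) - 4) * ((n : ℝ) - 2) ^ 2) ^ ((n : ℝ) / 4))
    (hFineq : (-F₀' / (lam * ((n : ℝ) - 2) * ((n : ℝ) - 1))) ^ (((n : ℝ) - 4) / (n : ℝ)) ≤
      C * ((n : ℝ) - 4) ^ 2 * (4 * F₀ lam - (((n : ℝ) - 2) / ((n : ℝ) - 1)) * lam * F₀'))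
    (hGeq : (-G₀' / (lam * ((n : ℝ) - 2) * ((n : ℝ) - 1))) ^ (((n : ℝ) - 4) / (n : ℝ)) =
      C * ((n : ℝ) - 4) ^ 2 * (4 * G₀ lam - (((n : ℝ) - 2) / ((n : ℝ) - 1)) * lam * G₀'))
    (hFG : F₀ lam ≤ G₀ lam) :
    G₀' ≤ F₀' := by
  have hn' : (5 : ℝ) ≤ n := by exact_mod_cast hn
  have h1 : (0 : ℝ) < n - 1 := by linarith
  have h2 : (0 : ℝ) < n - 2 := by linarith
  have h4 : (0 : ℝ) < n - 4 := by linarith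
  have h0 : (0 : ℝ) < n := by linarith
  have hD : 0 < lam * ((n : ℝ) - 2) * ((n : ℝ) - 1) := by positivity
  by_contra hcon
  push Not at hcon
  have hst : -G₀' / (lam * ((n : ℝ) - 2) * ((n : ℝ) - 1)) <
      -F₀' / (lam * ((n : ℝ) - 2) * ((n : ℝ) - 1)) := by
    apply div_lt_div_of_pos_right _ hD
    linarith
  have eF : (((n : ℝ) - 2) / ((n : ℝ) - 1)) * lam * F₀' =
      -(((n : ℝ) - 2) ^ 2 * lam ^ 2 * (-F₀' / (lam * ((n : ℝ) - 2) * ((n : ℝ) - 1)))) := by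
    field_simp
  have eG : (((n : ℝ) - 2) / ((n : ℝ) - 1)) * lam * G₀' =
      -(((n : ℝ) - 2) ^ 2 * lam ^ 2 * (-G₀' / (lam * ((n : ℝ) - 2) * ((n : ℝ) - 1)))) := by
    field_simp
  rw [eF] at hFineq
  rw [eG] at hGeq
  clear eF eG
  generalize -G₀' / (lam * ((n : ℝ) - 2) * ((n : ℝ) - 1)) = s at *
  generalize -F₀' / (lam * ((n : ℝ) - 2) * ((n : ℝ) - 1)) = t at *
  set B : ℝ := C * (n : ℝ) * ((n : ℝ) - 4) * ((n : ℝ) - 2) ^ 2 with hB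
  have hBpos : 0 < B := by positivity
  set a : ℝ := ((n : ℝ) - 4) / n with ha
  have ha0 : 0 < a := by positivity
  have ha1 : a < 1 := by rw [ha, div_lt_one h0]; linarith
  have hT : t ^ (4 / (n : ℝ)) ≤ (lam ^ 2)⁻¹ / B := by
    refine (Real.rpow_le_rpow hF1.le hF2 (by positivity)).trans_eq ?_
    rw [Real.div_rpow (by positivity) (by positivity), ← Real.rpow_mul hlam.le,
      ← Real.rpow_mul hBpos.le]
    have e1 : -(n : ℝ) / 2 * (4 / n) = -(2 : ℕ) := by field_simp; norm_num
    have e2 : (n : ℝ) / 4 * (4 / n) = 1 := by field_simp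
    rw [e1, e2, Real.rpow_one, Real.rpow_neg hlam.le, Real.rpow_natCast]
  have hsplit : t ^ a * t ^ (4 / (n : ℝ)) = t := by
    rw [← Real.rpow_add hF1]
    have : a + 4 / (n : ℝ) = 1 := by rw [ha]; field_simp; ring
    rw [this, Real.rpow_one]
  have hta : 0 < t ^ a := Real.rpow_pos_of_pos hF1 a
  set K : ℝ := C * ((n : ℝ) - 4) ^ 2 * (((n : ℝ) - 2) ^ 2 * lam ^ 2) with hK
  have hKpos : 0 < K := by positivity
  have hKa : K * ((lam ^ 2)⁻¹ / B) = a := by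
    rw [hK, hB, ha]; field_simp
  have hKt : K * t ≤ a * t ^ a := by
    calc K * t = t ^ a * (K * t ^ (4 / (n : ℝ))) := by
          conv_lhs => rw [← hsplit]
          ring
      _ ≤ t ^ a * (K * ((lam ^ 2)⁻¹ / B)) := by gcongr
      _ = a * t ^ a := by rw [hKa]; ring
  have hr : s / t < 1 := (div_lt_one hF1).2 hst
  have hr0 : 0 < s / t := div_pos hG1 hF1
  have hb : (1 + (s / t - 1)) ^ a < 1 + a * (s / t - 1) :=
    rpow_one_add_lt_one_add_mul_self (by linarith) (by linarith) ha0 ha1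
  rw [add_sub_cancel, Real.div_rpow hG1.le hF1.le, div_lt_iff₀ hta] at hb
  have h5 : K * t * (1 - s / t) ≤ a * t ^ a * (1 - s / t) :=
    mul_le_mul_of_nonneg_right hKt (by linarith)
  have h6 : K * t * (1 - s / t) = K * t - K * s := by field_simp
  have h7 : C * ((n : ℝ) - 4) ^ 2 * F₀ lam ≤ C * ((n : ℝ) - 4) ^ 2 * G₀ lam :=
    mul_le_mul_of_nonneg_left hFG (by positivity)
  have h8 : t ^ a ≤ 4 * (C * ((n : ℝ) - 4) ^ 2 * F₀ lam) + K * t := by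
    refine hFineq.trans_eq ?_
    rw [hK]; ring
  have h9 : s ^ a = 4 * (C * ((n : ℝ) - 4) ^ 2 * G₀ lam) + K * s := by
    rw [hGeq, hK]; ring
  linarith
end

section
/- Let n ≥ 5 be an integer, C > 0, and t_λ = λ^{-n/2} / (C n (n-4)(n-2)²)^{n/4} for λ > 0. Let F₀, G₀ : (0,∞) → ℝ be differentiable functions such that for every λ > 0: (i) 0 < -F₀'(λ)/(λ(n-2)(n-1)) ≤ t_λ and 0 < -G₀'(λ)/(λ(n-2)(n-1)) ≤ t_λ; (ii) (-F₀'(λ)/(λ(n-2)(n-1)))^{(n-4)/n} ≤ C(n-4)²(4F₀(λ) - ((n-2)/(n-1))λF₀'(λ)); (iii) (-G₀'(λ)/(λ(n-2)(n-1)))^{(n-4)/n} = C(n-4)²(4G₀(λ) - ((n-2)/(n-1))λG₀'(λ)). If there exists δ₀ > 0 such that F₀(λ) ≥ G₀(λ) for all λ ∈ (0, δ₀), then F₀(λ) ≥ G₀(λ) for all λ > 0. -/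
open Filter Topology in
lemma aux_left (D : ℝ → ℝ) (d a x : ℝ) (h : HasDerivAt D d x) (hd : 0 < d) (hax : a < x) :
    ∃ y ∈ Set.Ioo a x, D y < D x := by
  have h1 := (hasDerivAt_iff_tendsto_slope.1 h).eventually (lt_mem_nhds hd)
  have h2 : 𝓝[<] x ≤ 𝓝[≠] x := nhdsWithin_mono x (fun y hy => ne_of_lt hy)
  have h3 := (h1.filter_mono h2).and (Ioo_mem_nhdsLT hax)
  obtain ⟨y, hy, hyI⟩ := h3.exists
  refine ⟨y, hyI, ?_⟩
  rw [slope_def_field] at hy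
  have h4 : y - x < 0 := by linarith [hyI.2]
  by_contra hc
  push Not at hc
  have : (D y - D x) / (y - x) ≤ 0 := div_nonpos_of_nonneg_of_nonpos (by linarith) h4.le
  first
  | linarith
  | (have : (D x - D y) / (x - y) ≤ 0 := div_nonpos_of_nonpos_of_nonneg (by linarith) (by linarith)
     linarith)

lemma aux_mono (n l M u v : ℝ) (hn : 5 ≤ n) (hl : 0 < l) (hM : 0 < M) (hv : 0 < v) (hvu : v ≤ u)
    (hu : u ≤ l ^ (-n / 2) / M ^ (n / 4)) :
    v ^ ((n - 4) / n) + (n - 4) / n * (M * l ^ 2) * (u - v) ≤ u ^ ((n - 4) / n) := by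
  have hu0 : 0 < u := by linarith
  have hp0 : 0 < (n - 4) / n := div_pos (by linarith) (by linarith)
  have hp1 : (n - 4) / n ≤ 1 := by rw [div_le_one (by linarith)]; linarith
  have hT : (l ^ (-n / 2) / M ^ (n / 4)) ^ (-4 / n) = M * l ^ 2 := by
    rw [Real.div_rpow (by positivity) (by positivity), ← Real.rpow_mul hl.le, ← Real.rpow_mul hM.le]
    have e1 : -n / 2 * (-4 / n) = (2 : ℕ) := by push_cast; field_simp; norm_num
    have e2 : n / 4 * (-4 / n) = -1 := by field_simp
    rw [e1, e2, Real.rpow_natCast, Real.rpow_neg_one]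
    field_simp
  have h1 : M * l ^ 2 ≤ u ^ (-4 / n) := by
    rw [← hT]
    exact Real.rpow_le_rpow_of_nonpos hu0 hu (div_nonpos_of_nonpos_of_nonneg (by norm_num) (by linarith))
  have hB := rpow_one_add_le_one_add_mul_self (s := v / u - 1)
    (by have := div_pos hv hu0; linarith) hp0.le hp1
  rw [show 1 + (v / u - 1) = v / u by ring, Real.div_rpow hv.le hu0.le,
    div_le_iff₀ (by positivity)] at hB
  have h3 : u ^ ((n - 4) / n) = u ^ (-4 / n) * u := by
    rw [← Real.rpow_add_one hu0.ne']
    congr 1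
    field_simp
    ring
  have h4 : (1 + (n - 4) / n * (v / u - 1)) * u ^ ((n - 4) / n)
      = u ^ ((n - 4) / n) - (n - 4) / n * (u - v) * u ^ (-4 / n) := by
    rw [h3]
    field_simp
    ring
  rw [h4] at hB
  have h5 : (n - 4) / n * (u - v) * (M * l ^ 2) ≤ (n - 4) / n * (u - v) * u ^ (-4 / n) :=
    mul_le_mul_of_nonneg_left h1 (mul_nonneg hp0.le (by linarith))
  linarith

/-- The ODE comparison principle (Step 4 of the proof of the main theorem).
Let `n ≥ 5`, `C > 0`, `t_λ = λ^{-n/2}/(Cn(n-4)(n-2)²)^{n/4}`, and let `F₀, G₀ : (0,∞) → ℝ`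
be differentiable and satisfy, for every `λ > 0`:
(i) `0 < -F₀'(λ)/(λ(n-2)(n-1)) ≤ t_λ` and `0 < -G₀'(λ)/(λ(n-2)(n-1)) ≤ t_λ`,
(ii) `(-F₀'(λ)/(λ(n-2)(n-1)))^{(n-4)/n} ≤ C(n-4)²(4F₀(λ) - ((n-2)/(n-1))λF₀'(λ))`,
(iii) `(-G₀'(λ)/(λ(n-2)(n-1)))^{(n-4)/n} = C(n-4)²(4G₀(λ) - ((n-2)/(n-1))λG₀'(λ))`.
If `F₀ ≥ G₀` on some interval `(0, δ₀)` with `δ₀ > 0`, then `F₀ ≥ G₀` on all of `(0,∞)`. -/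
theorem stmt_13 (n : ℕ) (hn : 5 ≤ n) (C : ℝ) (hC : 0 < C) (F₀ G₀ : ℝ → ℝ)
    (hFdiff : ∀ lam > (0 : ℝ), DifferentiableAt ℝ F₀ lam)
    (hGdiff : ∀ lam > (0 : ℝ), DifferentiableAt ℝ G₀ lam)
    (hF1 : ∀ lam > (0 : ℝ), 0 < -deriv F₀ lam / (lam * ((n : ℝ) - 2) * ((n : ℝ) - 1)))
    (hF2 : ∀ lam > (0 : ℝ), -deriv F₀ lam / (lam * ((n : ℝ) - 2) * ((n : ℝ) - 1)) ≤
      lam ^ (-(n : ℝ) / 2) / (C * (n : ℝ) * ((n : ℝ) - 4) * ((n : ℝ) - 2) ^ 2) ^ ((n : ℝ) / 4))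
    (hG1 : ∀ lam > (0 : ℝ), 0 < -deriv G₀ lam / (lam * ((n : ℝ) - 2) * ((n : ℝ) - 1)))
    (hG2 : ∀ lam > (0 : ℝ), -deriv G₀ lam / (lam * ((n : ℝ) - 2) * ((n : ℝ) - 1)) ≤
      lam ^ (-(n : ℝ) / 2) / (C * (n : ℝ) * ((n : ℝ) - 4) * ((n : ℝ) - 2) ^ 2) ^ ((n : ℝ) / 4))
    (hFineq : ∀ lam > (0 : ℝ),
      (-deriv F₀ lam / (lam * ((n : ℝ) - 2) * ((n : ℝ) - 1))) ^ (((n : ℝ) - 4) / (n : ℝ)) ≤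
        C * ((n : ℝ) - 4) ^ 2 *
          (4 * F₀ lam - (((n : ℝ) - 2) / ((n : ℝ) - 1)) * lam * deriv F₀ lam))
    (hGeq : ∀ lam > (0 : ℝ),
      (-deriv G₀ lam / (lam * ((n : ℝ) - 2) * ((n : ℝ) - 1))) ^ (((n : ℝ) - 4) / (n : ℝ)) =
        C * ((n : ℝ) - 4) ^ 2 *
          (4 * G₀ lam - (((n : ℝ) - 2) / ((n : ℝ) - 1)) * lam * deriv G₀ lam))
    (hsmall : ∃ δ₀ > (0 : ℝ), ∀ lam ∈ Set.Ioo (0 : ℝ) δ₀, G₀ lam ≤ F₀ lam) :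
    ∀ lam > (0 : ℝ), G₀ lam ≤ F₀ lam := by
  have hN : (5 : ℝ) ≤ n := by exact_mod_cast hn
  generalize (n : ℝ) = N at *
  have key : ∀ l > (0 : ℝ), F₀ l < G₀ l → deriv G₀ l < deriv F₀ l := by
    intro l hl hlt
    by_contra hc
    push Not at hc
    have hden : 0 < l * (N - 2) * (N - 1) :=
      mul_pos (mul_pos hl (by linarith)) (by linarith)
    have hM : 0 < C * N * (N - 4) * (N - 2) ^ 2 :=
      mul_pos (mul_pos (mul_pos hC (by linarith)) (by linarith)) (pow_pos (by linarith) 2)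
    have hvu : -deriv G₀ l / (l * (N - 2) * (N - 1)) ≤ -deriv F₀ l / (l * (N - 2) * (N - 1)) :=
      div_le_div_of_nonneg_right (by linarith) hden.le
    have h := aux_mono N l _ _ _ hN hl hM (hG1 l hl) hvu (hF2 l hl)
    have hf := hFineq l hl
    rw [hGeq l hl] at h
    have hN1 : N - 1 ≠ 0 := by linarith
    have hN2 : N - 2 ≠ 0 := by linarith
    have hN0 : N ≠ 0 := by linarith
    have e : (N - 4) / N * (C * N * (N - 4) * (N - 2) ^ 2 * l ^ 2) *
        (-deriv F₀ l / (l * (N - 2) * (N - 1)) - -deriv G₀ l / (l * (N - 2) * (N - 1)))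
        = C * (N - 4) ^ 2 * ((N - 2) / (N - 1) * l * deriv G₀ l - (N - 2) / (N - 1) * l * deriv F₀ l) := by
      field_simp
      ring
    rw [e] at h
    have hpos : 0 < C * (N - 4) ^ 2 := mul_pos hC (pow_pos (by linarith) 2)
    have := mul_lt_mul_of_pos_left hlt hpos
    linarith
  obtain ⟨δ, hδ, hs⟩ := hsmall
  intro l hl
  by_contra hc
  push Not at hc
  have hδl : δ ≤ l := by
    by_contra h
    push Not at h
    linarith [hs l ⟨hl, h⟩]
  have ha : 0 < δ / 2 := by linarith
  have hD : ∀ x > (0 : ℝ), HasDerivAt (fun y => F₀ y - G₀ y) (deriv F₀ x - deriv G₀ x) x :=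
    fun x hx => (hFdiff x hx).hasDerivAt.sub (hGdiff x hx).hasDerivAt
  obtain ⟨x, hx, hmin⟩ := (isCompact_Icc (a := δ / 2) (b := l)).exists_isMinOn
    ⟨l, by linarith, le_rfl⟩
    (fun x hx => (hD x (lt_of_lt_of_le ha hx.1)).continuousAt.continuousWithinAt)
  have hxl : F₀ x - G₀ x ≤ F₀ l - G₀ l := hmin ⟨by linarith, le_rfl⟩
  have hx0 : 0 < x := lt_of_lt_of_le ha hx.1
  have hax : δ / 2 < x := by
    refine lt_of_le_of_ne hx.1 fun h => ?_
    have := hs (δ / 2) ⟨ha, by linarith⟩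
    rw [← h] at hxl
    linarith
  have hk := key x hx0 (by linarith)
  obtain ⟨y, hy, hlt⟩ := aux_left _ _ _ x (hD x hx0) (by linarith) hax
  have : F₀ x - G₀ x ≤ F₀ y - G₀ y := hmin ⟨hy.1.le, hy.2.le.trans hx.2⟩
  linarith
end
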